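/- Let n ≥ 2, Ω a bounded domain with B₁ ⋐ Ω, and let f : Ω × ℝⁿ → ℝ be a Carathéodory function, convex in the second variable for a.e. x, satisfying for some 1 ≤ L < ∞, μ ≥ 0 and nonnegative g ∈ L^{p/(p−1)}(Ω): |z|^p − g(x)^{p/(p−1)} ≤ f(x,z) ≤ L|z|^q + g(x)^{p/(p−1)} and f(x,2z) ≤ μ + L·f(x,z), where 1 ≤ p < min{q, n}, q < ∞ and ε := min{1/q + 1/(n−1), 1} − 1/p ≥ 0. Let u be a Q-minimizer of F[u,A] = ∫_A f(x,∇u) dx. Then there exist c₁ = c₁(n,p,q,Q) ∈ [1,∞) and c₂ = c₂(n,p) ∈ [1,∞) such that for every k > h ≥ 0 and every 1/2 ≤ ρ < σ < 1: J(k,ρ) ≤ c₁ ( ω( c₂ J(h,σ)^{p_n^*/p} (k−h)^{−p_n^*} ) + L ( J(h,σ)^{1/p} / (k−h) )^{p_n^* q ε} J(h,σ)^{q/p} (σ−ρ)^{−γ} + ( J(h,σ)^{1/p} / (k−h) )^{p_n^* p/n} J(h,σ) ), where p_n^* := pn/(n−p), J(l,r) := ‖(u−l)₊‖_{W^{1,p}(B_r)}^p,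 γ := q − 1 + q·min{1/q + 1/(n−1), 1}, and ω(t) := ∫_0^t ((g^{1/(p−1)}·χ_{B₁})*(s))^p ds with h* the nonincreasing rearrangement. -/

import Mathlib

open MeasureTheory Metric Set
open scoped ENNReal NNReal Topology

noncomputable section

/-- `du` is the weak gradient of `u` on the open set `Ω ⊆ ℝⁿ`, in the sense of
integration by parts against smooth compactly supported test functions. -/
def IsWeakGradOn (n : ℕ) (Ω : Set (EuclideanSpace ℝ (Fin n)))
    (u : EuclideanSpace ℝ (Fin n) → ℝ)
    (du : EuclideanSpace ℝ (Fin n) → EuclideanSpace ℝ (Fin n)) : Prop :=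
  ∀ φ : EuclideanSpace ℝ (Fin n) → ℝ,
    ContDiff ℝ (⊤ : ℕ∞) φ → HasCompactSupport φ → tsupport φ ⊆ Ω →
    ∀ i : Fin n,
      (∫ x in Ω, u x * (fderiv ℝ φ x (EuclideanSpace.single i (1 : ℝ))))
        = - ∫ x in Ω, du x i * φ x

/-- `u ∈ W^{1,1}_loc(Ω)` (with weak gradient `du`) is a `Q`-minimizer of the functional
`F[v,A] = ∫_A f(x, ∇v(x)) dx`: for every `φ ∈ W^{1,1}(Ω)` (with weak gradient `dφ`)
whose support is compactly contained in `Ω`, `F[u, supp φ] < ∞` (encoded as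
integrability of `x ↦ f x (du x)` on `supp φ`) and
`F[u, supp φ] ≤ Q · F[u + φ, supp φ]`. -/
def IsQMinimizer (n : ℕ) (Ω : Set (EuclideanSpace ℝ (Fin n)))
    (f : EuclideanSpace ℝ (Fin n) → EuclideanSpace ℝ (Fin n) → ℝ) (Q : ℝ)
    (u : EuclideanSpace ℝ (Fin n) → ℝ)
    (du : EuclideanSpace ℝ (Fin n) → EuclideanSpace ℝ (Fin n)) : Prop :=
  IsWeakGradOn n Ω u du ∧ LocallyIntegrableOn u Ω ∧ LocallyIntegrableOn du Ω ∧
  ∀ (φ : EuclideanSpace ℝ (Fin n) → ℝ)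
    (dφ : EuclideanSpace ℝ (Fin n) → EuclideanSpace ℝ (Fin n)),
    IsWeakGradOn n Ω φ dφ → IntegrableOn φ Ω → IntegrableOn dφ Ω →
    IsCompact (tsupport φ) → tsupport φ ⊆ Ω →
    IntegrableOn (fun x => f x (du x)) (tsupport φ) ∧
    (IntegrableOn (fun x => f x (du x + dφ x)) (tsupport φ) →
      (∫ x in tsupport φ, f x (du x)) ≤ Q * ∫ x in tsupport φ, f x (du x + dφ x))

/-- The nonincreasing rearrangement `h*(t) = inf {σ > 0 : |{|h| > σ}| ≤ t}`. -/
def rearr (n : ℕ) (h : EuclideanSpace ℝ (Fin n) → ℝ) (t : ℝ) : ℝ :=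
  sInf {σ : ℝ | 0 < σ ∧ volume {x | σ < |h x|} ≤ ENNReal.ofReal t}

/-- `ω(t) := ∫_0^t ((g^{1/(p−1)} χ_{B₁})*(s))^p ds`. -/
def omegaFn (n : ℕ) (p : ℝ) (g : EuclideanSpace ℝ (Fin n) → ℝ) (t : ℝ) : ℝ :=
  ∫ s in Ioo (0 : ℝ) t,
    (rearr n ((ball (0 : EuclideanSpace ℝ (Fin n)) 1).indicator
      fun x => g x ^ (1 / (p - 1))) s) ^ p

/-- `J(l,r) := ‖(u−l)₊‖_{W^{1,p}(B_r)}^p = ∫_{B_r} ((u−l)₊)^p + ∫_{B_r ∩ {u>l}} |∇u|^p`,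
where `du` is the weak gradient of `u`. -/
def Jfun (n : ℕ) (p : ℝ) (u : EuclideanSpace ℝ (Fin n) → ℝ)
    (du : EuclideanSpace ℝ (Fin n) → EuclideanSpace ℝ (Fin n)) (l r : ℝ) : ℝ :=
  (∫ x in ball (0 : EuclideanSpace ℝ (Fin n)) r, max (u x - l) 0 ^ p) +
    ∫ x in ball (0 : EuclideanSpace ℝ (Fin n)) r ∩ {x | l < u x}, ‖du x‖ ^ p

open Filter ContinuousLinearMap in
theorem lintegral_rpow_le_measure_rpow_mul {α : Type*} {_ : MeasurableSpace α} (μ : Measure α)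
    {h : α → ℝ≥0∞} (hh : AEMeasurable h μ) {m : ℝ} (hm : 1 ≤ m) :
    (∫⁻ x, h x ∂μ) ^ m ≤ μ univ ^ (m - 1) * ∫⁻ x, h x ^ m ∂μ := by
  rcases hm.eq_or_lt with rfl | hm'
  · simp
  have hc : m.HolderConjugate (m / (m - 1)) := Real.HolderConjugate.conjExponent hm'
  have key := ENNReal.lintegral_mul_le_Lp_mul_Lq μ hc hh (aemeasurable_const (b := (1 : ℝ≥0∞)))
  simp only [Pi.mul_apply, mul_one, ENNReal.one_rpow, lintegral_const, one_mul] at key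
  have hm0 : 0 < m := by linarith
  calc (∫⁻ x, h x ∂μ) ^ m ≤ ((∫⁻ x, h x ^ m ∂μ) ^ (1 / m) * μ univ ^ (1 / (m / (m - 1)))) ^ m := by
        gcongr
    _ = _ := by
        rw [ENNReal.mul_rpow_of_nonneg _ _ hm0.le, ← ENNReal.rpow_mul, ← ENNReal.rpow_mul,
          one_div_mul_cancel hm0.ne', ENNReal.rpow_one, mul_comm]
        congr 2
        have : m - 1 ≠ 0 := by linarith
        field_simp

/-- Abbreviation for Euclidean space. -/
abbrev Eu (n : ℕ) := EuclideanSpace ℝ (Fin n)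

/-- A bump function at the origin supported in the ball of radius `1 / (j + 1)`. -/
def molBump (n j : ℕ) : ContDiffBump (0 : Eu n) where
  rIn := 1 / (2 * ((j : ℝ) + 1))
  rOut := 1 / ((j : ℝ) + 1)
  rIn_pos := by positivity
  rIn_lt_rOut := by
    apply one_div_lt_one_div_of_lt <;> have : (0 : ℝ) ≤ j := j.cast_nonneg <;> linarith

/-- The standard mollifying kernel at scale `1 / (j + 1)`. -/
def molKer (n j : ℕ) : Eu n → ℝ := (molBump n j).normed volume

/-- Mollification at scale `1 / (j + 1)`. -/
def mol {n : ℕ} {F : Type*} [NormedAddCommGroup F] [NormedSpace ℝ F] (j : ℕ) (f : Eu n → F) :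
    Eu n → F := fun x => ∫ y, molKer n j (x - y) • f y

section mol
variable {n : ℕ} {F : Type*} [NormedAddCommGroup F] [NormedSpace ℝ F]

theorem mol_eq_convolution (j : ℕ) (f : Eu n → F) :
    mol j f = convolution (molKer n j) f (ContinuousLinearMap.lsmul ℝ ℝ) volume := by
  ext x
  rw [convolution_eq_swap]
  rfl

theorem molKer_nonneg (j : ℕ) (x : Eu n) : 0 ≤ molKer n j x := ContDiffBump.nonneg_normed _ _

theorem contDiff_molKer (j : ℕ) : ContDiff ℝ (⊤ : ℕ∞) (molKer n j) :=
  ContDiffBump.contDiff_normed _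

theorem continuous_molKer (j : ℕ) : Continuous (molKer n j) := (contDiff_molKer j).continuous

theorem hasCompactSupport_molKer (j : ℕ) : HasCompactSupport (molKer n j) :=
  ContDiffBump.hasCompactSupport_normed _

theorem molKer_eq_zero {j : ℕ} {x : Eu n} (hx : 1 / ((j : ℝ) + 1) ≤ ‖x‖) : molKer n j x = 0 := by
  have h : Function.support (molKer n j) = ball 0 (1 / ((j : ℝ) + 1)) :=
    ContDiffBump.support_normed_eq _
  by_contra h0
  have : x ∈ Function.support (molKer n j) := h0
  rw [h, mem_ball_zero_iff] at this
  linarith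

theorem integral_molKer (j : ℕ) : ∫ x, molKer n j x = 1 := ContDiffBump.integral_normed _

theorem integrable_molKer (j : ℕ) : Integrable (molKer n j) :=
  ContDiffBump.integrable_normed _

theorem lintegral_molKer_sub_left (j : ℕ) (x : Eu n) :
    ∫⁻ y, ENNReal.ofReal (molKer n j (x - y)) = 1 := by
  rw [lintegral_sub_left_eq_self (fun y => ENNReal.ofReal (molKer n j y)) x,
    ← ofReal_integral_eq_lintegral_ofReal (integrable_molKer j)
      (Filter.Eventually.of_forall (molKer_nonneg j)), integral_molKer, ENNReal.ofReal_one]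

theorem lintegral_molKer_sub_right (j : ℕ) (y : Eu n) :
    ∫⁻ x, ENNReal.ofReal (molKer n j (x - y)) = 1 := by
  rw [lintegral_sub_right_eq_self (fun y => ENNReal.ofReal (molKer n j y)) y,
    ← ofReal_integral_eq_lintegral_ofReal (integrable_molKer j)
      (Filter.Eventually.of_forall (molKer_nonneg j)), integral_molKer, ENNReal.ofReal_one]

theorem contDiff_mol [CompleteSpace F] (j : ℕ) {f : Eu n → F} (hf : LocallyIntegrable f) :
    ContDiff ℝ (⊤ : ℕ∞) (mol j f) := by
  rw [mol_eq_convolution]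
  exact (hasCompactSupport_molKer j).contDiff_convolution_left _ (contDiff_molKer j) hf

theorem tendsto_rOut : Filter.Tendsto (fun j => (molBump n j).rOut) Filter.atTop (𝓝 0) :=
  tendsto_one_div_add_atTop_nhds_zero_nat

theorem ae_tendsto_mol [CompleteSpace F] {f : Eu n → F} (hf : LocallyIntegrable f) :
    ∀ᵐ x, Filter.Tendsto (fun j => mol j f x) Filter.atTop (𝓝 (f x)) := by
  have := ContDiffBump.ae_convolution_tendsto_right_of_locallyIntegrable (μ := volume)
    (φ := molBump n) (l := Filter.atTop) (K := 2) tendsto_rOut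
    (Filter.Eventually.of_forall fun j => le_of_eq ?_) hf
  · filter_upwards [this] with x hx
    simpa only [mol_eq_convolution, molKer] using hx
  · simp only [molBump]; field_simp

theorem enorm_mol_le (j : ℕ) (f : Eu n → F) (x : Eu n) :
    ‖mol j f x‖ₑ ≤ ∫⁻ y, ENNReal.ofReal (molKer n j (x - y)) * ‖f y‖ₑ := by
  refine (enorm_integral_le_lintegral_enorm _).trans (le_of_eq ?_)
  refine lintegral_congr fun y => ?_
  rw [enorm_smul, Real.enorm_of_nonneg (molKer_nonneg _ _)]

theorem enorm_mol_rpow_le (j : ℕ) {f : Eu n → F} (hf : AEStronglyMeasurable f) {m : ℝ} (hm : 1 ≤ m)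
    (x : Eu n) :
    ‖mol j f x‖ₑ ^ m ≤ ∫⁻ y, ENNReal.ofReal (molKer n j (x - y)) * ‖f y‖ₑ ^ m := by
  have hmeas : Measurable fun y : Eu n => ENNReal.ofReal (molKer n j (x - y)) :=
    ((continuous_molKer j).comp (by fun_prop)).measurable.ennreal_ofReal
  set ν := (volume : Measure (Eu n)).withDensity fun y => ENNReal.ofReal (molKer n j (x - y))
  have hν : ν univ = 1 := by
    rw [withDensity_apply _ MeasurableSet.univ, Measure.restrict_univ, lintegral_molKer_sub_left]
  have h1 := lintegral_rpow_le_measure_rpow_mul ν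
    (hf.enorm.mono_ac (withDensity_absolutelyContinuous _ _)) hm
  rw [hν, ENNReal.one_rpow, one_mul] at h1
  have e1 : ∀ g : Eu n → ℝ≥0∞, AEMeasurable g →
      ∫⁻ y, g y ∂ν = ∫⁻ y, ENNReal.ofReal (molKer n j (x - y)) * g y := fun g hg => by
    rw [lintegral_withDensity_eq_lintegral_mul₀ hmeas.aemeasurable hg]; rfl
  rw [e1 _ hf.enorm, e1 _ (hf.enorm.pow_const _)] at h1
  exact (ENNReal.rpow_le_rpow (enorm_mol_le j f x) (by linarith)).trans h1

theorem setLIntegral_enorm_mol_rpow_le (j : ℕ) {f : Eu n → F} (hf : AEStronglyMeasurable f)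
    {m : ℝ} (hm : 1 ≤ m) {A B : Set (Eu n)} (hB : MeasurableSet B)
    (hA : ∀ x ∈ A, ∀ y, ‖x - y‖ < 1 / ((j : ℝ) + 1) → y ∈ B) (hAm : MeasurableSet A) :
    ∫⁻ x in A, ‖mol j f x‖ₑ ^ m ≤ ∫⁻ x in B, ‖f x‖ₑ ^ m := by
  calc ∫⁻ x in A, ‖mol j f x‖ₑ ^ m
      ≤ ∫⁻ x in A, ∫⁻ y in B, ENNReal.ofReal (molKer n j (x - y)) * ‖f y‖ₑ ^ m := by
        refine setLIntegral_mono' hAm fun x hx => (enorm_mol_rpow_le j hf hm x).trans (le_of_eq ?_)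
        rw [← lintegral_indicator hB]
        refine lintegral_congr fun y => ?_
        by_cases hy : y ∈ B
        · rw [indicator_of_mem hy]
        · rw [indicator_of_notMem hy, molKer_eq_zero, ENNReal.ofReal_zero, zero_mul]
          by_contra h
          exact hy (hA x hx y (not_le.1 h))
    _ ≤ ∫⁻ x, ∫⁻ y in B, ENNReal.ofReal (molKer n j (x - y)) * ‖f y‖ₑ ^ m :=
        setLIntegral_le_lintegral _ _
    _ = ∫⁻ y in B, ∫⁻ x, ENNReal.ofReal (molKer n j (x - y)) * ‖f y‖ₑ ^ m := by
        apply lintegral_lintegral_swap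
        apply AEMeasurable.mul
        · exact (((continuous_molKer j).comp
            (by fun_prop : Continuous fun z : Eu n × Eu n => z.1 - z.2)).measurable.ennreal_ofReal).aemeasurable
        · exact (hf.restrict.enorm.pow_const m).comp_snd
    _ = _ := by
        refine lintegral_congr fun y => ?_
        rw [lintegral_mul_const _ ?_, lintegral_molKer_sub_right, one_mul]
        exact ((continuous_molKer j).comp (by fun_prop)).measurable.ennreal_ofReal

open Filter in
theorem tendsto_lintegral_mol_sub [CompleteSpace F] {f : Eu n → F} (hf : Integrable f) :
    Tendsto (fun j => ∫⁻ x, ‖mol j f x - f x‖ₑ) atTop (𝓝 0) := by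
  have hcont : ∀ j, Continuous (mol j f) := fun j => (contDiff_mol j hf.locallyIntegrable).continuous
  have hle : ∀ j, ∫⁻ x, ‖mol j f x‖ₑ ≤ ∫⁻ x, ‖f x‖ₑ := fun j => by
    have := setLIntegral_enorm_mol_rpow_le j hf.1 le_rfl (A := univ) MeasurableSet.univ
      (fun _ _ _ _ => mem_univ _) MeasurableSet.univ
    simpa using this
  set I := ∫⁻ x, ‖f x‖ₑ
  have hI : I ≠ ∞ := hf.2.ne
  set D := fun j => ∫⁻ x, ‖mol j f x - f x‖ₑ
  have hms : ∀ j, AEStronglyMeasurable (fun x => mol j f x - f x) volume := fun j =>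
    (hcont j).aestronglyMeasurable.sub hf.1
  have hDle : ∀ j, D j ≤ 2 * I := fun j => by
    calc D j ≤ ∫⁻ x, (‖mol j f x‖ₑ + ‖f x‖ₑ) := lintegral_mono fun x => enorm_sub_le
      _ = (∫⁻ x, ‖mol j f x‖ₑ) + I := by
        rw [lintegral_add_left' (hcont j).aestronglyMeasurable.enorm]
      _ ≤ I + I := by gcongr; exact hle j
      _ = 2 * I := (two_mul I).symm
  have ha : ∀ j, ∫⁻ x, (‖mol j f x‖ₑ + ‖f x‖ₑ - ‖mol j f x - f x‖ₑ) ≤ 2 * I - D j := fun j => by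
    apply ENNReal.le_sub_of_add_le_right (ne_top_of_le_ne_top (by finiteness) (hDle j))
    rw [← lintegral_add_right' _ (hms j).enorm]
    calc _ ≤ ∫⁻ x, (‖mol j f x‖ₑ + ‖f x‖ₑ) := by
          refine lintegral_mono fun x => ?_
          rw [tsub_add_cancel_of_le enorm_sub_le]
      _ = (∫⁻ x, ‖mol j f x‖ₑ) + I := by
        rw [lintegral_add_left' (hcont j).aestronglyMeasurable.enorm]
      _ ≤ I + I := by gcongr; exact hle j
      _ = 2 * I := (two_mul I).symm
  have hF : 2 * I ≤ liminf (fun j => 2 * I - D j) atTop := by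
    calc 2 * I = ∫⁻ x, liminf (fun j => ‖mol j f x‖ₑ + ‖f x‖ₑ - ‖mol j f x - f x‖ₑ) atTop := by
          rw [← lintegral_const_mul'' _ hf.1.enorm]
          refine lintegral_congr_ae ?_
          filter_upwards [ae_tendsto_mol hf.locallyIntegrable] with x hx
          have h1 : Tendsto (fun j => ‖mol j f x‖ₑ + ‖f x‖ₑ - ‖mol j f x - f x‖ₑ) atTop
              (𝓝 (‖f x‖ₑ + ‖f x‖ₑ - ‖f x - f x‖ₑ)) := by
            refine ENNReal.Tendsto.sub ?_ ?_ (Or.inl (by finiteness))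
            · exact (hx.enorm).add tendsto_const_nhds
            · exact (hx.sub tendsto_const_nhds).enorm
          rw [h1.liminf_eq]; simp [two_mul]
      _ ≤ liminf (fun j => ∫⁻ x, (‖mol j f x‖ₑ + ‖f x‖ₑ - ‖mol j f x - f x‖ₑ)) atTop := by
          apply lintegral_liminf_le'
          intro j
          exact ((hcont j).aestronglyMeasurable.enorm.add hf.1.enorm).sub (hms j).enorm
      _ ≤ _ := liminf_le_liminf (Eventually.of_forall ha)
  have hL : Tendsto (fun j => 2 * I - D j) atTop (𝓝 (2 * I)) :=
    tendsto_of_le_liminf_of_limsup_le hF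
      (limsup_le_of_le (by isBoundedDefault) (Eventually.of_forall fun j => tsub_le_self))
  have h2 : Tendsto (fun j => 2 * I - (2 * I - D j)) atTop (𝓝 (2 * I - 2 * I)) :=
    ENNReal.Tendsto.sub tendsto_const_nhds hL (Or.inl (by finiteness))
  rw [tsub_self] at h2
  refine h2.congr fun j => ?_
  exact ENNReal.sub_sub_cancel (by finiteness) (hDle j)

end mol

section weak
variable {n : ℕ}

theorem fderiv_eq_zero_of_notMem_tsupport {E F : Type*} [NormedAddCommGroup E] [NormedSpace ℝ E]
    [NormedAddCommGroup F] [NormedSpace ℝ F] {φ : E → F} {x : E} (hx : x ∉ tsupport φ) :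
    fderiv ℝ φ x = 0 := by
  by_contra h
  exact hx (support_fderiv_subset ℝ (f := φ) h)

theorem setIntegral_mul_eq_of_tsupport_subset {V : Set (Eu n)} {u φ : Eu n → ℝ}
    (hφ : ∀ x, x ∉ V → φ x = 0) :
    ∫ x in V, u x * φ x = ∫ x, u x * φ x :=
  setIntegral_eq_integral_of_forall_compl_eq_zero fun x hx => by rw [hφ x hx, mul_zero]

theorem isWeakGradOn_iff {V : Set (Eu n)} {u : Eu n → ℝ} {du : Eu n → Eu n} :
    IsWeakGradOn n V u du ↔ ∀ φ : Eu n → ℝ, ContDiff ℝ (⊤ : ℕ∞) φ → HasCompactSupport φ →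
      tsupport φ ⊆ V → ∀ i : Fin n,
      (∫ x, u x * (fderiv ℝ φ x (EuclideanSpace.single i (1 : ℝ)))) = - ∫ x, du x i * φ x := by
  refine forall_congr' fun φ => forall_congr' fun h1 => forall_congr' fun h2 =>
    forall_congr' fun h3 => forall_congr' fun i => ?_
  rw [setIntegral_mul_eq_of_tsupport_subset (φ := φ)
      (fun x hx => image_eq_zero_of_notMem_tsupport fun h => hx (h3 h)),
    setIntegral_mul_eq_of_tsupport_subset
      (fun x hx => by rw [fderiv_eq_zero_of_notMem_tsupport fun h => hx (h3 h)]; rfl)]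

theorem IsWeakGradOn.mono {V Ω : Set (Eu n)} {u : Eu n → ℝ} {du : Eu n → Eu n}
    (h : IsWeakGradOn n Ω u du) (hV : V ⊆ Ω) : IsWeakGradOn n V u du := by
  rw [isWeakGradOn_iff] at h ⊢
  exact fun φ h1 h2 h3 => h φ h1 h2 (h3.trans hV)

theorem fderiv_molKer_sub (j : ℕ) (x y v : Eu n) :
    fderiv ℝ (fun y => molKer n j (x - y)) y v = - fderiv ℝ (molKer n j) (x - y) v := by
  have h1 : HasFDerivAt (molKer n j) (fderiv ℝ (molKer n j) (x - y)) (x - y) :=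
    ((contDiff_molKer j).differentiable (by simp) _).hasFDerivAt
  have h2 : HasFDerivAt (fun y : Eu n => x - y) (-ContinuousLinearMap.id ℝ (Eu n)) y :=
    (hasFDerivAt_id y).const_sub x
  have h3 : HasFDerivAt (fun y => molKer n j (x - y)) _ y := h1.comp y h2
  rw [h3.fderiv]
  simp

theorem fderiv_mol_apply (j : ℕ) {f : Eu n → ℝ} (hf : LocallyIntegrable f) (x v : Eu n) :
    fderiv ℝ (mol j f) x v = ∫ y, fderiv ℝ (molKer n j) (x - y) v * f y := by
  rw [mol_eq_convolution, ((hasCompactSupport_molKer j).hasFDerivAt_convolution_left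
    (ContinuousLinearMap.lsmul ℝ ℝ) ((contDiff_molKer j).of_le (by simp)) hf x).fderiv,
    convolution_eq_swap, ContinuousLinearMap.integral_apply]
  · rfl
  · have hc : HasCompactSupport (fderiv ℝ (molKer n j)) := (hasCompactSupport_molKer j).fderiv ℝ
    have h := hc.convolutionExists_left
      ((ContinuousLinearMap.lsmul ℝ ℝ : ℝ →L[ℝ] ℝ →L[ℝ] ℝ).precompL (Eu n))
      ((contDiff_molKer j).continuous_fderiv (by simp)) hf x
    exact h.integrable_swap

theorem contDiff_molKer_sub (j : ℕ) (x : Eu n) :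
    ContDiff ℝ (⊤ : ℕ∞) fun y => molKer n j (x - y) :=
  (contDiff_molKer j).comp (contDiff_const.sub contDiff_id)

theorem tsupport_molKer_sub (j : ℕ) (x : Eu n) :
    tsupport (fun y => molKer n j (x - y)) ⊆ closedBall x (1 / ((j : ℝ) + 1)) := by
  apply closure_minimal _ isClosed_closedBall
  intro y hy
  by_contra h
  apply hy
  apply molKer_eq_zero
  rw [mem_closedBall, dist_comm, dist_eq_norm, not_le] at h
  exact h.le

theorem coord_integral {f : Eu n → Eu n} (hf : Integrable f) (i : Fin n) :
    (∫ x, f x) i = ∫ x, f x i :=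
  ((EuclideanSpace.proj i : Eu n →L[ℝ] ℝ).integral_comp_comm hf).symm

theorem integrable_molKer_smul (j : ℕ) {F : Type*} [NormedAddCommGroup F] [NormedSpace ℝ F]
    {f : Eu n → F} (hf : LocallyIntegrable f) (x : Eu n) :
    Integrable fun y => molKer n j (x - y) • f y := by
  have h := (hasCompactSupport_molKer j).convolutionExists_left
      (ContinuousLinearMap.lsmul ℝ ℝ : ℝ →L[ℝ] F →L[ℝ] F)
      (continuous_molKer j) hf x
  exact h.integrable_swap

/-- The gradient of the mollification is the mollification of the weak gradient. -/
theorem fderiv_mol_of_isWeakGradOn {V : Set (Eu n)} {w : Eu n → ℝ} {dw : Eu n → Eu n}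
    (hV : MeasurableSet V) (h : IsWeakGradOn n V w dw) (hw : IntegrableOn w V)
    (hdw : IntegrableOn dw V) {j : ℕ} {x : Eu n} (hx : closedBall x (1 / ((j : ℝ) + 1)) ⊆ V) :
    fderiv ℝ (mol j (V.indicator w)) x = innerSL ℝ (mol j (V.indicator dw) x) := by
  have hW : LocallyIntegrable (V.indicator w) := (hw.integrable_indicator hV).locallyIntegrable
  have hdW : LocallyIntegrable (V.indicator dw) := (hdw.integrable_indicator hV).locallyIntegrable
  rw [isWeakGradOn_iff] at h
  have hsub := (tsupport_molKer_sub j x).trans hx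
  have hcomp : HasCompactSupport fun y => molKer n j (x - y) :=
    HasCompactSupport.of_support_subset_isCompact (isCompact_closedBall x (1 / ((j : ℝ) + 1)))
      ((subset_tsupport _).trans (tsupport_molKer_sub j x))
  have hpt : ∀ i : Fin n, fderiv ℝ (mol j (V.indicator w)) x (EuclideanSpace.single i (1 : ℝ))
      = mol j (V.indicator dw) x i := fun i => by
    have h1 := h _ (contDiff_molKer_sub j x) hcomp hsub i
    rw [fderiv_mol_apply j hW]
    unfold mol
    rw [coord_integral (integrable_molKer_smul j hdW x)]
    simp only [fderiv_molKer_sub, mul_neg, integral_neg, neg_inj] at h1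
    calc _ = ∫ y, w y * fderiv ℝ (molKer n j) (x - y) (EuclideanSpace.single i (1 : ℝ)) := by
          refine integral_congr_ae (Filter.Eventually.of_forall fun y => ?_)
          by_cases hy : y ∈ V
          · simp [indicator_of_mem hy, mul_comm]
          · have := fderiv_eq_zero_of_notMem_tsupport fun h => hy (hsub h)
            have h2 := fderiv_molKer_sub j x y (EuclideanSpace.single i (1 : ℝ))
            rw [this] at h2
            have h3 : fderiv ℝ (molKer n j) (x - y) (EuclideanSpace.single i (1 : ℝ)) = 0 := by
              simpa using h2
            simp [h3]
      _ = _ := h1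
      _ = _ := by
          refine integral_congr_ae (Filter.Eventually.of_forall fun y => ?_)
          by_cases hy : y ∈ V
          · simp [indicator_of_mem hy, mul_comm]
          · have : molKer n j (x - y) = 0 :=
              image_eq_zero_of_notMem_tsupport (f := fun y => molKer n j (x - y)) fun h => hy (hsub h)
            simp [this]
  ext v
  rw [← (EuclideanSpace.basisFun (Fin n) ℝ).sum_repr v]
  simp only [EuclideanSpace.basisFun_apply, EuclideanSpace.basisFun_repr, map_sum, map_smul, hpt]
  refine Finset.sum_congr rfl fun i _ => ?_
  simp [innerSL_apply_apply, EuclideanSpace.inner_single_right]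

end weak

section approx
variable {n : ℕ}

open Filter

theorem eventually_one_div_lt {δ : ℝ} (hδ : 0 < δ) : ∀ᶠ j : ℕ in atTop, 1 / ((j : ℝ) + 1) < δ :=
  tendsto_one_div_add_atTop_nhds_zero_nat.eventually (gt_mem_nhds hδ)

theorem exists_smooth_approx {Ω K : Set (Eu n)} (hΩ : IsOpen Ω) (hK : IsCompact K) (hKΩ : K ⊆ Ω)
    {w : Eu n → ℝ} {dw : Eu n → Eu n} (h : IsWeakGradOn n Ω w dw) (hw : LocallyIntegrableOn w Ω)
    (hdw : LocallyIntegrableOn dw Ω) :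
    ∃ W : ℕ → Eu n → ℝ, (∀ j, ContDiff ℝ (⊤ : ℕ∞) (W j)) ∧
      (∀ᵐ x ∂volume.restrict K, Tendsto (fun j => W j x) atTop (𝓝 (w x))) ∧
      (∀ᵐ x ∂volume.restrict K,
        Tendsto (fun j => fderiv ℝ (W j) x) atTop (𝓝 (innerSL ℝ (dw x)))) ∧
      Tendsto (fun j => ∫⁻ x in K, ‖W j x - w x‖ₑ) atTop (𝓝 0) ∧
      Tendsto (fun j => ∫⁻ x in K, ‖fderiv ℝ (W j) x - innerSL ℝ (dw x)‖ₑ) atTop (𝓝 0) := by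
  obtain ⟨δ, hδ, hV⟩ := hK.exists_cthickening_subset_open hΩ hKΩ
  set V := cthickening δ K
  have hVc : IsCompact V := hK.cthickening
  have hVm : MeasurableSet V := hVc.measurableSet
  have hKV : K ⊆ V := self_subset_cthickening K
  have hwV := hw.integrableOn_compact_subset hV hVc
  have hdwV := hdw.integrableOn_compact_subset hV hVc
  have hwI := hwV.integrable_indicator hVm
  have hdwI := hdwV.integrable_indicator hVm
  have hball : ∀ᶠ j : ℕ in atTop, ∀ x ∈ K, fderiv ℝ (mol j (V.indicator w)) x =
      innerSL ℝ (mol j (V.indicator dw) x) := by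
    filter_upwards [eventually_one_div_lt hδ] with j hj x hx
    apply fderiv_mol_of_isWeakGradOn hVm (h.mono hV) hwV hdwV
    refine (closedBall_subset_closedBall hj.le).trans ?_
    exact closedBall_subset_cthickening hx δ
  have hKm : MeasurableSet K := hK.measurableSet
  refine ⟨fun j => mol j (V.indicator w), fun j => contDiff_mol j hwI.locallyIntegrable, ?_, ?_,
    ?_, ?_⟩
  · rw [ae_restrict_iff' hKm]
    filter_upwards [ae_tendsto_mol hwI.locallyIntegrable] with x hx hxK
    rwa [indicator_of_mem (hKV hxK)] at hx
  · rw [ae_restrict_iff' hKm]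
    filter_upwards [ae_tendsto_mol hdwI.locallyIntegrable] with x hx hxK
    rw [indicator_of_mem (hKV hxK)] at hx
    have := ((innerSL ℝ : Eu n →L⋆[ℝ] _).continuous.tendsto (dw x)).comp hx
    refine this.congr' ?_
    filter_upwards [hball] with j hj
    exact (hj x hxK).symm
  · refine tendsto_of_tendsto_of_tendsto_of_le_of_le tendsto_const_nhds
      (tendsto_lintegral_mol_sub hwI) (fun _ => zero_le) fun j => ?_
    refine le_trans (le_of_eq ?_) (setLIntegral_le_lintegral K _)
    refine setLIntegral_congr_fun hKm fun x hx => ?_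
    simp only [indicator_of_mem (hKV hx)]
  · refine tendsto_of_tendsto_of_tendsto_of_le_of_le' tendsto_const_nhds
      (tendsto_lintegral_mol_sub hdwI) (Eventually.of_forall fun _ => zero_le) ?_
    filter_upwards [hball] with j hj
    refine le_trans (le_of_eq ?_) (setLIntegral_le_lintegral K _)
    refine setLIntegral_congr_fun hKm fun x hx => ?_
    simp only [hj x hx, ← map_sub, indicator_of_mem (hKV hx)]
    rw [← ofReal_norm, ← ofReal_norm, innerSL_apply_norm]

theorem tendsto_integral_mul_of_tendsto_lintegral {α : Type*} {_ : MeasurableSpace α}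
    {μ : Measure α} {f : ℕ → α → ℝ} {g : α → ℝ} (hf : ∀ j, Integrable (f j) μ)
    (hg : Integrable g μ) (h : Tendsto (fun j => ∫⁻ x, ‖f j x - g x‖ₑ ∂μ) atTop (𝓝 0))
    {ψ : α → ℝ} (hψ : AEStronglyMeasurable ψ μ) {C : ℝ} (hC : ∀ x, ‖ψ x‖ ≤ C) :
    Tendsto (fun j => ∫ x, f j x * ψ x ∂μ) atTop (𝓝 (∫ x, g x * ψ x ∂μ)) := by
  have hb : ∀ {k : α → ℝ}, Integrable k μ → Integrable (fun x => k x * ψ x) μ := fun hk =>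
    hk.mul_bdd hψ (Eventually.of_forall hC)
  refine tendsto_integral_of_L1 _ (hb hg).1 (Eventually.of_forall fun j => hb (hf j)) ?_
  have h2 : Tendsto (fun j => (∫⁻ x, ‖f j x - g x‖ₑ ∂μ) * ENNReal.ofReal C) atTop (𝓝 0) := by
    simpa using ENNReal.Tendsto.mul_const h (Or.inr ENNReal.ofReal_ne_top)
  refine tendsto_of_tendsto_of_tendsto_of_le_of_le tendsto_const_nhds h2 (fun _ => zero_le)
    fun j => ?_
  dsimp only
  rw [← lintegral_mul_const' _ _ ENNReal.ofReal_ne_top]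
  refine lintegral_mono fun x => ?_
  rw [← sub_mul, enorm_mul]
  gcongr
  rw [← ofReal_norm]
  exact ENNReal.ofReal_le_ofReal (hC x)

theorem gradient_apply (Z : Eu n → ℝ) (x : Eu n) (i : Fin n) :
    gradient Z x i = fderiv ℝ Z x (EuclideanSpace.single i (1 : ℝ)) := by
  have : inner ℝ (gradient Z x) (EuclideanSpace.single i (1 : ℝ))
      = fderiv ℝ Z x (EuclideanSpace.single i (1 : ℝ)) := by
    rw [gradient, InnerProductSpace.toDual_symm_apply]
  rw [← this, EuclideanSpace.inner_single_right]
  simp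

theorem norm_gradient (Z : Eu n → ℝ) (x : Eu n) : ‖gradient Z x‖ = ‖fderiv ℝ Z x‖ := by
  rw [gradient, LinearIsometryEquiv.norm_map]

theorem measurable_gradient (Z : Eu n → ℝ) : Measurable (gradient Z) := by
  unfold gradient
  exact (InnerProductSpace.toDual ℝ (Eu n)).symm.continuous.measurable.comp
    (measurable_fderiv ℝ Z)

theorem LipschitzWith.norm_gradient_le {Z : Eu n → ℝ} {C : ℝ≥0} (hZ : LipschitzWith C Z)
    (x : Eu n) : ‖gradient Z x‖ ≤ C := by
  rw [norm_gradient]; exact norm_fderiv_le_of_lipschitz ℝ hZ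

theorem LipschitzWith.integral_fderiv_mul_eq {Z : Eu n → ℝ} {C : ℝ≥0} (hZ : LipschitzWith C Z)
    {g : Eu n → ℝ} (hg : ContDiff ℝ (⊤ : ℕ∞) g) (hgc : HasCompactSupport g) (v : Eu n) :
    ∫ x, fderiv ℝ Z x v * g x = - ∫ x, Z x * fderiv ℝ g x v := by
  obtain ⟨D, hD⟩ := hg.lipschitzWith_of_hasCompactSupport hgc (by simp)
  have := hZ.integral_lineDeriv_mul_eq (μ := volume) hD hgc v
  have h1 : ∫ x, lineDeriv ℝ Z x v * g x = ∫ x, fderiv ℝ Z x v * g x := by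
    refine integral_congr_ae ?_
    filter_upwards [hZ.ae_differentiableAt (μ := volume)] with x hx
    rw [hx.lineDeriv_eq_fderiv]
  rw [← h1, this, ← integral_neg]
  refine integral_congr_ae (Eventually.of_forall fun x => ?_)
  dsimp only
  rw [((hg.differentiable (by simp)) x).lineDeriv_eq_fderiv, map_neg]
  ring

theorem ContDiff.coord_fderiv_continuous {W : Eu n → ℝ} (hW : ContDiff ℝ (⊤ : ℕ∞) W) (v : Eu n) :
    Continuous fun x => fderiv ℝ W x v :=
  (hW.continuous_fderiv (by simp)).clm_apply continuous_const

theorem HasCompactSupport.exists_bound_fderiv {φ : Eu n → ℝ} (hφ : ContDiff ℝ (⊤ : ℕ∞) φ)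
    (hc : HasCompactSupport φ) (v : Eu n) :
    ∃ C, (∀ x, ‖φ x‖ ≤ C) ∧ ∀ x, ‖fderiv ℝ φ x v‖ ≤ C := by
  obtain ⟨C₁, h₁⟩ := hφ.continuous.bounded_above_of_compact_support hc
  obtain ⟨C₂, h₂⟩ := (hφ.coord_fderiv_continuous v).bounded_above_of_compact_support
    (hc.fderiv_apply (𝕜 := ℝ) v)
  exact ⟨max C₁ C₂, fun x => (h₁ x).trans (le_max_left _ _),
    fun x => (h₂ x).trans (le_max_right _ _)⟩

theorem tendsto_lintegral_coord {K : Set (Eu n)} {W : ℕ → Eu n → ℝ} {dw : Eu n → Eu n}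
    (h : Tendsto (fun j => ∫⁻ x in K, ‖fderiv ℝ (W j) x - innerSL ℝ (dw x)‖ₑ) atTop (𝓝 0))
    (i : Fin n) :
    Tendsto (fun j => ∫⁻ x in K,
      ‖fderiv ℝ (W j) x (EuclideanSpace.single i (1 : ℝ)) - dw x i‖ₑ) atTop (𝓝 0) := by
  refine tendsto_of_tendsto_of_tendsto_of_le_of_le tendsto_const_nhds h (fun _ => zero_le)
    fun j => lintegral_mono fun x => ?_
  have e : dw x i = innerSL ℝ (dw x) (EuclideanSpace.single i (1 : ℝ)) := by
    simp [innerSL_apply_apply, EuclideanSpace.inner_single_right]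
  rw [e, ← sub_apply, ← ofReal_norm, ← ofReal_norm]
  apply ENNReal.ofReal_le_ofReal
  refine (ContinuousLinearMap.le_opNorm _ _).trans (le_of_eq ?_)
  simp

theorem integrableOn_coord {K : Set (Eu n)} {dw : Eu n → Eu n} (h : IntegrableOn dw K) (i : Fin n) :
    IntegrableOn (fun x => dw x i) K :=
  (EuclideanSpace.proj i : Eu n →L[ℝ] ℝ).integrable_comp h

/-- Product rule for a Lipschitz factor. -/
theorem IsWeakGradOn.lipschitz_mul {Ω : Set (Eu n)} (hΩ : IsOpen Ω)
    {w : Eu n → ℝ} {dw : Eu n → Eu n} (h : IsWeakGradOn n Ω w dw) (hw : LocallyIntegrableOn w Ω)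
    (hdw : LocallyIntegrableOn dw Ω) {Z : Eu n → ℝ} {C : ℝ≥0} (hZ : LipschitzWith C Z)
    {M : ℝ} (hM : ∀ x, ‖Z x‖ ≤ M) :
    IsWeakGradOn n Ω (fun x => Z x * w x) (fun x => Z x • dw x + w x • gradient Z x) := by
  rw [isWeakGradOn_iff]
  intro φ h1 h2 h3 i
  set e : Eu n := EuclideanSpace.single i (1 : ℝ) with he
  set K := tsupport φ
  have hK : IsCompact K := h2
  obtain ⟨W, W1, -, -, W2, W3⟩ := exists_smooth_approx hΩ hK h3 h hw hdw
  obtain ⟨B, hB1, hB2⟩ := HasCompactSupport.exists_bound_fderiv h1 h2 e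
  have hwK := hw.integrableOn_compact_subset h3 hK
  have hdwK := integrableOn_coord (hdw.integrableOn_compact_subset h3 hK) i
  have hB0 : 0 ≤ B := (norm_nonneg _).trans (hB1 0)
  have hM0 : 0 ≤ M := (norm_nonneg _).trans (hM 0)
  have hφ0 : ∀ x, x ∉ K → φ x = 0 := fun x hx => image_eq_zero_of_notMem_tsupport hx
  have hφ1 : ∀ x, x ∉ K → fderiv ℝ φ x e = 0 := fun x hx => by
    rw [fderiv_eq_zero_of_notMem_tsupport hx]; rfl
  have hZm : Measurable Z := hZ.continuous.measurable
  have hdZ : ∀ x, ‖fderiv ℝ Z x e‖ ≤ C := fun x => by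
    refine ((fderiv ℝ Z x).le_opNorm e).trans ?_
    have : ‖e‖ = 1 := by simp [he]
    rw [this, mul_one]
    exact norm_fderiv_le_of_lipschitz ℝ hZ
  have hWi : ∀ j, IntegrableOn (W j) K := fun j => (W1 j).continuous.continuousOn.integrableOn_compact hK
  have hdWi : ∀ j, IntegrableOn (fun x => fderiv ℝ (W j) x e) K := fun j =>
    ((W1 j).coord_fderiv_continuous e).continuousOn.integrableOn_compact hK
  have hφm := h1.continuous.measurable
  have hdφm := (h1.coord_fderiv_continuous e).measurable
  have hdZm : Measurable fun x => fderiv ℝ Z x e := measurable_fderiv_apply_const ℝ Z e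
  have T1 := tendsto_integral_mul_of_tendsto_lintegral hWi hwK W2
    (ψ := fun x => fderiv ℝ Z x e * φ x) (C := C * B) (hdZm.mul hφm).aestronglyMeasurable
    (fun x => by rw [norm_mul]; gcongr; exacts [hdZ x, hB1 x])
  have T2 := tendsto_integral_mul_of_tendsto_lintegral hWi hwK W2
    (ψ := fun x => Z x * fderiv ℝ φ x e) (C := M * B) (hZm.mul hdφm).aestronglyMeasurable
    (fun x => by rw [norm_mul]; gcongr; exacts [hM x, hB2 x])
  have T3 := tendsto_integral_mul_of_tendsto_lintegral hdWi hdwK (tendsto_lintegral_coord W3 i)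
    (ψ := fun x => Z x * φ x) (C := M * B) (hZm.mul hφm).aestronglyMeasurable
    (fun x => by rw [norm_mul]; gcongr; exacts [hM x, hB1 x])
  have bd : ∀ {k : Eu n → ℝ} {ψ : Eu n → ℝ} {D : ℝ}, IntegrableOn k K → Measurable ψ →
      (∀ x, ‖ψ x‖ ≤ D) → IntegrableOn (fun x => k x * ψ x) K := fun hk hψ hD =>
    hk.mul_bdd hψ.aestronglyMeasurable (Eventually.of_forall hD)
  have bZφ : ∀ x, ‖Z x * φ x‖ ≤ M * B := fun x => by rw [norm_mul]; gcongr; exacts [hM x, hB1 x]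
  have bZdφ : ∀ x, ‖Z x * fderiv ℝ φ x e‖ ≤ M * B := fun x => by
    rw [norm_mul]; gcongr; exacts [hM x, hB2 x]
  have bdZφ : ∀ x, ‖fderiv ℝ Z x e * φ x‖ ≤ C * B := fun x => by
    rw [norm_mul]; gcongr; exacts [hdZ x, hB1 x]
  have mZφ : Measurable fun x => Z x * φ x := hZm.mul hφm
  have mZdφ : Measurable fun x => Z x * fderiv ℝ φ x e := hZm.mul hdφm
  have mdZφ : Measurable fun x => fderiv ℝ Z x e * φ x := hdZm.mul hφm
  have key : ∀ j, (∫ x in K, W j x * (fderiv ℝ Z x e * φ x)) +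
      (∫ x in K, W j x * (Z x * fderiv ℝ φ x e)) +
      (∫ x in K, fderiv ℝ (W j) x e * (Z x * φ x)) = 0 := fun j => by
    have hg : ContDiff ℝ (⊤ : ℕ∞) fun x => W j x * φ x := (W1 j).mul h1
    have hgc : HasCompactSupport fun x => W j x * φ x := h2.mul_left
    have := hZ.integral_fderiv_mul_eq hg hgc e
    have e2 : ∫ x, Z x * fderiv ℝ (fun x => W j x * φ x) x e =
        ∫ x in K, (W j x * (Z x * fderiv ℝ φ x e) + fderiv ℝ (W j) x e * (Z x * φ x)) := by
      rw [← setIntegral_eq_integral_of_forall_compl_eq_zero (s := K)]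
      · refine integral_congr_ae (Eventually.of_forall fun x => ?_)
        dsimp only
        rw [fderiv_fun_mul ((W1 j).differentiable (by simp) x) (h1.differentiable (by simp) x)]
        simp
        ring
      · intro x hx
        rw [fderiv_eq_zero_of_notMem_tsupport fun h => hx (tsupport_mul_subset_right h)]
        simp
    have e1 : ∫ x, fderiv ℝ Z x e * (W j x * φ x) = ∫ x in K, W j x * (fderiv ℝ Z x e * φ x) := by
      rw [← setIntegral_eq_integral_of_forall_compl_eq_zero (s := K)]
      · refine integral_congr_ae (Eventually.of_forall fun x => ?_)
        dsimp only; ring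
      · intro x hx; rw [hφ0 x hx]; simp
    rw [e1, e2, integral_add (bd (hWi j) mZdφ bZdφ) (bd (hdWi j) mZφ bZφ)] at this
    linarith
  have lim := (T1.add T2).add T3
  simp only [key] at lim
  have h0 := tendsto_nhds_unique tendsto_const_nhds lim
  have f1 : ∫ x, Z x * w x * fderiv ℝ φ x e = ∫ x in K, w x * (Z x * fderiv ℝ φ x e) := by
    rw [← setIntegral_eq_integral_of_forall_compl_eq_zero (s := K)]
    · refine integral_congr_ae (Eventually.of_forall fun x => ?_)
      dsimp only; ring
    · intro x hx; rw [hφ1 x hx]; simp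
  have f2 : ∫ x, (Z x • dw x + w x • gradient Z x) i * φ x =
      ∫ x in K, (dw x i * (Z x * φ x) + w x * (fderiv ℝ Z x e * φ x)) := by
    rw [← setIntegral_eq_integral_of_forall_compl_eq_zero (s := K)]
    · refine integral_congr_ae (Eventually.of_forall fun x => ?_)
      simp only [PiLp.add_apply, PiLp.smul_apply, smul_eq_mul, gradient_apply, he]; ring
    · intro x hx; rw [hφ0 x hx]; simp
  rw [f1, f2, integral_add (bd hdwK mZφ bZφ) (bd hwK mdZφ bdZφ)]
  linarith

end approx

section chain
variable {n : ℕ}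

open Filter

theorem tendsto_integral_mul_of_tendsto_lintegral_of_ae {α : Type*} {_ : MeasurableSpace α}
    {μ : Measure α} {f : ℕ → α → ℝ} {g : α → ℝ} (hf : ∀ j, Integrable (f j) μ)
    (hg : Integrable g μ) (h : Tendsto (fun j => ∫⁻ x, ‖f j x - g x‖ₑ ∂μ) atTop (𝓝 0))
    {ψ : ℕ → α → ℝ} {χ : α → ℝ} (hψ : ∀ j, AEStronglyMeasurable (ψ j) μ) {C : ℝ}
    (hC : ∀ j x, ‖ψ j x‖ ≤ C) (hχ : ∀ᵐ x ∂μ, Tendsto (fun j => ψ j x) atTop (𝓝 (χ x))) :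
    Tendsto (fun j => ∫ x, f j x * ψ j x ∂μ) atTop (𝓝 (∫ x, g x * χ x ∂μ)) := by
  have hb : ∀ j {k : α → ℝ}, Integrable k μ → Integrable (fun x => k x * ψ j x) μ := fun j _ hk =>
    hk.mul_bdd (hψ j) (Eventually.of_forall (hC j))
  have hd : ∀ j, Integrable (fun x => f j x - g x) μ := fun j => (hf j).sub hg
  have h1 : Tendsto (fun j => ∫ x, g x * ψ j x ∂μ) atTop (𝓝 (∫ x, g x * χ x ∂μ)) := by
    refine tendsto_integral_of_dominated_convergence (fun x => ‖g x‖ * C)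
      (fun j => (hb j hg).1) (hg.norm.mul_const C) (fun j => Eventually.of_forall fun x => ?_) ?_
    · rw [norm_mul]; gcongr; exact hC j x
    · filter_upwards [hχ] with x hx using hx.const_mul _
  have h2 : Tendsto (fun j => ∫ x, (f j x - g x) * ψ j x ∂μ) atTop (𝓝 0) := by
    have h3 := (ENNReal.tendsto_toReal ENNReal.zero_ne_top).comp h
    have h4 : Tendsto (fun j => (∫⁻ x, ‖f j x - g x‖ₑ ∂μ).toReal * C) atTop (𝓝 0) := by
      simpa using h3.mul_const C
    refine squeeze_zero_norm (fun j => ?_) h4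
    refine (norm_integral_le_integral_norm _).trans ?_
    rw [← integral_norm_eq_lintegral_enorm (hd j).1, ← integral_mul_const]
    refine integral_mono_of_nonneg (Eventually.of_forall fun x => norm_nonneg _)
      ((hd j).norm.mul_const C) (Eventually.of_forall fun x => ?_)
    dsimp only
    rw [norm_mul]; gcongr; exact hC j x
  have h5 := h2.add h1
  rw [zero_add] at h5
  refine h5.congr fun j => ?_
  rw [← integral_add (hb j (hd j)) (hb j hg)]
  exact integral_congr_ae (Eventually.of_forall fun x => by dsimp only; ring)

theorem IsWeakGradOn.comp {Ω : Set (Eu n)} (hΩ : IsOpen Ω)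
    {w : Eu n → ℝ} {dw : Eu n → Eu n} (h : IsWeakGradOn n Ω w dw) (hw : LocallyIntegrableOn w Ω)
    (hdw : LocallyIntegrableOn dw Ω) {G a : ℝ → ℝ} (hG : ∀ t, HasDerivAt G (a t) t)
    (ha : Continuous a) (hb : ∀ t, ‖a t‖ ≤ 1) :
    IsWeakGradOn n Ω (fun x => G (w x)) (fun x => a (w x) • dw x) := by
  rw [isWeakGradOn_iff]
  intro φ h1 h2 h3 i
  set e : Eu n := EuclideanSpace.single i (1 : ℝ) with he
  set K := tsupport φ
  have hK : IsCompact K := h2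
  obtain ⟨W, W1, Wae, -, W2, W3⟩ := exists_smooth_approx hΩ hK h3 h hw hdw
  obtain ⟨B, hB1, hB2⟩ := HasCompactSupport.exists_bound_fderiv h1 h2 e
  have hwK := hw.integrableOn_compact_subset h3 hK
  have hdwK := integrableOn_coord (hdw.integrableOn_compact_subset h3 hK) i
  have hB0 : 0 ≤ B := (norm_nonneg _).trans (hB1 0)
  have hφ0 : ∀ x, x ∉ K → φ x = 0 := fun x hx => image_eq_zero_of_notMem_tsupport hx
  have hφ1 : ∀ x, x ∉ K → fderiv ℝ φ x e = 0 := fun x hx => by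
    rw [fderiv_eq_zero_of_notMem_tsupport hx]; rfl
  have hWi : ∀ j, IntegrableOn (W j) K := fun j => (W1 j).continuous.continuousOn.integrableOn_compact hK
  have hdWi : ∀ j, IntegrableOn (fun x => fderiv ℝ (W j) x e) K := fun j =>
    ((W1 j).coord_fderiv_continuous e).continuousOn.integrableOn_compact hK
  have hGc : Continuous G := continuous_iff_continuousAt.2 fun t => (hG t).continuousAt
  have hGL : LipschitzWith 1 G := lipschitzWith_of_nnnorm_deriv_le
    (fun t => (hG t).differentiableAt) fun t => by rw [(hG t).deriv]; exact hb t
  have hGwK : IntegrableOn (fun x => G (w x)) K := by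
    have : IntegrableOn (fun x => |w x| + |G 0|) K :=
      hwK.abs.add (integrableOn_const (hK.measure_lt_top.ne))
    refine this.mono' (hGc.comp_aestronglyMeasurable hwK.1) (Eventually.of_forall fun x => ?_)
    have := hGL.dist_le_mul (w x) 0
    rw [Real.dist_eq, Real.dist_eq, sub_zero, NNReal.coe_one, one_mul] at this
    rw [Real.norm_eq_abs]
    have h5 := abs_add_le (G (w x) - G 0) (G 0)
    rw [sub_add_cancel] at h5
    linarith
  have W2' : Tendsto (fun j => ∫⁻ x in K, ‖G (W j x) - G (w x)‖ₑ) atTop (𝓝 0) := by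
    refine tendsto_of_tendsto_of_tendsto_of_le_of_le tendsto_const_nhds W2 (fun _ => zero_le)
      fun j => lintegral_mono fun x => ?_
    rw [← ofReal_norm, ← ofReal_norm]
    apply ENNReal.ofReal_le_ofReal
    simpa [Real.dist_eq] using hGL.dist_le_mul (W j x) (w x)
  have T1 := tendsto_integral_mul_of_tendsto_lintegral
    (fun j => (hGc.comp (W1 j).continuous).continuousOn.integrableOn_compact hK) hGwK W2'
    (ψ := fun x => fderiv ℝ φ x e) (C := B) (h1.coord_fderiv_continuous e).aestronglyMeasurable hB2
  have T2 := tendsto_integral_mul_of_tendsto_lintegral_of_ae hdWi hdwK (tendsto_lintegral_coord W3 i)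
    (ψ := fun j x => a (W j x) * φ x) (χ := fun x => a (w x) * φ x) (C := B)
    (fun j => ((ha.comp (W1 j).continuous).mul h1.continuous).aestronglyMeasurable)
    (fun j x => by
      rw [norm_mul]
      calc ‖a (W j x)‖ * ‖φ x‖ ≤ 1 * B := by gcongr; exacts [hb _, hB1 x]
        _ = B := one_mul B)
    (by filter_upwards [Wae] with x hx using ((ha.tendsto _).comp hx).mul_const _)
  have key : ∀ j, ∫ x in K, G (W j x) * fderiv ℝ φ x e =
      - ∫ x in K, fderiv ℝ (W j) x e * (a (W j x) * φ x) := fun j => by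
    have hd : ∀ x, HasFDerivAt (fun x => G (W j x)) (a (W j x) • fderiv ℝ (W j) x) x := fun x =>
      (hG _).comp_hasFDerivAt x ((W1 j).differentiable (by simp) x).hasFDerivAt
    have hgW := hGc.comp (W1 j).continuous
    have hfd : ∀ x, fderiv ℝ (fun x => G (W j x)) x e = a (W j x) * fderiv ℝ (W j) x e := fun x => by
      rw [(hd x).fderiv]; rfl
    have := integral_mul_fderiv_eq_neg_fderiv_mul_of_integrable (μ := volume)
      (f := fun x => G (W j x)) (g := φ) (v := e) ?_ ?_ ?_ (fun x _ => (hd x).differentiableAt)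
      (fun x _ => h1.differentiable (by simp) x)
    · rw [setIntegral_eq_integral_of_forall_compl_eq_zero (fun x hx => by rw [hφ1 x hx, mul_zero]),
        this, setIntegral_eq_integral_of_forall_compl_eq_zero
          (fun x hx => by rw [hφ0 x hx, mul_zero, mul_zero])]
      congr 1
      refine integral_congr_ae (Eventually.of_forall fun x => ?_)
      dsimp only
      rw [hfd]; ring
    · simp only [hfd]
      exact (((ha.comp (W1 j).continuous).mul ((W1 j).coord_fderiv_continuous e)).mul
        h1.continuous).integrable_of_hasCompactSupport h2.mul_left
    · exact (hgW.mul (h1.coord_fderiv_continuous e)).integrable_of_hasCompactSupport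
        ((h2.fderiv_apply (𝕜 := ℝ) e).mul_left)
    · exact (hgW.mul h1.continuous).integrable_of_hasCompactSupport h2.mul_left
  have h0 := tendsto_nhds_unique T1 (T2.neg.congr fun j => (key j).symm)
  rw [← setIntegral_eq_integral_of_forall_compl_eq_zero (s := K)
    (fun x hx => by rw [hφ1 x hx, mul_zero]), h0,
    ← setIntegral_eq_integral_of_forall_compl_eq_zero (s := K)
    (f := fun x => (a (w x) • dw x) i * φ x) (fun x hx => by rw [hφ0 x hx, mul_zero])]
  congr 1
  refine integral_congr_ae (Eventually.of_forall fun x => ?_)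
  simp only [PiLp.smul_apply, smul_eq_mul]; ring

theorem IsWeakGradOn.of_tendsto {Ω : Set (Eu n)} {w v : Eu n → ℝ} {dw dv : Eu n → Eu n}
    {w' : ℕ → Eu n → ℝ} {dw' : ℕ → Eu n → Eu n} (h : ∀ j, IsWeakGradOn n Ω (w' j) (dw' j))
    (hw : LocallyIntegrableOn v Ω) (hdw : LocallyIntegrableOn dv Ω)
    (hm : ∀ j, AEStronglyMeasurable (w' j) (volume.restrict Ω))
    (hdm : ∀ j, AEStronglyMeasurable (dw' j) (volume.restrict Ω))
    (hb : ∀ j x, ‖w' j x‖ ≤ ‖v x‖) (hdb : ∀ j x, ‖dw' j x‖ ≤ ‖dv x‖)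
    (hl : ∀ x, Tendsto (fun j => w' j x) atTop (𝓝 (w x)))
    (hdl : ∀ x, Tendsto (fun j => dw' j x) atTop (𝓝 (dw x))) : IsWeakGradOn n Ω w dw := by
  rw [isWeakGradOn_iff]
  intro φ h1 h2 h3 i
  set e : Eu n := EuclideanSpace.single i (1 : ℝ) with he
  set K := tsupport φ
  have hK : IsCompact K := h2
  obtain ⟨B, hB1, hB2⟩ := HasCompactSupport.exists_bound_fderiv h1 h2 e
  have hwK := hw.integrableOn_compact_subset h3 hK
  have hdwK := hdw.integrableOn_compact_subset h3 hK
  have hφ0 : ∀ x, x ∉ K → φ x = 0 := fun x hx => image_eq_zero_of_notMem_tsupport hx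
  have hφ1 : ∀ x, x ∉ K → fderiv ℝ φ x e = 0 := fun x hx => by
    rw [fderiv_eq_zero_of_notMem_tsupport hx]; rfl
  have T1 : Tendsto (fun j => ∫ x in K, w' j x * fderiv ℝ φ x e) atTop
      (𝓝 (∫ x in K, w x * fderiv ℝ φ x e)) := by
    refine tendsto_integral_of_dominated_convergence (fun x => ‖v x‖ * B) (fun j => ?_)
      (hwK.norm.mul_const B) (fun j => Eventually.of_forall fun x => ?_)
      (Eventually.of_forall fun x => (hl x).mul_const _)
    · exact ((hm j).mono_measure (Measure.restrict_mono h3 le_rfl)).mul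
        (h1.coord_fderiv_continuous e).aestronglyMeasurable
    · rw [norm_mul]; gcongr; exacts [hb j x, hB2 x]
  have T2 : Tendsto (fun j => ∫ x in K, dw' j x i * φ x) atTop
      (𝓝 (∫ x in K, dw x i * φ x)) := by
    refine tendsto_integral_of_dominated_convergence (fun x => ‖dv x‖ * B) (fun j => ?_)
      (hdwK.norm.mul_const B) (fun j => Eventually.of_forall fun x => ?_)
      (Eventually.of_forall fun x => Tendsto.mul_const _ ?_)
    · exact (((EuclideanSpace.proj i : Eu n →L[ℝ] ℝ).continuous.comp_aestronglyMeasurable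
        ((hdm j).mono_measure (Measure.restrict_mono h3 le_rfl)))).mul
        h1.continuous.aestronglyMeasurable
    · rw [norm_mul]; gcongr; exacts [(PiLp.norm_apply_le _ i).trans (hdb j x), hB1 x]
    · exact ((EuclideanSpace.proj i : Eu n →L[ℝ] ℝ).continuous.tendsto _).comp (hdl x)
  have e1 : ∀ w : Eu n → ℝ, ∫ x, w x * fderiv ℝ φ x e = ∫ x in K, w x * fderiv ℝ φ x e := fun w =>
    (setIntegral_eq_integral_of_forall_compl_eq_zero fun x hx => by rw [hφ1 x hx, mul_zero]).symm
  have e2 : ∀ w : Eu n → ℝ, ∫ x, w x * φ x = ∫ x in K, w x * φ x := fun w =>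
    (setIntegral_eq_integral_of_forall_compl_eq_zero fun x hx => by rw [hφ0 x hx, mul_zero]).symm
  rw [e1, e2 fun x => dw x i]
  refine tendsto_nhds_unique T1 (T2.neg.congr fun j => ?_)
  have := isWeakGradOn_iff.1 (h j) φ h1 h2 h3 i
  rw [e1, e2 fun x => dw' j x i] at this
  exact this.symm

/-- A continuous ramp approximating the Heaviside function at `k`. -/
def ramp (k : ℝ) (j : ℕ) (t : ℝ) : ℝ := min 1 (max 0 ((j : ℝ) * (t - k)))

theorem ramp_continuous (k : ℝ) (j : ℕ) : Continuous (ramp k j) := by unfold ramp; fun_prop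

theorem ramp_nonneg (k : ℝ) (j : ℕ) (t : ℝ) : 0 ≤ ramp k j t := by unfold ramp; positivity

theorem ramp_le_one (k : ℝ) (j : ℕ) (t : ℝ) : ramp k j t ≤ 1 := min_le_left _ _

theorem ramp_of_le {k t : ℝ} (h : t ≤ k) (j : ℕ) : ramp k j t = 0 := by
  unfold ramp
  rw [max_eq_left (mul_nonpos_of_nonneg_of_nonpos (Nat.cast_nonneg j) (by linarith))]
  simp

theorem tendsto_ramp (k t : ℝ) : Tendsto (fun j => ramp k j t) atTop (𝓝 (if k < t then 1 else 0)) := by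
  split_ifs with h
  · refine tendsto_const_nhds.congr' ?_
    filter_upwards [eventually_ge_atTop (Nat.ceil (1 / (t - k)))] with j hj
    have h1 : 1 / (t - k) ≤ j := (Nat.le_ceil _).trans (by exact_mod_cast hj)
    rw [div_le_iff₀ (by linarith)] at h1
    unfold ramp
    rw [min_eq_left (h1.trans (le_max_right _ _))]
  · simp only [ramp_of_le (not_lt.1 h)]; exact tendsto_const_nhds

theorem IsWeakGradOn.posPart {Ω : Set (Eu n)} (hΩ : IsOpen Ω)
    {u : Eu n → ℝ} {du : Eu n → Eu n} (h : IsWeakGradOn n Ω u du) (hu : LocallyIntegrableOn u Ω)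
    (hdu : LocallyIntegrableOn du Ω) (k : ℝ) :
    IsWeakGradOn n Ω (fun x => max (u x - k) 0) ({x | k < u x}.indicator du) := by
  have hG : ∀ j t, HasDerivAt (fun t => ∫ s in k..t, ramp k j s) (ramp k j t) t := fun j t =>
    intervalIntegral.integral_hasDerivAt_right ((ramp_continuous k j).intervalIntegrable _ _)
      ((ramp_continuous k j).stronglyMeasurableAtFilter _ _) (ramp_continuous k j).continuousAt
  have hn : ∀ j t, ‖ramp k j t‖ ≤ 1 := fun j t => by
    rw [Real.norm_of_nonneg (ramp_nonneg _ _ _)]; exact ramp_le_one _ _ _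
  have hGc : ∀ j, Continuous fun t => ∫ s in k..t, ramp k j s := fun j =>
    continuous_iff_continuousAt.2 fun t => (hG j t).continuousAt
  refine IsWeakGradOn.of_tendsto (v := fun x => u x - k) (dv := du)
    (fun j => h.comp hΩ hu hdu (hG j) (ramp_continuous k j) (hn j))
    (hu.sub ((locallyIntegrable_const k).locallyIntegrableOn Ω)) hdu (fun j => ?_) (fun j => ?_) (fun j x => ?_)
    (fun j x => ?_) (fun x => ?_) (fun x => ?_)
  · exact (hGc j).comp_aestronglyMeasurable hu.aestronglyMeasurable
  · exact ((ramp_continuous k j).comp_aestronglyMeasurable hu.aestronglyMeasurable).smul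
      hdu.aestronglyMeasurable
  · refine (intervalIntegral.norm_integral_le_of_norm_le_const fun s _ => hn j s).trans ?_
    rw [one_mul, Real.norm_eq_abs]
  · rw [norm_smul]
    exact mul_le_of_le_one_left (norm_nonneg _) (hn _ _)
  · have hlim := intervalIntegral.tendsto_integral_filter_of_dominated_convergence (μ := volume)
      (a := k) (b := u x) (F := fun j => ramp k j) (f := fun t => if k < t then (1 : ℝ) else 0)
      (l := atTop) (fun _ => 1)
      (Eventually.of_forall fun j => (ramp_continuous k j).aestronglyMeasurable)
      (Eventually.of_forall fun j => Eventually.of_forall fun t _ => hn j t)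
      intervalIntegrable_const (Eventually.of_forall fun t _ => tendsto_ramp k t)
    convert hlim using 2
    rcases le_total (u x) k with hk | hk
    · rw [max_eq_right (by linarith), intervalIntegral.integral_zero_ae]
      refine Eventually.of_forall fun t ht => ?_
      rw [uIoc_of_ge hk] at ht
      rw [if_neg (not_lt.2 ht.2)]
    · rw [max_eq_left (by linarith), intervalIntegral.integral_of_le hk,
        setIntegral_congr_fun (g := fun _ => (1 : ℝ)) measurableSet_Ioc fun t ht => if_pos ht.1]
      simp [hk]
  · have := (tendsto_ramp k (u x)).smul_const (du x)
    convert this using 2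
    by_cases hk : k < u x
    · simp [indicator, hk]
    · simp [indicator, hk]

end chain

section segment
variable {n : ℕ}

open Filter

theorem exists_approx_ball {x₀ : Eu n} {R : ℝ} {w : Eu n → ℝ} {dw : Eu n → Eu n}
    (h : IsWeakGradOn n (ball x₀ R) w dw) (hw : IntegrableOn w (ball x₀ R))
    (hdw : IntegrableOn dw (ball x₀ R)) :
    ∃ W : ℕ → Eu n → ℝ, (∀ j, ContDiff ℝ (⊤ : ℕ∞) (W j)) ∧
      (∀ᵐ x, x ∈ ball x₀ R → Tendsto (fun j => W j x) atTop (𝓝 (w x))) ∧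
      ∀ s < R, ∀ᶠ j in atTop, ∀ m : ℝ, 1 ≤ m →
        ∫⁻ x in ball x₀ s, ‖W j x‖ₑ ^ m ≤ ∫⁻ x in ball x₀ R, ‖w x‖ₑ ^ m ∧
        ∫⁻ x in ball x₀ s, ‖fderiv ℝ (W j) x‖ₑ ^ m ≤ ∫⁻ x in ball x₀ R, ‖dw x‖ₑ ^ m := by
  have hwI := hw.integrable_indicator measurableSet_ball
  have hdwI := hdw.integrable_indicator measurableSet_ball
  have hco : ∀ {F : Type} [NormedAddCommGroup F] (f : Eu n → F) (m : ℝ),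
      ∫⁻ x in ball x₀ R, ‖(ball x₀ R).indicator f x‖ₑ ^ m = ∫⁻ x in ball x₀ R, ‖f x‖ₑ ^ m := by
    intro F _ f m
    refine setLIntegral_congr_fun measurableSet_ball fun x hx => ?_
    simp only [indicator_of_mem hx]
  refine ⟨fun j => mol j ((ball x₀ R).indicator w), fun j => contDiff_mol j hwI.locallyIntegrable,
    ?_, fun s hs => ?_⟩
  · filter_upwards [ae_tendsto_mol hwI.locallyIntegrable] with x hx hxK
    rwa [indicator_of_mem hxK] at hx
  · filter_upwards [eventually_one_div_lt (sub_pos.2 hs)] with j hj m hm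
    have hsub : ∀ x ∈ ball x₀ s, ∀ y, ‖x - y‖ < 1 / ((j : ℝ) + 1) → y ∈ ball x₀ R := by
      intro x hx y hy
      rw [mem_ball, dist_eq_norm] at hx ⊢
      have : y - x₀ = (x - x₀) - (x - y) := by abel
      rw [this]
      refine (norm_sub_le _ _).trans_lt ?_
      linarith
    constructor
    · rw [← hco w]
      exact setLIntegral_enorm_mol_rpow_le j hwI.1 hm measurableSet_ball hsub measurableSet_ball
    · rw [← hco dw]
      refine le_trans (le_of_eq ?_)
        (setLIntegral_enorm_mol_rpow_le j hdwI.1 hm measurableSet_ball hsub measurableSet_ball)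
      refine setLIntegral_congr_fun measurableSet_ball fun x hx => ?_
      rw [fderiv_mol_of_isWeakGradOn measurableSet_ball h hw hdw, ← ofReal_norm, ← ofReal_norm,
        innerSL_apply_norm]
      intro y hy
      rw [mem_closedBall] at hy
      rw [mem_ball] at hx ⊢
      have := dist_triangle y x x₀
      linarith

theorem lintegral_comp_smul_add (h : Eu n → ℝ≥0∞) {c : ℝ} (hc : 0 < c) (b : Eu n) :
    ∫⁻ x, h (c • x + b) = ENNReal.ofReal ((c ^ n)⁻¹) * ∫⁻ x, h x := by
  have h1 : ∫⁻ x, h (c • x + b) = ∫⁻ x, (fun y => h (y + b)) (c • x) := rfl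
  have hme : MeasurableEmbedding fun x : Eu n => c • x :=
    (Homeomorph.smulOfNeZero c hc.ne').measurableEmbedding
  rw [h1, ← hme.lintegral_map (fun y => h (y + b)), Measure.map_addHaar_smul _ hc.ne', lintegral_smul_measure,
    lintegral_add_right_eq_self]
  rw [finrank_euclideanSpace_fin, abs_of_pos (by positivity), smul_eq_mul]

theorem setLIntegral_convex_comb_le {B : Set (Eu n)} (hB : Convex ℝ B) (hBm : MeasurableSet B)
    (h : Eu n → ℝ≥0∞) {t : ℝ} (ht0 : 0 ≤ t) (ht1 : t < 1) {z : Eu n} (hz : z ∈ B) :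
    ∫⁻ x in B, h ((1 - t) • x + t • z) ≤ ENNReal.ofReal (((1 - t) ^ n)⁻¹) * ∫⁻ x in B, h x := by
  rw [← lintegral_indicator hBm h, ← lintegral_comp_smul_add _ (sub_pos.2 ht1) (t • z)]
  refine le_trans (le_of_eq ?_) (setLIntegral_le_lintegral B _)
  refine setLIntegral_congr_fun hBm fun x hx => ?_
  have : (1 - t) • x + t • z ∈ B := hB hx hz (by linarith) ht0 (by ring)
  simp only [indicator_of_mem this]

theorem setLIntegral_convex_comb_le' {B : Set (Eu n)} (hB : Convex ℝ B) (hBm : MeasurableSet B)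
    (h : Eu n → ℝ≥0∞) {t : ℝ} (ht0 : 0 < t) (ht1 : t ≤ 1) {x : Eu n} (hx : x ∈ B) :
    ∫⁻ z in B, h ((1 - t) • x + t • z) ≤ ENNReal.ofReal ((t ^ n)⁻¹) * ∫⁻ x in B, h x := by
  have := setLIntegral_convex_comb_le hB hBm h (t := 1 - t) (by linarith) (by linarith) hx
  simp only [sub_sub_cancel] at this
  refine le_trans (le_of_eq ?_) this
  simp only [add_comm]

theorem enorm_sub_le_lintegral_segment {v : Eu n → ℝ} (hv : ContDiff ℝ (⊤ : ℕ∞) v) (x z : Eu n) :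
    ‖v x - v z‖ₑ ≤ ‖x - z‖ₑ * ∫⁻ t in Ioo (0 : ℝ) 1, ‖fderiv ℝ v ((1 - t) • x + t • z)‖ₑ := by
  set γ : ℝ → Eu n := fun t => (1 - t) • x + t • z
  have hγ : ∀ t, HasDerivAt γ (z - x) t := fun t => by
    have h1 : HasDerivAt (fun t : ℝ => (1 - t) • x) ((-1 : ℝ) • x) t :=
      ((hasDerivAt_id t).const_sub 1).smul_const x
    have h2 : HasDerivAt (fun t : ℝ => t • z) ((1 : ℝ) • z) t := (hasDerivAt_id t).smul_const z
    have h3 := h1.add h2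
    have e3 : (-1 : ℝ) • x + (1 : ℝ) • z = z - x := by rw [neg_smul, one_smul, one_smul]; abel
    rwa [e3] at h3
  have hd : ∀ t, HasDerivAt (fun t => v (γ t)) (fderiv ℝ v (γ t) (z - x)) t := fun t =>
    ((hv.differentiable (by simp) (γ t)).hasFDerivAt).comp_hasDerivAt t (hγ t)
  have hγc : Continuous γ := by fun_prop
  have hcont : Continuous fun t => fderiv ℝ v (γ t) (z - x) :=
    ((hv.continuous_fderiv (by simp)).comp hγc).clm_apply continuous_const
  have h_int := intervalIntegral.integral_eq_sub_of_hasDerivAt (a := 0) (b := 1)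
    (fun t _ => hd t) (hcont.intervalIntegrable _ _)
  have e : ‖v x - v z‖ₑ = ‖∫ t in Ioo (0 : ℝ) 1, fderiv ℝ v (γ t) (z - x)‖ₑ := by
    rw [← integral_Ioc_eq_integral_Ioo, ← intervalIntegral.integral_of_le zero_le_one, h_int,
      ← enorm_neg]
    simp [γ]
  rw [e]
  refine (enorm_integral_le_lintegral_enorm _).trans ?_
  rw [← lintegral_const_mul' _ _ enorm_ne_top]
  refine lintegral_mono fun t => ?_
  rw [mul_comm, ← enorm_neg (x - z), neg_sub]
  exact (fderiv ℝ v (γ t)).le_opENorm _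

theorem continuous_enorm_fderiv {v : Eu n → ℝ} (hv : ContDiff ℝ (⊤ : ℕ∞) v) :
    Continuous fun x => ‖fderiv ℝ v x‖ₑ := (hv.continuous_fderiv (by simp)).enorm

theorem poincare_double {v : Eu n → ℝ} (hv : ContDiff ℝ (⊤ : ℕ∞) v) {m : ℝ} (hm : 1 ≤ m)
    (x₀ : Eu n) {s : ℝ} :
    ∫⁻ x in ball x₀ s, ∫⁻ z in ball x₀ s, ‖v x - v z‖ₑ ^ m ≤
      ENNReal.ofReal (2 * s) ^ m * (2 ^ n * (volume (ball x₀ s) *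
        ∫⁻ x in ball x₀ s, ‖fderiv ℝ v x‖ₑ ^ m)) := by
  set B := ball x₀ s
  have hBm : MeasurableSet B := measurableSet_ball
  have hBc : Convex ℝ B := convex_ball x₀ s
  set G : Eu n → ℝ≥0∞ := fun x => ‖fderiv ℝ v x‖ₑ ^ m
  have hGm : Measurable G := (continuous_enorm_fderiv hv).measurable.pow_const m
  have hpt : ∀ x ∈ B, ∀ z ∈ B, ‖v x - v z‖ₑ ^ m ≤
      ENNReal.ofReal (2 * s) ^ m * ∫⁻ t in Ioo (0 : ℝ) 1, G ((1 - t) • x + t • z) := by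
    intro x hx z hz
    have h1 := enorm_sub_le_lintegral_segment hv x z
    have h2 : ‖x - z‖ₑ ≤ ENNReal.ofReal (2 * s) := by
      rw [← ofReal_norm]
      apply ENNReal.ofReal_le_ofReal
      rw [← dist_eq_norm]
      have := dist_triangle_right x z x₀
      rw [mem_ball] at hx hz
      linarith
    have h3 := lintegral_rpow_le_measure_rpow_mul (volume.restrict (Ioo (0 : ℝ) 1))
      (h := fun t => ‖fderiv ℝ v ((1 - t) • x + t • z)‖ₑ)
      (((continuous_enorm_fderiv hv).comp (by fun_prop)).measurable.aemeasurable) hm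
    simp only [Measure.restrict_apply_univ, Real.volume_Ioo, sub_zero, ENNReal.ofReal_one,
      ENNReal.one_rpow, one_mul] at h3
    calc ‖v x - v z‖ₑ ^ m ≤ (ENNReal.ofReal (2 * s) *
          ∫⁻ t in Ioo (0 : ℝ) 1, ‖fderiv ℝ v ((1 - t) • x + t • z)‖ₑ) ^ m := by
          gcongr
          exact h1.trans (by gcongr)
      _ ≤ _ := by
          rw [ENNReal.mul_rpow_of_nonneg _ _ (by linarith)]
          gcongr
  have hGt : ∀ t ∈ Ioo (0 : ℝ) 1, ∫⁻ x in B, ∫⁻ z in B, G ((1 - t) • x + t • z) ≤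
      2 ^ n * (volume B * ∫⁻ x in B, G x) := by
    intro t ht
    have h2n : ∀ c : ℝ, 1 / 2 ≤ c → ENNReal.ofReal ((c ^ n)⁻¹) ≤ 2 ^ n := fun c hc => by
      have : (2 : ℝ≥0∞) ^ n = ENNReal.ofReal (2 ^ n) := by
        rw [ENNReal.ofReal_pow (by norm_num)]; norm_num
      rw [this, ← inv_pow]
      apply ENNReal.ofReal_le_ofReal
      have : c⁻¹ ≤ 2 := by rw [inv_le_comm₀ (by linarith) (by norm_num)]; linarith
      gcongr
    rcases le_total t (1 / 2) with h | h
    · rw [lintegral_lintegral_swap]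
      · calc ∫⁻ z in B, ∫⁻ x in B, G ((1 - t) • x + t • z)
            ≤ ∫⁻ z in B, 2 ^ n * ∫⁻ x in B, G x := by
              refine setLIntegral_mono' hBm fun z hz => ?_
              refine (setLIntegral_convex_comb_le hBc hBm G ht.1.le ht.2 hz).trans ?_
              gcongr
              exact h2n _ (by linarith)
          _ = _ := by rw [setLIntegral_const]; ring
      · exact (hGm.comp (by fun_prop)).aemeasurable
    · calc ∫⁻ x in B, ∫⁻ z in B, G ((1 - t) • x + t • z)
            ≤ ∫⁻ z in B, 2 ^ n * ∫⁻ x in B, G x := by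
              refine setLIntegral_mono' hBm fun z hz => ?_
              refine (setLIntegral_convex_comb_le' hBc hBm G ht.1 ht.2.le hz).trans ?_
              gcongr
              exact h2n _ (by linarith)
          _ = _ := by rw [setLIntegral_const]; ring
  calc ∫⁻ x in B, ∫⁻ z in B, ‖v x - v z‖ₑ ^ m
      ≤ ∫⁻ x in B, ∫⁻ z in B, ENNReal.ofReal (2 * s) ^ m *
          ∫⁻ t in Ioo (0 : ℝ) 1, G ((1 - t) • x + t • z) :=
        setLIntegral_mono' hBm fun x hx => setLIntegral_mono' hBm fun z hz => hpt x hx z hz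
    _ = ENNReal.ofReal (2 * s) ^ m *
          ∫⁻ x in B, ∫⁻ z in B, ∫⁻ t in Ioo (0 : ℝ) 1, G ((1 - t) • x + t • z) := by
        have hc : ENNReal.ofReal (2 * s) ^ m ≠ ∞ := by finiteness
        rw [← lintegral_const_mul' _ _ hc]
        exact lintegral_congr fun x => lintegral_const_mul' _ _ hc
    _ = ENNReal.ofReal (2 * s) ^ m *
          ∫⁻ t in Ioo (0 : ℝ) 1, ∫⁻ x in B, ∫⁻ z in B, G ((1 - t) • x + t • z) := by
        congr 1
        have h1 : ∀ x, ∫⁻ z in B, ∫⁻ t in Ioo (0 : ℝ) 1, G ((1 - t) • x + t • z) =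
            ∫⁻ t in Ioo (0 : ℝ) 1, ∫⁻ z in B, G ((1 - t) • x + t • z) := fun x =>
          lintegral_lintegral_swap (hGm.comp (by fun_prop)).aemeasurable
        simp only [h1]
        apply lintegral_lintegral_swap
        refine Measurable.aemeasurable ?_
        refine Measurable.lintegral_prod_right'
          (f := fun q : (Eu n × ℝ) × Eu n => G ((1 - q.1.2) • q.1.1 + q.1.2 • q.2)) ?_
        exact hGm.comp (by fun_prop)
    _ ≤ ENNReal.ofReal (2 * s) ^ m *
          ∫⁻ t in Ioo (0 : ℝ) 1, 2 ^ n * (volume B * ∫⁻ x in B, G x) := by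
        exact mul_le_mul_right (setLIntegral_mono' measurableSet_Ioo hGt) _
    _ = _ := by rw [setLIntegral_const]; simp

end segment

section weakSobolev
variable {n : ℕ}

open Filter

theorem lintegral_le_ofReal_of_rpow {α : Type*} {_ : MeasurableSpace α} (μ : Measure α)
    {h : α → ℝ≥0∞} (hh : AEMeasurable h μ) {p ω b : ℝ} (hp : 1 ≤ p) (hω : 0 ≤ ω) (hb : 0 ≤ b)
    (hμ : μ univ ≤ ENNReal.ofReal ω) (hI : ∫⁻ x, h x ^ p ∂μ ≤ ENNReal.ofReal (b ^ p)) :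
    ∫⁻ x, h x ∂μ ≤ ENNReal.ofReal (ω ^ (1 - 1 / p) * b) := by
  have hp0 : 0 < p := by linarith
  have h1 := lintegral_rpow_le_measure_rpow_mul μ hh hp
  rw [← ENNReal.rpow_le_rpow_iff hp0]
  refine h1.trans ?_
  rw [ENNReal.ofReal_rpow_of_nonneg (by positivity) hp0.le, Real.mul_rpow (by positivity) hb,
    ENNReal.ofReal_mul (by positivity), ← Real.rpow_mul hω]
  have : (1 - 1 / p) * p = p - 1 := by field_simp
  rw [this, ← ENNReal.ofReal_rpow_of_nonneg hω (by linarith)]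
  gcongr

theorem setLIntegral_rpow_le_ofReal {r τ : ℝ} (hr : r < -1) (hτ : 0 < τ) :
    ∫⁻ t in Ico τ 1, ENNReal.ofReal (t ^ r) ≤ ENNReal.ofReal (- τ ^ (r + 1) / (r + 1)) := by
  rw [← integral_Ioi_rpow_of_lt hr hτ, ofReal_integral_eq_lintegral_ofReal
    (integrableOn_Ioi_rpow_of_lt hr hτ)]
  · rw [setLIntegral_congr Ioi_ae_eq_Ici]
    exact lintegral_mono_set Ico_subset_Ici_self
  · filter_upwards [ae_restrict_mem measurableSet_Ioi] with t ht
    exact Real.rpow_nonneg (hτ.trans ht).le _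

theorem weak_sobolev_smooth_of_ball {p : ℝ} (hp : 1 ≤ p) (hpn : p < n) {s : ℝ}
    (hs1 : s ≤ 1) {v : Eu n → ℝ} (hv : ContDiff ℝ (⊤ : ℕ∞) v) {a : ℝ} (ha : 0 < a)
    (hA1 : ∫⁻ x in ball (0 : Eu n) s, ‖v x‖ₑ ^ p ≤ ENNReal.ofReal (a ^ p))
    (hA2 : ∫⁻ x in ball (0 : Eu n) s, ‖fderiv ℝ v x‖ₑ ^ p ≤ ENNReal.ofReal (a ^ p))
    {τ l ω : ℝ} (hτ : 0 < τ) (hτ1 : τ ≤ 1 / 2) (hl : 0 < l) (hω : 0 < ω)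
    (hωV : volume (ball (0 : Eu n) s) = ENNReal.ofReal ω)
    (hτl : (1 + 2 * (p / (n - p))) * ω ^ (- (1 / p)) * a * τ ^ (1 - n / p) ≤ l / 2) :
    volume (ball (0 : Eu n) s ∩ {x | ENNReal.ofReal l < ‖v x‖ₑ}) ≤
      ENNReal.ofReal (4 ^ p * 2 ^ n * τ ^ p * (a / l) ^ p) := by
  have hp0 : 0 < p := by linarith
  have hnp : 0 < (n : ℝ) - p := by linarith
  set B := ball (0 : Eu n) s
  have hBm : MeasurableSet B := measurableSet_ball
  have hBc : Convex ℝ B := convex_ball _ s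
  set G : Eu n → ℝ≥0∞ := fun x => ‖fderiv ℝ v x‖ₑ
  have hGm : Measurable G := (continuous_enorm_fderiv hv).measurable
  have hvm : Measurable fun x => ‖v x‖ₑ := hv.continuous.enorm.measurable
  set F : Eu n → ℝ≥0∞ := fun x => ∫⁻ t in Ioo 0 τ, ∫⁻ z in B, G ((1 - t) • x + t • z)
  have hG3 : Measurable fun q : (Eu n × ℝ) × Eu n => G ((1 - q.1.2) • q.1.1 + q.1.2 • q.2) :=
    hGm.comp (by fun_prop)
  have hG2 : Measurable fun q : Eu n × ℝ => ∫⁻ z in B, G ((1 - q.2) • q.1 + q.2 • z) :=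
    hG3.lintegral_prod_right'
  have hFm : Measurable F := hG2.lintegral_prod_right'
  have hVe : ∀ p : ℝ, 0 ≤ p → volume B ^ p = ENNReal.ofReal (ω ^ p) := fun p hp => by
    rw [hωV, ENNReal.ofReal_rpow_of_nonneg hω.le hp]
  set c := 1 + 2 * (p / (n - p))
  have hM : ∀ x ∈ B, ∫⁻ t in Ico τ 1, ∫⁻ z in B, G ((1 - t) • x + t • z) ≤
      ENNReal.ofReal (ω ^ (1 - 1 / p) * a * (p / (n - p) * τ ^ (1 - n / p))) := by
    intro x hx
    calc _ ≤ ∫⁻ t in Ico τ 1, ENNReal.ofReal (ω ^ (1 - 1 / p) * a) *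
          ENNReal.ofReal (t ^ (-(n / p))) := by
          refine setLIntegral_mono' measurableSet_Ico fun t ht => ?_
          have ht0 : 0 < t := hτ.trans_le ht.1
          have h1 := setLIntegral_convex_comb_le' hBc hBm (fun y => G y ^ p) ht0 ht.2.le hx
          rw [← ENNReal.ofReal_mul (by positivity), mul_assoc]
          refine lintegral_le_ofReal_of_rpow (volume.restrict B)
            (hGm.comp (by fun_prop)).aemeasurable hp hω.le (by positivity)
            (by rw [Measure.restrict_apply_univ, hωV]) ?_
          refine h1.trans ?_
          calc _ ≤ ENNReal.ofReal ((t ^ n)⁻¹) * ENNReal.ofReal (a ^ p) := by gcongr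
            _ = _ := by
              rw [← ENNReal.ofReal_mul (by positivity), Real.mul_rpow ha.le (by positivity),
                ← Real.rpow_mul ht0.le, mul_comm]
              congr 2
              rw [neg_mul, div_mul_cancel₀ _ hp0.ne', Real.rpow_neg ht0.le, Real.rpow_natCast]
      _ ≤ ENNReal.ofReal (ω ^ (1 - 1 / p) * a) *
          ENNReal.ofReal (- τ ^ (-(n / p) + 1) / (-(n / p) + 1)) := by
          rw [lintegral_const_mul' _ _ ENNReal.ofReal_ne_top]
          gcongr
          apply setLIntegral_rpow_le_ofReal _ hτ
          rw [neg_lt_neg_iff, lt_div_iff₀ hp0]; linarith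
      _ = _ := by
          rw [← ENNReal.ofReal_mul (by positivity)]
          congr 2
          have e1 : -(n / p) + 1 = 1 - n / p := by ring
          rw [e1]
          have e2 : 1 - n / p = -((n - p) / p) := by field_simp; ring
          have e3 : p / (n - p) = ((n - p) / p)⁻¹ := by rw [inv_div]
          rw [e3, e2, neg_div_neg_eq, div_eq_mul_inv, mul_comm]
  have hv1 : ∫⁻ z in B, ‖v z‖ₑ ≤ ENNReal.ofReal (ω ^ (1 - 1 / p) * a) :=
    lintegral_le_ofReal_of_rpow (volume.restrict B) hvm.aemeasurable hp hω.le ha.le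
      (by rw [Measure.restrict_apply_univ, hωV]) hA1
  have hpt : ∀ x ∈ B, ENNReal.ofReal ω * ‖v x‖ₑ ≤
      2 * F x + ENNReal.ofReal (ω * (c * ω ^ (-(1 / p)) * a * τ ^ (1 - n / p))) := by
    intro x hx
    have h1 : ∀ z ∈ B, ‖v x‖ₑ ≤ ‖v z‖ₑ + 2 * ∫⁻ t in Ioo (0 : ℝ) 1, G ((1 - t) • x + t • z) := by
      intro z hz
      have h2 := enorm_sub_le_lintegral_segment hv x z
      have h3 : ‖x - z‖ₑ ≤ 2 := by
        have h4 : ‖x - z‖ ≤ 2 := by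
          refine (norm_sub_le _ _).trans ?_
          rw [mem_ball_zero_iff] at hx hz
          linarith
        rw [← ofReal_norm]
        exact (ENNReal.ofReal_le_ofReal h4).trans_eq (by simp)
      calc ‖v x‖ₑ = ‖v z + (v x - v z)‖ₑ := by congr 1; ring
        _ ≤ ‖v z‖ₑ + ‖v x - v z‖ₑ := enorm_add_le _ _
        _ ≤ _ := by gcongr; exact h2.trans (by gcongr)
    have hGx : Measurable fun q : Eu n × ℝ => G ((1 - q.2) • x + q.2 • q.1) := hGm.comp (by fun_prop)
    calc ENNReal.ofReal ω * ‖v x‖ₑ = ∫⁻ z in B, ‖v x‖ₑ := by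
          rw [setLIntegral_const, hωV, mul_comm]
      _ ≤ ∫⁻ z in B, (‖v z‖ₑ + 2 * ∫⁻ t in Ioo (0 : ℝ) 1, G ((1 - t) • x + t • z)) :=
          setLIntegral_mono' hBm h1
      _ = (∫⁻ z in B, ‖v z‖ₑ) + 2 * ∫⁻ t in Ioo (0 : ℝ) 1, ∫⁻ z in B, G ((1 - t) • x + t • z) := by
          rw [lintegral_add_left hvm, lintegral_const_mul' _ _ (by simp),
            lintegral_lintegral_swap hGx.aemeasurable]
      _ = (∫⁻ z in B, ‖v z‖ₑ) + 2 * (F x + ∫⁻ t in Ico τ 1, ∫⁻ z in B, G ((1 - t) • x + t • z)) := by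
          rw [← Ioo_union_Ico_eq_Ioo hτ (by linarith : τ ≤ 1), lintegral_union measurableSet_Ico]
          exact disjoint_left.2 fun t h1 h2 => absurd h1.2 (not_lt.2 h2.1)
      _ ≤ ENNReal.ofReal (ω ^ (1 - 1 / p) * a * τ ^ (1 - n / p)) + 2 * (F x +
          ENNReal.ofReal (ω ^ (1 - 1 / p) * a * (p / (n - p) * τ ^ (1 - n / p)))) := by
          gcongr ?_ + 2 * (_ + ?_)
          · refine hv1.trans (ENNReal.ofReal_le_ofReal ?_)
            refine le_mul_of_one_le_right (by positivity) ?_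
            apply Real.one_le_rpow_of_pos_of_le_one_of_nonpos hτ (by linarith)
            rw [sub_nonpos, le_div_iff₀ hp0]; linarith
          · exact hM x hx
      _ = _ := by
          have e1 : ω ^ (1 - 1 / p) = ω * ω ^ (-(1 / p)) := by
            rw [sub_eq_add_neg, Real.rpow_add hω, Real.rpow_one]
          rw [mul_add, add_left_comm]
          congr 1
          rw [← ENNReal.ofReal_ofNat, ← ENNReal.ofReal_mul (by norm_num),
            ← ENNReal.ofReal_add (by positivity) (by positivity), e1]
          congr 1
          simp only [c]; ring
  have hsub : B ∩ {x | ENNReal.ofReal l < ‖v x‖ₑ} ⊆ {x | ENNReal.ofReal (ω * l / 4) ^ p ≤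
      (B.indicator F x) ^ p} := by
    rintro x ⟨hx, hxl⟩
    simp only [mem_ofPred_eq, indicator_of_mem hx] at hxl ⊢
    gcongr
    by_contra hF
    rw [not_le] at hF
    have h1 := hpt x hx
    have h2 : ENNReal.ofReal ω * ENNReal.ofReal l < ENNReal.ofReal ω * ‖v x‖ₑ :=
      (ENNReal.mul_lt_mul_iff_right (by simpa using hω) ENNReal.ofReal_ne_top).2 hxl
    have h3 : 2 * F x + ENNReal.ofReal (ω * (c * ω ^ (-(1 / p)) * a * τ ^ (1 - n / p))) ≤
        ENNReal.ofReal ω * ENNReal.ofReal l := by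
      calc _ ≤ 2 * ENNReal.ofReal (ω * l / 4) + ENNReal.ofReal (ω * (l / 2)) := by gcongr
        _ = _ := by
          rw [← ENNReal.ofReal_ofNat, ← ENNReal.ofReal_mul (by norm_num),
            ← ENNReal.ofReal_add (by positivity) (by positivity), ← ENNReal.ofReal_mul hω.le]
          congr 1
          ring
    exact absurd (h2.trans_le (h1.trans h3)) (lt_irrefl _)
  have hFp : ∫⁻ x in B, F x ^ p ≤ ENNReal.ofReal (τ ^ p * ω ^ p * 2 ^ n * a ^ p) := by
    have h1 : ∀ x, F x ^ p ≤ ENNReal.ofReal τ ^ (p - 1) * (volume B ^ (p - 1) *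
        ∫⁻ t in Ioo 0 τ, ∫⁻ z in B, G ((1 - t) • x + t • z) ^ p) := by
      intro x
      refine (lintegral_rpow_le_measure_rpow_mul (volume.restrict (Ioo 0 τ))
        (hG2.comp (by fun_prop : Measurable fun t : ℝ => (x, t))).aemeasurable hp).trans ?_
      rw [Measure.restrict_apply_univ, Real.volume_Ioo, sub_zero]
      gcongr
      rw [← lintegral_const_mul' _ _ (by rw [hVe _ (by linarith)]; exact ENNReal.ofReal_ne_top)]
      refine lintegral_mono fun t => ?_
      refine (lintegral_rpow_le_measure_rpow_mul (volume.restrict B)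
        (hGm.comp (by fun_prop)).aemeasurable hp).trans ?_
      rw [Measure.restrict_apply_univ]
      exact le_rfl
    have hGt : ∀ t ∈ Ioo 0 τ, ∫⁻ x in B, ∫⁻ z in B, G ((1 - t) • x + t • z) ^ p ≤
        2 ^ n * (volume B * ∫⁻ x in B, G x ^ p) := by
      intro t ht
      rw [lintegral_lintegral_swap (f := fun x z => G ((1 - t) • x + t • z) ^ p)
        ((hGm.comp (by fun_prop)).pow_const p).aemeasurable]
      calc ∫⁻ z in B, ∫⁻ x in B, G ((1 - t) • x + t • z) ^ p
            ≤ ∫⁻ z in B, 2 ^ n * ∫⁻ x in B, G x ^ p := by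
              refine setLIntegral_mono' hBm fun z hz => ?_
              refine (setLIntegral_convex_comb_le hBc hBm (fun y => G y ^ p) ht.1.le
                (by linarith [ht.2]) hz).trans ?_
              gcongr
              have : (2 : ℝ≥0∞) ^ n = ENNReal.ofReal (2 ^ n) := by
                rw [ENNReal.ofReal_pow (by norm_num)]; norm_num
              rw [this, ← inv_pow]
              apply ENNReal.ofReal_le_ofReal
              have h5 : 1 / 2 ≤ 1 - t := by linarith [ht.2]
              have : (1 - t)⁻¹ ≤ 2 := by
                rw [inv_le_comm₀ (by linarith) (by norm_num)]; linarith
              have : 0 ≤ (1 - t)⁻¹ := by rw [inv_nonneg]; linarith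
              gcongr
          _ = _ := by rw [setLIntegral_const]; ring
    calc ∫⁻ x in B, F x ^ p
        ≤ ∫⁻ x in B, ENNReal.ofReal τ ^ (p - 1) * (volume B ^ (p - 1) *
          ∫⁻ t in Ioo 0 τ, ∫⁻ z in B, G ((1 - t) • x + t • z) ^ p) := lintegral_mono h1
      _ = ENNReal.ofReal τ ^ (p - 1) * (volume B ^ (p - 1) *
          ∫⁻ t in Ioo 0 τ, ∫⁻ x in B, ∫⁻ z in B, G ((1 - t) • x + t • z) ^ p) := by
          rw [lintegral_const_mul' _ _ (ENNReal.rpow_ne_top_of_nonneg (by linarith)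
            ENNReal.ofReal_ne_top),
            lintegral_const_mul' _ _ (by rw [hVe _ (by linarith)]; exact ENNReal.ofReal_ne_top)]
          congr 2
          apply lintegral_lintegral_swap
          refine Measurable.aemeasurable ?_
          exact Measurable.lintegral_prod_right' (hG3.pow_const p)
      _ ≤ ENNReal.ofReal τ ^ (p - 1) * (volume B ^ (p - 1) *
          ∫⁻ t in Ioo 0 τ, 2 ^ n * (volume B * ENNReal.ofReal (a ^ p))) := by
          refine mul_le_mul_right (mul_le_mul_right ?_ _) _
          refine setLIntegral_mono' measurableSet_Ioo fun t ht => (hGt t ht).trans ?_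
          gcongr
      _ = _ := by
          have e2 : (2 : ℝ≥0∞) ^ n = ENNReal.ofReal (2 ^ n) := by
            rw [ENNReal.ofReal_pow (by norm_num)]; norm_num
          rw [setLIntegral_const, Real.volume_Ioo, sub_zero, hVe _ (by linarith), hωV,
            ENNReal.ofReal_rpow_of_nonneg hτ.le (by linarith), e2,
            ← ENNReal.ofReal_mul (by positivity), ← ENNReal.ofReal_mul (by positivity),
            ← ENNReal.ofReal_mul (by positivity), ← ENNReal.ofReal_mul (by positivity),
            ← ENNReal.ofReal_mul (by positivity)]
          congr 1
          have e3 : ∀ y : ℝ, 0 < y → y ^ p = y ^ (p - 1) * y := fun y hy => by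
            rw [Real.rpow_sub_one hy.ne', div_mul_cancel₀ _ hy.ne']
          rw [e3 τ hτ, e3 ω hω]; ring
  refine (measure_mono hsub).trans ?_
  have hpos : 0 < ω * l / 4 := by positivity
  refine (meas_ge_le_lintegral_div (((hFm.indicator hBm).pow_const p).aemeasurable)
    (by positivity) (by finiteness)).trans ?_
  have : ∫⁻ x, (B.indicator F x) ^ p = ∫⁻ x in B, F x ^ p := by
    rw [← lintegral_indicator hBm]
    refine lintegral_congr fun x => ?_
    by_cases hx : x ∈ B <;> simp [hx, hp0]
  rw [this]
  refine (ENNReal.div_le_div_right hFp _).trans (le_of_eq ?_)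
  rw [ENNReal.ofReal_rpow_of_nonneg hpos.le hp0.le, ← ENNReal.ofReal_div_of_pos (by positivity)]
  congr 1
  rw [Real.div_rpow (by positivity) (by norm_num), Real.mul_rpow hω.le hl.le,
    Real.div_rpow ha.le hl.le]
  field_simp

theorem weak_sobolev_smooth {p : ℝ} (hp : 1 ≤ p) (hpn : p < n) :
    ∃ C : ℝ, 0 < C ∧ ∀ s : ℝ, 1 / 4 ≤ s → s ≤ 1 → ∀ v : Eu n → ℝ, ContDiff ℝ (⊤ : ℕ∞) v →
      ∀ a : ℝ, 0 < a → ∫⁻ x in ball (0 : Eu n) s, ‖v x‖ₑ ^ p ≤ ENNReal.ofReal (a ^ p) →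
      ∫⁻ x in ball (0 : Eu n) s, ‖fderiv ℝ v x‖ₑ ^ p ≤ ENNReal.ofReal (a ^ p) →
      ∀ l : ℝ, 0 < l → volume (ball (0 : Eu n) s ∩ {x | ENNReal.ofReal l < ‖v x‖ₑ}) ≤
        ENNReal.ofReal (C * (a / l) ^ (p * n / (n - p))) := by
  have hp0 : 0 < p := by linarith
  have hnp : 0 < (n : ℝ) - p := by linarith
  have hn0 : 0 < (n : ℝ) := by linarith
  set V : ℝ → ℝ := fun s => (volume (ball (0 : Eu n) s)).toReal
  have hVpos : ∀ s, 0 < s → 0 < V s := fun s hs =>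
    ENNReal.toReal_pos (measure_ball_pos volume _ hs).ne' measure_ball_lt_top.ne
  have hVmono : ∀ s t, s ≤ t → V s ≤ V t := fun s t h =>
    ENNReal.toReal_mono measure_ball_lt_top.ne (measure_mono (ball_subset_ball h))
  have hVe : ∀ s, volume (ball (0 : Eu n) s) = ENNReal.ofReal (V s) := fun s =>
    (ENNReal.ofReal_toReal measure_ball_lt_top.ne).symm
  set c := 1 + 2 * (p / (n - p))
  have hc : 0 < c := by positivity
  have hV4 := hVpos (1 / 4) (by norm_num)
  have hV1 := hVpos 1 one_pos
  set K := 2 * c * V (1 / 4) ^ (-(1 / p))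
  have hK : 0 < K := by positivity
  set C₁ := 4 ^ p * 2 ^ n * K ^ (p / (n - p) * p)
  set C₂ := V 1 * 2 ^ n * K ^ (p * n / (n - p))
  have hC₁ : 0 < C₁ := by positivity
  have hC₂ : 0 < C₂ := by positivity
  refine ⟨C₁ + C₂, by positivity, fun s hs4 hs1 v hv a ha hA1 hA2 l hl => ?_⟩
  have hs0 : 0 < s := by linarith
  have hal : 0 < a / l := by positivity
  set τ := (K * (a / l)) ^ (p / (n - p))
  have hτ : 0 < τ := by positivity
  rcases le_or_gt τ (1 / 2) with h | h
  · have := weak_sobolev_smooth_of_ball hp hpn hs1 hv ha hA1 hA2 hτ h hl (hVpos s hs0) (hVe s) ?_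
    · refine this.trans (ENNReal.ofReal_le_ofReal ?_)
      have e : 4 ^ p * 2 ^ n * τ ^ p * (a / l) ^ p = C₁ * (a / l) ^ (p * n / (n - p)) := by
        simp only [τ, C₁]
        rw [← Real.rpow_mul (by positivity), Real.mul_rpow hK.le hal.le]
        have : p * n / (n - p) = p / (n - p) * p + p := by field_simp; ring
        rw [this, Real.rpow_add hal]
        ring
      rw [e]
      gcongr
      linarith
    · have e : τ ^ (1 - n / p) = (K * (a / l))⁻¹ := by
        simp only [τ]
        rw [← Real.rpow_mul (by positivity), ← Real.rpow_neg_one]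
        congr 1
        field_simp
        ring
      rw [e]
      have hVle : V s ^ (-(1 / p)) ≤ V (1 / 4) ^ (-(1 / p)) :=
        Real.rpow_le_rpow_of_nonpos hV4 (hVmono _ _ hs4) (by rw [neg_nonpos]; positivity)
      calc c * V s ^ (-(1 / p)) * a * (K * (a / l))⁻¹
          ≤ c * V (1 / 4) ^ (-(1 / p)) * a * (K * (a / l))⁻¹ := by gcongr
        _ = l / 2 := by
          simp only [K]
          have : V (1 / 4) ^ (-(1 / p)) ≠ 0 := by positivity
          field_simp
  · calc _ ≤ volume (ball (0 : Eu n) s) := measure_mono inter_subset_left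
      _ ≤ ENNReal.ofReal (V 1) := by rw [hVe]; exact ENNReal.ofReal_le_ofReal (hVmono _ _ hs1)
      _ ≤ _ := by
        apply ENNReal.ofReal_le_ofReal
        have e : C₂ * (a / l) ^ (p * n / (n - p)) = V 1 * (2 ^ n * τ ^ n) := by
          simp only [τ, C₂]
          rw [← Real.rpow_natCast _ n, ← Real.rpow_natCast _ n, ← Real.rpow_mul (by positivity),
            div_mul_eq_mul_div, Real.mul_rpow hK.le hal.le]
          ring
        have h1 : 1 ≤ 2 ^ n * τ ^ n := by
          rw [← mul_pow]
          exact one_le_pow₀ (by linarith)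
        have h2 : 0 ≤ C₁ * (a / l) ^ (p * n / (n - p)) := by positivity
        rw [add_mul, e]
        nlinarith

end weakSobolev

section sobolevLimits
variable {n : ℕ}
open Filter

theorem lintegral_le_of_le_liminf {α : Type*} {_ : MeasurableSpace α} {μ : Measure α}
    {f : ℕ → α → ℝ≥0∞} {g : α → ℝ≥0∞} (hf : ∀ j, AEMeasurable (f j) μ)
    (h : ∀ᵐ x ∂μ, g x ≤ liminf (fun j => f j x) atTop) {K : ℝ≥0∞}
    (hK : ∀ᶠ j in atTop, ∫⁻ x, f j x ∂μ ≤ K) : ∫⁻ x, g x ∂μ ≤ K :=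
  (lintegral_mono_ae h).trans ((lintegral_liminf_le' hf).trans
    (liminf_le_of_frequently_le' hK.frequently))

theorem weak_sobolev {p : ℝ} (hp : 1 ≤ p) (hpn : p < n) :
    ∃ C : ℝ, 0 < C ∧ ∀ R : ℝ, 1 / 2 ≤ R → R ≤ 1 → ∀ (w : Eu n → ℝ) (dw : Eu n → Eu n),
      IsWeakGradOn n (ball 0 R) w dw → IntegrableOn w (ball 0 R) → IntegrableOn dw (ball 0 R) →
      ∀ a : ℝ, 0 ≤ a → ∫⁻ x in ball (0 : Eu n) R, ‖w x‖ₑ ^ p ≤ ENNReal.ofReal (a ^ p) →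
      ∫⁻ x in ball (0 : Eu n) R, ‖dw x‖ₑ ^ p ≤ ENNReal.ofReal (a ^ p) →
      ∀ l : ℝ, 0 < l → volume (ball (0 : Eu n) R ∩ {x | ENNReal.ofReal l < ‖w x‖ₑ}) ≤
        ENNReal.ofReal (C * (a / l) ^ (p * n / (n - p))) := by
  obtain ⟨C, hC, H⟩ := weak_sobolev_smooth (n := n) hp hpn
  refine ⟨C, hC, fun R hR hR1 w dw h hw hdw => ?_⟩
  obtain ⟨W, hW, hWt, hWs⟩ := exists_approx_ball h hw hdw
  have key : ∀ a : ℝ, 0 < a → ∫⁻ x in ball (0 : Eu n) R, ‖w x‖ₑ ^ p ≤ ENNReal.ofReal (a ^ p) →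
      ∫⁻ x in ball (0 : Eu n) R, ‖dw x‖ₑ ^ p ≤ ENNReal.ofReal (a ^ p) →
      ∀ l : ℝ, 0 < l → volume (ball (0 : Eu n) R ∩ {x | ENNReal.ofReal l < ‖w x‖ₑ}) ≤
        ENNReal.ofReal (C * (a / l) ^ (p * n / (n - p))) := by
    intro a ha h1 h2 l hl
    have hs : ∀ s, 1 / 4 ≤ s → s < R →
        volume (ball (0 : Eu n) s ∩ {x | ENNReal.ofReal l < ‖w x‖ₑ}) ≤
        ENNReal.ofReal (C * (a / l) ^ (p * n / (n - p))) := by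
      intro s hs hsR
      set A : ℕ → Set (Eu n) := fun j => {x | ENNReal.ofReal l < ‖W j x‖ₑ}
      have hA : ∀ j, MeasurableSet (A j) := fun j =>
        measurableSet_lt measurable_const (hW j).continuous.enorm.measurable
      set f : ℕ → Eu n → ℝ≥0∞ := fun j => (ball (0 : Eu n) s ∩ A j).indicator 1
      have hf : ∀ j, Measurable (f j) := fun j =>
        measurable_one.indicator (measurableSet_ball.inter (hA j))
      have h3 : ∫⁻ x, liminf (fun j => f j x) atTop ≤
          ENNReal.ofReal (C * (a / l) ^ (p * n / (n - p))) := by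
        refine lintegral_le_of_le_liminf (fun j => (hf j).aemeasurable)
          (Eventually.of_forall fun x => le_rfl) ?_
        filter_upwards [hWs s hsR] with j hj
        rw [lintegral_indicator_one (measurableSet_ball.inter (hA j))]
        exact H s hs (by linarith) (W j) (hW j) a ha ((hj p hp).1.trans h1)
          ((hj p hp).2.trans h2) l hl
      refine le_trans ?_ ((mul_meas_ge_le_lintegral (Measurable.liminf hf) 1).trans h3)
      rw [one_mul]
      refine measure_mono_ae ?_
      filter_upwards [hWt] with x hx hxm
      have hx1 := hx (ball_subset_ball hsR.le hxm.1)
      have h4 : ∀ᶠ j in atTop, f j x = 1 := by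
        have := (tendsto_order.1 (hx1.enorm)).1 _ hxm.2
        filter_upwards [this] with j hj
        exact indicator_of_mem (⟨hxm.1, hj⟩ : x ∈ ball (0 : Eu n) s ∩ A j) 1
      exact le_liminf_of_le (by isBoundedDefault) (h4.mono fun j hj => hj.ge)
    have hU : ball (0 : Eu n) R ∩ {x | ENNReal.ofReal l < ‖w x‖ₑ} =
        ⋃ j : ℕ, (ball (0 : Eu n) (R - 1 / (4 * ((j : ℝ) + 1))) ∩
          {x | ENNReal.ofReal l < ‖w x‖ₑ}) := by
      rw [← iUnion_inter]
      congr 1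
      ext x
      simp only [mem_iUnion, mem_ball_zero_iff]
      constructor
      · intro hx
        obtain ⟨j, hj⟩ := exists_nat_one_div_lt (sub_pos.2 hx)
        refine ⟨j, ?_⟩
        have : 1 / (4 * ((j : ℝ) + 1)) ≤ 1 / ((j : ℝ) + 1) := by
          apply one_div_le_one_div_of_le (by positivity)
          have : (0 : ℝ) ≤ j := by positivity
          linarith
        linarith
      · rintro ⟨j, hj⟩
        have : 0 < 1 / (4 * ((j : ℝ) + 1)) := by positivity
        linarith
    rw [hU, Monotone.measure_iUnion]
    · refine iSup_le fun j => hs _ ?_ ?_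
      · have : 1 / (4 * ((j : ℝ) + 1)) ≤ 1 / 4 := by
          apply one_div_le_one_div_of_le (by positivity)
          have : (0 : ℝ) ≤ j := by positivity
          linarith
        linarith
      · have : 0 < 1 / (4 * ((j : ℝ) + 1)) := by positivity
        linarith
    · intro i j hij
      refine inter_subset_inter_left _ (ball_subset_ball ?_)
      gcongr
  intro a ha h1 h2 l hl
  have hex : 0 < p * n / (n - p) := by
    have : 0 < (n : ℝ) - p := by linarith
    have : 0 < (n : ℝ) := by linarith
    positivity
  have ht : Tendsto (fun b : ℝ => ENNReal.ofReal (C * (b / l) ^ (p * n / (n - p)))) (𝓝[>] a)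
      (𝓝 (ENNReal.ofReal (C * (a / l) ^ (p * n / (n - p))))) := by
    refine Tendsto.mono_left ?_ nhdsWithin_le_nhds
    apply ENNReal.tendsto_ofReal
    refine ((continuous_id.div_const l).rpow_const fun _ => Or.inr hex.le).tendsto a |>.const_mul C
  refine ge_of_tendsto ht ?_
  filter_upwards [self_mem_nhdsWithin] with b hb
  have hb' : a < b := hb
  have hab : ENNReal.ofReal (a ^ p) ≤ ENNReal.ofReal (b ^ p) := by gcongr
  exact key b (by linarith) (h1.trans hab) (h2.trans hab) l hl

theorem IsWeakGradOn.poincare_double {x₀ : Eu n} {R : ℝ} {w : Eu n → ℝ} {dw : Eu n → Eu n}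
    (h : IsWeakGradOn n (ball x₀ R) w dw) (hw : IntegrableOn w (ball x₀ R))
    (hdw : IntegrableOn dw (ball x₀ R)) {m : ℝ} (hm : 1 ≤ m) {s : ℝ} (hs : s < R) :
    ∫⁻ x in ball x₀ s, ∫⁻ z in ball x₀ s, ‖w x - w z‖ₑ ^ m ≤
      ENNReal.ofReal (2 * s) ^ m * (2 ^ n * (volume (ball x₀ s) *
        ∫⁻ x in ball x₀ R, ‖dw x‖ₑ ^ m)) := by
  obtain ⟨W, hW, hWt, hWs⟩ := exists_approx_ball h hw hdw
  have hWm : ∀ j, Measurable fun q : Eu n × Eu n => ‖W j q.1 - W j q.2‖ₑ ^ m := fun j => by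
    have := (hW j).continuous
    exact ((by fun_prop : Continuous fun q : Eu n × Eu n => W j q.1 - W j q.2).enorm.measurable).pow_const m
  have hWt' : ∀ᵐ x ∂volume.restrict (ball x₀ s), Tendsto (fun j => W j x) atTop (𝓝 (w x)) := by
    refine (ae_restrict_iff' measurableSet_ball).2 ?_
    filter_upwards [hWt] with x hx hxs
    exact hx (ball_subset_ball hs.le hxs)
  refine lintegral_le_of_le_liminf
    (f := fun j x => ∫⁻ z in ball x₀ s, ‖W j x - W j z‖ₑ ^ m)
    (fun j => (hWm j).lintegral_prod_right'.aemeasurable) ?_ ?_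
  · filter_upwards [hWt'] with x hx
    refine le_trans (lintegral_mono_ae ?_) (lintegral_liminf_le
      (fun j => (hWm j).comp (by fun_prop : Measurable fun z => (x, z))))
    filter_upwards [hWt'] with z hz
    have : Tendsto (fun j => ‖W j x - W j z‖ₑ ^ m) atTop (𝓝 (‖w x - w z‖ₑ ^ m)) :=
      ((ENNReal.continuous_rpow_const).tendsto _).comp ((hx.sub hz).enorm)
    exact this.liminf_eq.ge
  · filter_upwards [hWs s hs] with j hj
    refine (_root_.poincare_double (hW j) hm x₀).trans ?_
    exact mul_le_mul_right (mul_le_mul_right (mul_le_mul_right (hj m hm).2 _) _) _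

theorem IsWeakGradOn.lintegral_rpow_lt_top {x₀ : Eu n} {R : ℝ} {w : Eu n → ℝ} {dw : Eu n → Eu n}
    (h : IsWeakGradOn n (ball x₀ R) w dw) (hw : IntegrableOn w (ball x₀ R))
    (hdw : IntegrableOn dw (ball x₀ R)) {m : ℝ} (hm : 1 ≤ m)
    (hfin : ∫⁻ x in ball x₀ R, ‖dw x‖ₑ ^ m < ∞) {s : ℝ} (hs : s < R) :
    ∫⁻ x in ball x₀ s, ‖w x‖ₑ ^ m < ∞ := by
  rcases le_or_gt s 0 with hs0 | hs0
  · simp [ball_eq_empty.2 hs0]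
  have h1 := h.poincare_double hw hdw hm hs
  have h2 : ∫⁻ x in ball x₀ s, ∫⁻ z in ball x₀ s, ‖w x - w z‖ₑ ^ m < ∞ := by
    refine h1.trans_lt ?_
    have := (measure_ball_lt_top (μ := volume) (x := x₀) (r := s)).ne
    finiteness
  have hws : AEMeasurable w (volume.restrict (ball x₀ s)) :=
    (hw.mono_set (ball_subset_ball hs.le)).aestronglyMeasurable.aemeasurable
  obtain ⟨w', hw'm, hw'e⟩ := hws
  have h3 : ∀ᵐ x ∂volume.restrict (ball x₀ s),
      ∫⁻ z in ball x₀ s, ‖w' x - w' z‖ₑ ^ m < ∞ := by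
    have hme : Measurable fun x => ∫⁻ z in ball x₀ s, ‖w' x - w' z‖ₑ ^ m :=
      Measurable.lintegral_prod_right' (f := fun q : Eu n × Eu n => ‖w' q.1 - w' q.2‖ₑ ^ m)
        (by fun_prop)
    refine ae_lt_top hme (ne_of_lt (lt_of_le_of_lt (le_of_eq ?_) h2))
    refine lintegral_congr_ae ?_
    filter_upwards [hw'e] with x hx
    refine lintegral_congr_ae ?_
    filter_upwards [hw'e] with z hz
    rw [hx, hz]
  have : (ae (volume.restrict (ball x₀ s))).NeBot := by
    rw [ae_neBot, Ne, Measure.restrict_eq_zero]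
    exact (measure_ball_pos volume x₀ hs0).ne'
  obtain ⟨x, hx⟩ := h3.exists
  calc ∫⁻ z in ball x₀ s, ‖w z‖ₑ ^ m = ∫⁻ z in ball x₀ s, ‖w' z‖ₑ ^ m := by
        refine lintegral_congr_ae ?_
        filter_upwards [hw'e] with z hz
        rw [hz]
    _ ≤ ∫⁻ z in ball x₀ s, 2 ^ (m - 1) * (‖w' x‖ₑ ^ m + ‖w' x - w' z‖ₑ ^ m) := by
        refine lintegral_mono fun z => ?_
        refine le_trans ?_ (ENNReal.rpow_add_le_mul_rpow_add_rpow _ _ hm)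
        gcongr
        calc ‖w' z‖ₑ = ‖w' x - (w' x - w' z)‖ₑ := by congr 1; ring
          _ ≤ _ := enorm_sub_le
    _ < ∞ := by
        rw [lintegral_const_mul' _ _ (by finiteness), lintegral_add_left measurable_const,
          setLIntegral_const]
        have h4 := (measure_ball_lt_top (μ := volume) (x := x₀) (r := s)).ne
        have h5 := hx.ne
        finiteness

theorem IsWeakGradOn.poincare_zero {x₀ : Eu n} {R : ℝ} {w : Eu n → ℝ} {dw : Eu n → Eu n}
    (h : IsWeakGradOn n (ball x₀ R) w dw) (hw : IntegrableOn w (ball x₀ R))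
    (hdw : IntegrableOn dw (ball x₀ R)) {m : ℝ} (hm : 1 ≤ m) {s : ℝ} (hs : s < R) (hs0 : 0 < s)
    (hZ : volume (ball x₀ s) ≤ 2 * volume (ball x₀ s ∩ {x | w x = 0})) :
    ∫⁻ x in ball x₀ s, ‖w x‖ₑ ^ m ≤
      2 ^ (n + 1) * (ENNReal.ofReal (2 * s) ^ m * ∫⁻ x in ball x₀ R, ‖dw x‖ₑ ^ m) := by
  set V := volume (ball x₀ s)
  have hV0 : V ≠ 0 := (measure_ball_pos volume x₀ hs0).ne'
  have hVt : V ≠ ∞ := measure_ball_lt_top.ne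
  have h1 := h.poincare_double hw hdw hm hs
  have h2 : ∀ x, ‖w x‖ₑ ^ m * V ≤ 2 * ∫⁻ z in ball x₀ s, ‖w x - w z‖ₑ ^ m := by
    intro x
    calc ‖w x‖ₑ ^ m * V ≤ ‖w x‖ₑ ^ m * (2 * volume (ball x₀ s ∩ {x | w x = 0})) := by gcongr
      _ = 2 * ∫⁻ z in ball x₀ s ∩ {x | w x = 0}, ‖w x‖ₑ ^ m := by
        rw [setLIntegral_const]; ring
      _ ≤ 2 * ∫⁻ z in ball x₀ s ∩ {x | w x = 0}, ‖w x - w z‖ₑ ^ m := by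
        refine mul_le_mul_right ?_ _
        have hnm : NullMeasurableSet (ball x₀ s ∩ {x | w x = 0}) := by
          have hws : AEMeasurable w (volume.restrict (ball x₀ s)) :=
            (hw.mono_set (ball_subset_ball hs.le)).aestronglyMeasurable.aemeasurable
          have := hws.nullMeasurableSet_preimage (measurableSet_singleton 0)
          rw [nullMeasurableSet_restrict measurableSet_ball.nullMeasurableSet, inter_comm] at this
          exact this
        refine lintegral_mono_ae ?_
        filter_upwards [ae_restrict_mem₀ hnm] with z hz
        have hz2 : w z = 0 := hz.2
        rw [hz2, sub_zero]
      _ ≤ _ := by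
        gcongr
        exact inter_subset_left
  have h3 : (∫⁻ x in ball x₀ s, ‖w x‖ₑ ^ m) * V ≤
      (2 ^ (n + 1) * (ENNReal.ofReal (2 * s) ^ m * ∫⁻ x in ball x₀ R, ‖dw x‖ₑ ^ m)) * V := by
    calc (∫⁻ x in ball x₀ s, ‖w x‖ₑ ^ m) * V = ∫⁻ x in ball x₀ s, ‖w x‖ₑ ^ m * V :=
          (lintegral_mul_const' _ _ hVt).symm
      _ ≤ ∫⁻ x in ball x₀ s, 2 * ∫⁻ z in ball x₀ s, ‖w x - w z‖ₑ ^ m := lintegral_mono h2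
      _ = 2 * ∫⁻ x in ball x₀ s, ∫⁻ z in ball x₀ s, ‖w x - w z‖ₑ ^ m :=
          lintegral_const_mul' _ _ (by simp)
      _ ≤ 2 * _ := mul_le_mul_right h1 _
      _ = _ := by rw [pow_succ]; ring
  exact (ENNReal.mul_le_mul_iff_left hV0 hVt).1 h3

end sobolevLimits

section gagliardoNirenbergSobolev
open Filter

theorem enorm_le_lintegral_fderiv_fin_one {v : (Fin 1 → ℝ) → ℝ} (hv : ContDiff ℝ 1 v)
    (hc : HasCompactSupport v) (x : Fin 1 → ℝ) : ‖v x‖ₑ ≤ ∫⁻ y, ‖fderiv ℝ v y‖ₑ := by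
  calc ‖v x‖ₑ
    _ ≤ ∫⁻ t in Iic (x 0), ‖deriv (v ∘ Function.update x 0) t‖ₑ := by
        apply le_trans (by simp) (HasCompactSupport.enorm_le_lintegral_Ici_deriv _ _ _)
        · exact hv.comp (by convert! contDiff_update 1 x 0)
        · exact hc.comp_isClosedEmbedding (isClosedEmbedding_update x 0)
    _ ≤ ∫⁻ t, ‖fderiv ℝ v (Function.update x 0 t)‖ₑ := by
        refine (setLIntegral_le_lintegral _ _).trans (lintegral_mono fun t => ?_)
        calc ‖deriv (v ∘ Function.update x 0) t‖ₑ
            = ‖fderiv ℝ v (Function.update x 0 t) (deriv (Function.update x 0) t)‖ₑ := by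
              rw [fderiv_comp_deriv _ (hv.differentiable one_ne_zero).differentiableAt
                (hasDerivAt_update x 0 t).differentiableAt]
          _ ≤ ‖fderiv ℝ v (Function.update x 0 t)‖ₑ * ‖deriv (Function.update x 0) t‖ₑ :=
              ContinuousLinearMap.le_opENorm _ _
          _ ≤ ‖fderiv ℝ v (Function.update x 0 t)‖ₑ := by simp [deriv_update, Pi.enorm_single]
    _ = ∫⁻ y, ‖fderiv ℝ v y‖ₑ := by
        refine Eq.trans ?_ ((volume_preserving_funUnique (Fin 1) ℝ).symm.lintegral_comp_emb
          (MeasurableEquiv.measurableEmbedding _) fun y => ‖fderiv ℝ v y‖ₑ)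
        refine lintegral_congr fun t => ?_
        congr 2
        ext i
        fin_cases i
        simp

theorem exists_gagliardo_nirenberg_sobolev {d : ℕ} (hd : 1 ≤ d) {q m : ℝ} (hq : 1 < q) (hm : 1 ≤ m)
    (hmq : 1 / m = min (1 / q + 1 / d) 1) :
    ∃ C : ℝ≥0, ∀ v : (Fin d → ℝ) → ℝ, ContDiff ℝ 1 v → Function.support v ⊆ ball 0 2 →
      (∫⁻ y, ‖v y‖ₑ ^ q) ^ (m / q) ≤ C * ∫⁻ y, ‖fderiv ℝ v y‖ₑ ^ m := by
  have hq0 : 0 < q := by linarith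
  have hm0 : 0 < m := by linarith
  have hd0 : (0 : ℝ) < d := by exact_mod_cast hd
  rcases hd.eq_or_lt with rfl | hd2
  · have hm1 : m = 1 := by
      have : min (1 / q + 1 / ((1 : ℕ) : ℝ)) 1 = 1 := by
        rw [min_eq_right]
        have : 0 < 1 / q := by positivity
        simp only [Nat.cast_one, div_one]; simpa using this.le
      rw [this] at hmq
      field_simp at hmq
      linarith
    subst hm1
    refine ⟨(volume (ball (0 : Fin 1 → ℝ) 2) ^ (1 / q)).toNNReal, fun v hv hs => ?_⟩
    have hc : HasCompactSupport v :=
      HasCompactSupport.of_support_subset_isCompact (isCompact_closedBall 0 2)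
        (hs.trans ball_subset_closedBall)
    have hfin : volume (ball (0 : Fin 1 → ℝ) 2) ≠ ∞ := measure_ball_lt_top.ne
    rw [ENNReal.coe_toNNReal (by finiteness)]
    simp only [ENNReal.rpow_one]
    set D := ∫⁻ y, ‖fderiv ℝ v y‖ₑ
    calc (∫⁻ y, ‖v y‖ₑ ^ q) ^ (1 / q) ≤ (∫⁻ y in ball (0 : Fin 1 → ℝ) 2, D ^ q) ^ (1 / q) := by
          rw [← lintegral_indicator measurableSet_ball]
          gcongr with y
          by_cases hy : y ∈ ball (0 : Fin 1 → ℝ) 2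
          · rw [indicator_of_mem hy]
            gcongr
            exact enorm_le_lintegral_fderiv_fin_one hv hc y
          · have : v y = 0 := by
              by_contra h; exact hy (hs h)
            simp [this, hq0]
      _ = volume (ball (0 : Fin 1 → ℝ) 2) ^ (1 / q) * D := by
          rw [setLIntegral_const, ENNReal.mul_rpow_of_nonneg _ _ (by positivity),
            ← ENNReal.rpow_mul, mul_one_div_cancel hq0.ne', ENNReal.rpow_one, mul_comm]
  · have hd2' : (2 : ℝ) ≤ d := by exact_mod_cast hd2
    have hmd : m < d := by
      have h1 : 1 / (d : ℝ) < 1 / m := by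
        rw [hmq, lt_min_iff]
        refine ⟨by have : 0 < 1 / q := by positivity
                   linarith, ?_⟩
        rw [div_lt_one hd0]; linarith
      exact (one_div_lt_one_div hd0 hm0).1 h1
    refine ⟨eLpNormLESNormFDerivOfLeConst ℝ (volume : Measure (Fin d → ℝ)) (ball 0 2)
      m.toNNReal q.toNNReal ^ m, fun v hv hs => ?_⟩
    have h := eLpNorm_le_eLpNorm_fderiv_of_le (volume : Measure (Fin d → ℝ)) hv hs
      (p := m.toNNReal) (q := q.toNNReal) (by simpa using hm)
      (by rw [← NNReal.coe_lt_coe, Real.coe_toNNReal _ hm0.le]; simpa using hmd)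
      (by
        rw [NNReal.coe_inv, Real.coe_toNNReal _ hm0.le, Real.coe_toNNReal _ hq0.le]
        have : 1 / m ≤ 1 / q + 1 / d := hmq.trans_le (min_le_left _ _)
        simp only [Module.finrank_fin_fun]
        rw [inv_eq_one_div, inv_eq_one_div, inv_eq_one_div]
        linarith) isBounded_ball
    rw [eLpNorm_nnreal_eq_lintegral (by simpa using hq0),
      eLpNorm_nnreal_eq_lintegral (by simpa using hm0), Real.coe_toNNReal _ hm0.le,
      Real.coe_toNNReal _ hq0.le] at h
    have h2 := ENNReal.rpow_le_rpow h hm0.le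
    rw [ENNReal.mul_rpow_of_nonneg _ _ hm0.le, ← ENNReal.rpow_mul, ← ENNReal.rpow_mul,
      one_div_mul_cancel hm0.ne', ENNReal.rpow_one, one_div_mul_eq_div] at h2
    rwa [ENNReal.coe_rpow_of_nonneg _ hm0.le]

end gagliardoNirenbergSobolev

section gnomonicChart
open Filter

theorem lintegral_comp_smul_pos {E : Type*} [NormedAddCommGroup E] [NormedSpace ℝ E]
    [MeasurableSpace E] [BorelSpace E] [FiniteDimensional ℝ E] (μ : Measure E) [μ.IsAddHaarMeasure]
    (h : E → ℝ≥0∞) {c : ℝ} (hc : 0 < c) :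
    ∫⁻ x, h (c • x) ∂μ = ENNReal.ofReal ((c ^ Module.finrank ℝ E)⁻¹) * ∫⁻ x, h x ∂μ := by
  have hme : MeasurableEmbedding fun x : E => c • x :=
    (Homeomorph.smulOfNeZero c hc.ne').measurableEmbedding
  rw [← hme.lintegral_map h, Measure.map_addHaar_smul _ hc.ne', lintegral_smul_measure,
    abs_of_pos (by positivity), smul_eq_mul]

variable {d : ℕ}

/-- The point `(1, y)` of the affine hyperplane `{x₀ = 1}`. -/
def coneVec (y : Fin d → ℝ) : Eu (d + 1) := WithLp.toLp 2 (Fin.cons 1 y)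

/-- The gnomonic parametrisation of the open upper half sphere. -/
def gnomonic (y : Fin d → ℝ) : Eu (d + 1) := ‖coneVec y‖⁻¹ • coneVec y

theorem coneVec_zero (y : Fin d → ℝ) : coneVec y 0 = 1 := rfl

theorem coneVec_succ (y : Fin d → ℝ) (i : Fin d) : coneVec y i.succ = y i := rfl

theorem contDiff_coneVec : ContDiff ℝ 1 (coneVec (d := d)) := by
  rw [contDiff_euclidean]
  intro i
  refine Fin.cases ?_ (fun i => ?_) i
  · exact contDiff_const
  · exact contDiff_apply ℝ ℝ i

theorem one_le_norm_coneVec (y : Fin d → ℝ) : 1 ≤ ‖coneVec y‖ := by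
  have := PiLp.norm_apply_le (coneVec y) 0
  rwa [coneVec_zero, norm_one] at this

theorem norm_coneVec_pos (y : Fin d → ℝ) : 0 < ‖coneVec y‖ := zero_lt_one.trans_le (one_le_norm_coneVec y)

theorem norm_gnomonic (y : Fin d → ℝ) : ‖gnomonic y‖ = 1 := by
  rw [gnomonic, norm_smul, norm_inv, norm_norm, inv_mul_cancel₀ (norm_coneVec_pos y).ne']

theorem contDiff_gnomonic : ContDiff ℝ 1 (gnomonic (d := d)) := by
  have h : ContDiff ℝ 1 fun y : Fin d → ℝ => ‖coneVec y‖ :=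
    contDiff_coneVec.norm ℝ fun y => norm_pos_iff.1 (norm_coneVec_pos y)
  exact (h.inv fun y => (norm_coneVec_pos y).ne').smul contDiff_coneVec

theorem lintegral_eq_lintegral_cons {F : Eu (d + 1) → ℝ≥0∞} (hF : Measurable F) :
    ∫⁻ x, F x = ∫⁻ t : ℝ, ∫⁻ y : Fin d → ℝ, F (WithLp.toLp 2 (Fin.cons t y)) := by
  have hF1 : Measurable fun z : Fin (d + 1) → ℝ => F (WithLp.toLp 2 z) :=
    hF.comp (PiLp.volume_preserving_toLp (Fin (d + 1))).measurable
  have h1 := (PiLp.volume_preserving_toLp (Fin (d + 1))).lintegral_comp hF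
  have h2 := (volume_preserving_piFinSuccAbove (fun _ : Fin (d + 1) => ℝ) 0).symm.lintegral_comp hF1
  rw [← h1]
  refine h2.symm.trans ?_
  refine (lintegral_prod (μ := volume) (ν := volume) _ (hF1.comp
    (MeasurableEquiv.piFinSuccAbove (fun _ : Fin (d + 1) => ℝ) 0).symm.measurable).aemeasurable).trans ?_
  refine lintegral_congr fun t => lintegral_congr fun y => ?_
  simp [MeasurableEquiv.piFinSuccAbove, Fin.insertNthEquiv, Fin.insertNth_zero']

theorem measurable_smul_coneVec : Measurable fun q : ℝ × (Fin d → ℝ) => q.1 • coneVec q.2 := by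
  have := contDiff_coneVec (d := d).continuous
  exact (by fun_prop : Continuous fun q : ℝ × (Fin d → ℝ) => q.1 • coneVec q.2).measurable

theorem continuous_smul_gnomonic : Continuous fun q : ℝ × (Fin d → ℝ) => q.1 • gnomonic q.2 := by
  have := contDiff_gnomonic (d := d).continuous
  fun_prop

theorem setLIntegral_halfspace_eq {F : Eu (d + 1) → ℝ≥0∞} (hF : Measurable F) :
    ∫⁻ x in {x : Eu (d + 1) | 0 < x 0}, F x = ∫⁻ y : Fin d → ℝ, ∫⁻ r in Ioi (0 : ℝ),
      ENNReal.ofReal (r ^ d * (‖coneVec y‖ ^ (d + 1))⁻¹) * F (r • gnomonic y) := by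
  have hH : MeasurableSet {x : Eu (d + 1) | 0 < x 0} :=
    measurableSet_lt measurable_const (by fun_prop)
  rw [← lintegral_indicator hH, lintegral_eq_lintegral_cons (hF.indicator hH)]
  have h1 : ∀ t : ℝ, ∫⁻ y : Fin d → ℝ, {x : Eu (d + 1) | 0 < x 0}.indicator F
      (WithLp.toLp 2 (Fin.cons t y)) = (Ioi (0 : ℝ)).indicator (fun t => ∫⁻ y : Fin d → ℝ,
        ENNReal.ofReal (t ^ d) * F (t • coneVec y)) t := by
    intro t
    by_cases ht : 0 < t
    · rw [indicator_of_mem (show t ∈ Ioi (0 : ℝ) from ht)]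
      have h2 : ∀ y : Fin d → ℝ, {x : Eu (d + 1) | 0 < x 0}.indicator F
          (WithLp.toLp 2 (Fin.cons t y)) = F (WithLp.toLp 2 (Fin.cons t y)) := fun y =>
        indicator_of_mem (s := {x : Eu (d + 1) | 0 < x 0}) (a := WithLp.toLp 2 (Fin.cons t y)) ht F
      simp only [h2]
      have h3 := lintegral_comp_smul_pos volume
        (fun y : Fin d → ℝ => F (WithLp.toLp 2 (Fin.cons t y))) ht
      rw [Module.finrank_fin_fun] at h3
      rw [lintegral_const_mul' _ _ ENNReal.ofReal_ne_top]
      have h4 : ∀ y : Fin d → ℝ, F (t • coneVec y) = F (WithLp.toLp 2 (Fin.cons t (t • y))) := by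
        intro y
        congr 1
        ext i
        refine Fin.cases ?_ (fun i => ?_) i <;> simp [coneVec]
      simp only [h4]
      rw [h3, ← mul_assoc, ← ENNReal.ofReal_mul (by positivity), mul_inv_cancel₀ (by positivity),
        ENNReal.ofReal_one, one_mul]
    · rw [indicator_of_notMem (show t ∉ Ioi (0 : ℝ) from ht)]
      have h2 : ∀ y : Fin d → ℝ, {x : Eu (d + 1) | 0 < x 0}.indicator F
          (WithLp.toLp 2 (Fin.cons t y)) = 0 := fun y =>
        indicator_of_notMem (s := {x : Eu (d + 1) | 0 < x 0}) (a := WithLp.toLp 2 (Fin.cons t y)) ht F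
      simp [h2]
  simp only [h1]
  rw [lintegral_indicator measurableSet_Ioi, lintegral_lintegral_swap]
  · refine lintegral_congr fun y => ?_
    set N := ‖coneVec y‖
    have hN : 0 < N := norm_coneVec_pos y
    rw [← lintegral_indicator measurableSet_Ioi, ← lintegral_indicator measurableSet_Ioi]
    have h5 := lintegral_comp_smul_pos volume ((Ioi (0 : ℝ)).indicator fun t =>
      ENNReal.ofReal (t ^ d) * F (t • coneVec y)) (inv_pos.2 hN)
    rw [Module.finrank_self, pow_one, inv_inv] at h5
    have h6 : ENNReal.ofReal N⁻¹ * ENNReal.ofReal N = 1 := by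
      rw [← ENNReal.ofReal_mul (by positivity), inv_mul_cancel₀ hN.ne', ENNReal.ofReal_one]
    rw [← one_mul (∫⁻ _, _), ← h6, mul_assoc, ← h5, ← lintegral_const_mul' _ _ ENNReal.ofReal_ne_top]
    refine lintegral_congr fun r => ?_
    by_cases hr : 0 < r
    · have hr' : (N⁻¹ • r) ∈ Ioi (0 : ℝ) := by
        simp only [smul_eq_mul, mem_Ioi]; positivity
      rw [indicator_of_mem hr', indicator_of_mem (show r ∈ Ioi (0 : ℝ) from hr), ← mul_assoc,
        ← ENNReal.ofReal_mul (by positivity)]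
      congr 2
      · rw [smul_eq_mul]; field_simp; rw [div_pow]; field_simp; ring
      · rw [gnomonic, smul_smul, smul_eq_mul, mul_comm]
    · have hr' : (N⁻¹ • r) ∉ Ioi (0 : ℝ) := by
        simp only [smul_eq_mul, mem_Ioi, not_lt] at hr ⊢
        exact mul_nonpos_of_nonneg_of_nonpos (by positivity) hr
      rw [indicator_of_notMem hr', indicator_of_notMem (show r ∉ Ioi (0 : ℝ) from hr), mul_zero]
  · refine Measurable.aemeasurable ?_
    exact (by fun_prop : Measurable fun q : ℝ × (Fin d → ℝ) => ENNReal.ofReal (q.1 ^ d)).mul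
      (hF.comp measurable_smul_coneVec)

/-- Radial integrals over the gnomonic chart are controlled by integrals over balls. -/
theorem exists_lintegral_gnomonic_le (d : ℕ) : ∃ C : ℝ≥0, ∀ ρ σ : ℝ, 1 / 2 ≤ ρ →
    ∀ F : Eu (d + 1) → ℝ≥0∞, Measurable F →
      ∫⁻ r in Ioo ρ σ, ∫⁻ y in ball (0 : Fin d → ℝ) 3, F (r • gnomonic y) ≤
        C * ∫⁻ x in ball (0 : Eu (d + 1)) σ, F x := by
  obtain ⟨M, hM⟩ := (isCompact_closedBall (0 : Fin d → ℝ) 3).exists_bound_of_continuousOn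
    (contDiff_coneVec (d := d)).continuous.continuousOn
  set c : ℝ := (1 / 2) ^ d * (M ^ (d + 1))⁻¹
  have hM1 : 1 ≤ M := (one_le_norm_coneVec 0).trans (hM 0 (by simp))
  have hc : 0 < c := by positivity
  refine ⟨(c⁻¹).toNNReal, fun ρ σ hρ F hF => ?_⟩
  set H := (ball (0 : Eu (d + 1)) σ).indicator F
  have hH : Measurable H := hF.indicator measurableSet_ball
  have h1 : ENNReal.ofReal c * ∫⁻ r in Ioo ρ σ, ∫⁻ y in ball (0 : Fin d → ℝ) 3, F (r • gnomonic y) ≤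
      ∫⁻ x in ball (0 : Eu (d + 1)) σ, F x := by
    calc _ = ENNReal.ofReal c * ∫⁻ y in ball (0 : Fin d → ℝ) 3, ∫⁻ r in Ioo ρ σ, F (r • gnomonic y) := by
          rw [lintegral_lintegral_swap]
          exact (hF.comp continuous_smul_gnomonic.measurable).aemeasurable
      _ = ∫⁻ y in ball (0 : Fin d → ℝ) 3, ∫⁻ r in Ioo ρ σ, ENNReal.ofReal c * F (r • gnomonic y) := by
          rw [← lintegral_const_mul' _ _ ENNReal.ofReal_ne_top]
          refine lintegral_congr fun y => ?_
          rw [← lintegral_const_mul' _ _ ENNReal.ofReal_ne_top]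
      _ ≤ ∫⁻ y in ball (0 : Fin d → ℝ) 3, ∫⁻ r in Ioi (0 : ℝ),
            ENNReal.ofReal (r ^ d * (‖coneVec y‖ ^ (d + 1))⁻¹) * H (r • gnomonic y) := by
          refine setLIntegral_mono' measurableSet_ball fun y hy => ?_
          refine le_trans (setLIntegral_mono' measurableSet_Ioo (fun r hr => ?_))
            (lintegral_mono_set (fun r hr => ?_ : Ioo ρ σ ⊆ Ioi 0))
          · have hr1 : 1 / 2 ≤ r := hρ.trans hr.1.le
            have hmem : r • gnomonic y ∈ ball (0 : Eu (d + 1)) σ := by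
              rw [mem_ball_zero_iff, norm_smul, norm_gnomonic, mul_one, Real.norm_eq_abs,
                abs_of_nonneg (by linarith)]
              exact hr.2
            simp only [H, indicator_of_mem hmem]
            have := hM y (ball_subset_closedBall hy)
            have := norm_coneVec_pos y
            simp only [c]
            gcongr
          · exact lt_of_lt_of_le (by norm_num) (hρ.trans hr.1.le)
      _ ≤ ∫⁻ y, ∫⁻ r in Ioi (0 : ℝ),
            ENNReal.ofReal (r ^ d * (‖coneVec y‖ ^ (d + 1))⁻¹) * H (r • gnomonic y) :=
          setLIntegral_le_lintegral _ _
      _ = ∫⁻ x in {x : Eu (d + 1) | 0 < x 0}, H x := (setLIntegral_halfspace_eq hH).symm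
      _ ≤ ∫⁻ x, H x := setLIntegral_le_lintegral _ _
      _ = _ := lintegral_indicator measurableSet_ball _
  calc _ = ENNReal.ofReal c⁻¹ * (ENNReal.ofReal c *
        ∫⁻ r in Ioo ρ σ, ∫⁻ y in ball (0 : Fin d → ℝ) 3, F (r • gnomonic y)) := by
        rw [← mul_assoc, ← ENNReal.ofReal_mul (by positivity), inv_mul_cancel₀ hc.ne',
          ENNReal.ofReal_one, one_mul]
    _ ≤ _ := mul_le_mul_right h1 _

/-- The closed cone `{x : |xⱼ| ≤ x₀ for all j}`. -/
def frontCone (d : ℕ) : Set (Eu (d + 1)) := {x | ∀ j, |x j| ≤ x 0}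

theorem isClosed_frontCone : IsClosed (frontCone d) := by
  have : frontCone d = ⋂ j, {x : Eu (d + 1) | |x j| ≤ x 0} := by ext; simp [frontCone]
  rw [this]
  exact isClosed_iInter fun j => isClosed_le (by fun_prop) (by fun_prop)

theorem setLIntegral_frontCone_le {F : Eu (d + 1) → ℝ≥0∞} (hF : Measurable F) {G : Set ℝ}
    (hG : MeasurableSet G) (hG1 : G ⊆ Ioo 0 1) :
    ∫⁻ x in {x | ‖x‖ ∈ G} ∩ frontCone d, F x ≤
      ∫⁻ r in G, ∫⁻ y in closedBall (0 : Fin d → ℝ) 1, F (r • gnomonic y) := by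
  have hA : MeasurableSet ({x : Eu (d + 1) | ‖x‖ ∈ G} ∩ frontCone d) :=
    (measurable_norm hG).inter isClosed_frontCone.measurableSet
  set H := ({x : Eu (d + 1) | ‖x‖ ∈ G} ∩ frontCone d).indicator F
  have hH : Measurable H := hF.indicator hA
  calc ∫⁻ x in {x | ‖x‖ ∈ G} ∩ frontCone d, F x
      = ∫⁻ x in {x : Eu (d + 1) | ‖x‖ ∈ G} ∩ frontCone d, H x :=
        setLIntegral_congr_fun hA fun x hx => (indicator_of_mem hx F).symm
    _ ≤ ∫⁻ x in {x : Eu (d + 1) | 0 < x 0}, H x := by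
        refine lintegral_mono_set fun x hx => ?_
        show 0 < x 0
        refine lt_of_le_of_ne ((abs_nonneg _).trans (hx.2 0)) fun h0 => ?_
        have : x = 0 := by
          ext j
          have := hx.2 j
          rw [← h0] at this
          simpa using this
        have h1 := (hG1 hx.1).1
        rw [this, norm_zero] at h1
        exact lt_irrefl _ h1
    _ = ∫⁻ y, ∫⁻ r in Ioi (0 : ℝ),
            ENNReal.ofReal (r ^ d * (‖coneVec y‖ ^ (d + 1))⁻¹) * H (r • gnomonic y) :=
        setLIntegral_halfspace_eq hH
    _ ≤ ∫⁻ y, (closedBall (0 : Fin d → ℝ) 1).indicator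
          (fun y => ∫⁻ r in G, F (r • gnomonic y)) y := by
        refine lintegral_mono fun y => ?_
        have hkey : ∀ r, 0 < r → r • gnomonic y ∈ {x : Eu (d + 1) | ‖x‖ ∈ G} ∩ frontCone d →
            r ∈ G ∧ y ∈ closedBall (0 : Fin d → ℝ) 1 := by
          rintro r hr ⟨h1, h2⟩
          have hr1 : ‖r • gnomonic y‖ = r := by
            rw [norm_smul, norm_gnomonic, mul_one, Real.norm_eq_abs, abs_of_pos hr]
          refine ⟨hr1 ▸ h1, ?_⟩
          rw [mem_closedBall_zero_iff, pi_norm_le_iff_of_nonneg zero_le_one]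
          intro i
          have h3 := h2 i.succ
          have hN := norm_coneVec_pos y
          simp only [gnomonic, PiLp.smul_apply, smul_eq_mul, coneVec_succ, coneVec_zero, abs_mul,
            abs_of_pos hr, abs_inv, abs_of_pos hN, mul_one] at h3
          rw [Real.norm_eq_abs]
          have h4 : 0 < r * ‖coneVec y‖⁻¹ := by positivity
          rw [← mul_assoc] at h3
          exact le_of_mul_le_mul_left (by simpa using h3) h4
        by_cases hy : y ∈ closedBall (0 : Fin d → ℝ) 1
        · rw [indicator_of_mem hy, ← lintegral_indicator measurableSet_Ioi, ← lintegral_indicator hG]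
          refine lintegral_mono fun r => ?_
          by_cases hr : 0 < r
          · rw [indicator_of_mem (show r ∈ Ioi (0 : ℝ) from hr)]
            by_cases hm : r • gnomonic y ∈ {x : Eu (d + 1) | ‖x‖ ∈ G} ∩ frontCone d
            · have hrG := (hkey r hr hm).1
              simp only [H]
              rw [indicator_of_mem hm, indicator_of_mem hrG]
              refine mul_le_of_le_one_left' ?_
              rw [ENNReal.ofReal_le_one]
              have h5 : r ^ d ≤ 1 := pow_le_one₀ hr.le (hG1 hrG).2.le
              have h6 : (‖coneVec y‖ ^ (d + 1))⁻¹ ≤ 1 :=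
                inv_le_one_of_one_le₀ (one_le_pow₀ (one_le_norm_coneVec y))
              exact mul_le_one₀ h5 (by positivity) h6
            · simp only [H]
              rw [indicator_of_notMem hm, mul_zero]
              exact zero_le
          · rw [indicator_of_notMem (show r ∉ Ioi (0 : ℝ) from hr)]
            exact zero_le
        · rw [indicator_of_notMem hy]
          refine le_of_eq ?_
          rw [setLIntegral_congr_fun (g := fun _ => 0) measurableSet_Ioi, lintegral_zero]
          intro r hr
          simp only [H]
          rw [indicator_of_notMem (fun hm => hy (hkey r hr hm).2), mul_zero]
    _ = ∫⁻ y in closedBall (0 : Fin d → ℝ) 1, ∫⁻ r in G, F (r • gnomonic y) :=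
        lintegral_indicator measurableSet_closedBall _
    _ = _ := by
        rw [lintegral_lintegral_swap]
        exact (hF.comp (continuous_smul_gnomonic.measurable.comp measurable_swap)).aemeasurable

end gnomonicChart

section shellEnergy
open Filter

variable {d : ℕ}

/-- The coordinate isometries carrying the front cone onto the cone in direction `±eᵢ`. -/
def coneIso (τ : Fin (d + 1) × Bool) : Eu (d + 1) ≃ₗᵢ[ℝ] Eu (d + 1) :=
  (LinearIsometryEquiv.piLpCongrLeft 2 ℝ ℝ (Equiv.swap 0 τ.1)).trans
    (if τ.2 then LinearIsometryEquiv.neg ℝ else LinearIsometryEquiv.refl ℝ _)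

theorem exists_mem_frontCone (x : Eu (d + 1)) : ∃ τ, (coneIso τ).symm x ∈ frontCone d := by
  obtain ⟨i, -, hi⟩ := Finset.exists_max_image Finset.univ (fun j => |x j|) ⟨0, Finset.mem_univ 0⟩
  by_cases hx : 0 ≤ x i
  · refine ⟨(i, false), fun j => ?_⟩
    have h1 : ∀ j, (coneIso (i, false)).symm x j = x (Equiv.swap 0 i j) := fun j => by
      simp [coneIso, Equiv.piCongrLeft']
    rw [h1, h1, Equiv.swap_apply_left, ← abs_of_nonneg hx]
    exact hi _ (Finset.mem_univ _)
  · refine ⟨(i, true), fun j => ?_⟩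
    have h1 : ∀ j, (coneIso (i, true)).symm x j = - x (Equiv.swap 0 i j) := fun j => by
      simp [coneIso, Equiv.piCongrLeft']
    rw [h1, h1, Equiv.swap_apply_left, abs_neg, ← abs_of_neg (not_le.1 hx)]
    exact hi _ (Finset.mem_univ _)

/-- The integral of `F` over the sphere of radius `r`, up to constants. -/
def chartSum (F : Eu (d + 1) → ℝ≥0∞) (r : ℝ) : ℝ≥0∞ :=
  ∑ τ, ∫⁻ y in closedBall (0 : Fin d → ℝ) 1, F (coneIso τ (r • gnomonic y))

theorem measurable_chart {F : Eu (d + 1) → ℝ≥0∞} (hF : Measurable F) (τ : Fin (d + 1) × Bool) :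
    Measurable fun q : ℝ × (Fin d → ℝ) => F (coneIso τ (q.1 • gnomonic q.2)) :=
  hF.comp ((coneIso τ).continuous.comp continuous_smul_gnomonic).measurable

theorem measurable_chartSum {F : Eu (d + 1) → ℝ≥0∞} (hF : Measurable F) :
    Measurable (chartSum F) :=
  Finset.measurable_fun_sum _ fun τ _ => (measurable_chart hF τ).lintegral_prod_right'

theorem setLIntegral_shell_le_chartSum {F : Eu (d + 1) → ℝ≥0∞} (hF : Measurable F) {G : Set ℝ}
    (hG : MeasurableSet G) (hG1 : G ⊆ Ioo 0 1) :
    ∫⁻ x in {x : Eu (d + 1) | ‖x‖ ∈ G}, F x ≤ ∫⁻ r in G, chartSum F r := by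
  have hA : MeasurableSet {x : Eu (d + 1) | ‖x‖ ∈ G} := measurable_norm hG
  have hAc : MeasurableSet ({x : Eu (d + 1) | ‖x‖ ∈ G} ∩ frontCone d) :=
    hA.inter isClosed_frontCone.measurableSet
  set H : Fin (d + 1) × Bool → Eu (d + 1) → ℝ≥0∞ := fun τ x =>
    ({x : Eu (d + 1) | ‖x‖ ∈ G} ∩ frontCone d).indicator (fun z => F (coneIso τ z))
      ((coneIso τ).symm x)
  have hFm : ∀ τ, Measurable fun z => F (coneIso (d := d) τ z) := fun τ =>
    hF.comp (coneIso τ).continuous.measurable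
  have hHm : ∀ τ, Measurable (H τ) := fun τ =>
    ((hFm τ).indicator hAc).comp (coneIso τ).symm.continuous.measurable
  calc ∫⁻ x in {x : Eu (d + 1) | ‖x‖ ∈ G}, F x ≤ ∫⁻ x in {x : Eu (d + 1) | ‖x‖ ∈ G}, ∑ τ, H τ x := by
        refine setLIntegral_mono' hA fun x hx => ?_
        obtain ⟨τ, hτ⟩ := exists_mem_frontCone x
        refine le_trans ?_ (Finset.single_le_sum (f := fun τ => H τ x) (fun _ _ => zero_le)
          (Finset.mem_univ τ))
        have hx1 : ‖(coneIso τ).symm x‖ ∈ G := by rw [LinearIsometryEquiv.norm_map]; exact hx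
        simp only [H]
        rw [indicator_of_mem (s := {x : Eu (d + 1) | ‖x‖ ∈ G} ∩ frontCone d)
          (a := (coneIso τ).symm x) ⟨hx1, hτ⟩ fun z => F (coneIso τ z),
          LinearIsometryEquiv.apply_symm_apply]
    _ ≤ ∫⁻ x, ∑ τ, H τ x := setLIntegral_le_lintegral _ _
    _ = ∑ τ, ∫⁻ x, H τ x := lintegral_finsetSum _ fun τ _ => hHm τ
    _ ≤ ∑ τ, ∫⁻ r in G, ∫⁻ y in closedBall (0 : Fin d → ℝ) 1, F (coneIso τ (r • gnomonic y)) := by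
        refine Finset.sum_le_sum fun τ _ => ?_
        have h1 := (coneIso τ).measurePreserving.lintegral_comp (hHm τ)
        rw [← h1]
        simp only [H, LinearIsometryEquiv.symm_apply_apply]
        rw [lintegral_indicator hAc]
        exact setLIntegral_frontCone_le (hFm τ) hG hG1
    _ = _ := (lintegral_finsetSum _ fun τ _ => (measurable_chart hF τ).lintegral_prod_right').symm

theorem ContDiffBump.exists_enorm_fderiv_le {E : Type*} [NormedAddCommGroup E] [NormedSpace ℝ E]
    [HasContDiffBump E] [FiniteDimensional ℝ E] {c : E} (f : ContDiffBump c) :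
    ∃ M : ℝ≥0, ∀ y, ‖fderiv ℝ f y‖ₑ ≤ M := by
  obtain ⟨M, hM⟩ := ((f.contDiff (n := 1)).continuous_fderiv one_ne_zero).bounded_above_of_compact_support
    (f.hasCompactSupport.fderiv ℝ)
  refine ⟨M.toNNReal, fun y => ?_⟩
  rw [← ofReal_norm]
  exact ENNReal.ofReal_le_ofReal (hM y)

theorem exists_chart_energy_smooth (hd : 1 ≤ d) {q m : ℝ} (hq : 1 < q) (hm : 1 ≤ m)
    (hmq : 1 / m = min (1 / q + 1 / d) 1) :
    ∃ C : ℝ≥0, ∀ ρ σ : ℝ, 1 / 2 ≤ ρ → σ ≤ 1 → ∀ V : Eu (d + 1) → ℝ, ContDiff ℝ (⊤ : ℕ∞) V →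
      ∫⁻ r in Ioo ρ σ, (∫⁻ y in closedBall (0 : Fin d → ℝ) 1, ‖V (r • gnomonic y)‖ₑ ^ q) ^ (m / q) ≤
        C * ∫⁻ x in ball (0 : Eu (d + 1)) σ, (‖V x‖ₑ ^ m + ‖fderiv ℝ V x‖ₑ ^ m) := by
  obtain ⟨C₁, hC₁⟩ := exists_gagliardo_nirenberg_sobolev hd hq hm hmq
  obtain ⟨C₂, hC₂⟩ := exists_lintegral_gnomonic_le d
  let χ : ContDiffBump (0 : Fin d → ℝ) := ⟨1, 2, one_pos, one_lt_two⟩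
  obtain ⟨M₁, hM₁⟩ := χ.exists_enorm_fderiv_le
  have hgd : Differentiable ℝ (gnomonic (d := d)) := contDiff_gnomonic.differentiable one_ne_zero
  obtain ⟨M₂, hM₂⟩ := (isCompact_closedBall (0 : Fin d → ℝ) 3).exists_bound_of_continuousOn
    ((contDiff_gnomonic (d := d)).continuous_fderiv one_ne_zero).continuousOn
  set K : ℝ≥0∞ := (ENNReal.ofReal M₂ + M₁) ^ m * 2 ^ (m - 1)
  have hK : K ≠ ∞ := by simp only [K]; finiteness
  refine ⟨C₁ * K.toNNReal * C₂, fun ρ σ hρ hσ V hV => ?_⟩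
  set F : Eu (d + 1) → ℝ≥0∞ := fun x => ‖V x‖ₑ ^ m + ‖fderiv ℝ V x‖ₑ ^ m
  have hFm : Measurable F := (hV.continuous.enorm.measurable.pow_const m).add
    ((continuous_enorm_fderiv hV).measurable.pow_const m)
  have hq0 : 0 < q := by linarith
  have hm0 : 0 < m := by linarith
  have hr : ∀ r ∈ Ioo ρ σ, (∫⁻ y in closedBall (0 : Fin d → ℝ) 1, ‖V (r • gnomonic y)‖ₑ ^ q) ^ (m / q) ≤
      C₁ * (K * ∫⁻ y in ball (0 : Fin d → ℝ) 3, F (r • gnomonic y)) := by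
    intro r hr
    have hr0 : 0 < r := by linarith [hr.1]
    have hr1 : r ≤ 1 := by linarith [hr.2]
    set g : (Fin d → ℝ) → ℝ := fun y => V (r • gnomonic y)
    set v : (Fin d → ℝ) → ℝ := fun y => χ y * g y
    have hg : ContDiff ℝ 1 g := (hV.of_le (by simp)).comp (contDiff_gnomonic.const_smul r)
    have hv : ContDiff ℝ 1 v := χ.contDiff.mul hg
    have hsupp : Function.support v ⊆ ball 0 2 := fun y hy => by
      have : y ∈ Function.support χ := fun h => hy (by simp [v, h])
      rwa [χ.support_eq] at this
    have hgn := hC₁ v hv hsupp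
    refine le_trans (ENNReal.rpow_le_rpow ?_ (by positivity)) (hgn.trans (mul_le_mul_right ?_ _))
    · refine le_trans (setLIntegral_mono' measurableSet_closedBall fun y hy => ?_)
        (setLIntegral_le_lintegral (closedBall 0 1) _)
      simp only [v]
      rw [χ.one_of_mem_closedBall hy, one_mul]
    · rw [← lintegral_const_mul' _ _ hK, ← lintegral_indicator measurableSet_ball]
      refine lintegral_mono fun y => ?_
      by_cases hy : y ∈ ball (0 : Fin d → ℝ) 3
      · rw [indicator_of_mem hy]
        have h1 : fderiv ℝ v y = χ y • fderiv ℝ g y + g y • fderiv ℝ χ y :=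
          fderiv_fun_mul ((χ.contDiff (n := 1)).differentiable one_ne_zero y)
            (hg.differentiable one_ne_zero y)
        have h2 : fderiv ℝ g y = (fderiv ℝ V (r • gnomonic y)).comp (r • fderiv ℝ gnomonic y) := by
          have h3 : HasFDerivAt (fun y => r • gnomonic (d := d) y) (r • fderiv ℝ gnomonic y) y :=
            (hgd y).hasFDerivAt.const_smul r
          exact (((hV.differentiable (by simp)) _).hasFDerivAt.comp y h3).fderiv
        have h3 : ‖fderiv ℝ g y‖ₑ ≤ ENNReal.ofReal M₂ * ‖fderiv ℝ V (r • gnomonic y)‖ₑ := by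
          rw [h2, ← ofReal_norm, ← ofReal_norm, ← ENNReal.ofReal_mul
            ((norm_nonneg _).trans (hM₂ 0 (by simp)))]
          refine ENNReal.ofReal_le_ofReal ((ContinuousLinearMap.opNorm_comp_le _ _).trans ?_)
          rw [mul_comm, norm_smul, Real.norm_eq_abs, abs_of_pos hr0]
          have := hM₂ y (ball_subset_closedBall hy)
          gcongr
          calc r * ‖fderiv ℝ gnomonic y‖ ≤ 1 * ‖fderiv ℝ gnomonic y‖ := by gcongr
            _ ≤ M₂ := by rwa [one_mul]
        have hχ : ‖χ y‖ₑ ≤ 1 := by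
          rw [← ofReal_norm, Real.norm_of_nonneg χ.nonneg, ENNReal.ofReal_le_one]
          exact χ.le_one
        have h4 : ‖fderiv ℝ v y‖ₑ ≤ (ENNReal.ofReal M₂ + M₁) *
            (‖V (r • gnomonic y)‖ₑ + ‖fderiv ℝ V (r • gnomonic y)‖ₑ) := by
          have h5 : ‖χ y • fderiv ℝ g y + g y • fderiv ℝ χ y‖ₑ ≤
              ‖χ y • fderiv ℝ g y‖ₑ + ‖g y • fderiv ℝ χ y‖ₑ := by
            rw [← ofReal_norm, ← ofReal_norm, ← ofReal_norm, ← ENNReal.ofReal_add (norm_nonneg _)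
              (norm_nonneg _)]
            exact ENNReal.ofReal_le_ofReal (norm_add_le _ _)
          rw [h1]
          calc _ ≤ ‖χ y • fderiv ℝ g y‖ₑ + ‖g y • fderiv ℝ χ y‖ₑ := h5
            _ = ‖χ y‖ₑ * ‖fderiv ℝ g y‖ₑ + ‖g y‖ₑ * ‖fderiv ℝ χ y‖ₑ := by
              rw [enorm_smul, enorm_smul]
            _ ≤ 1 * (ENNReal.ofReal M₂ * ‖fderiv ℝ V (r • gnomonic y)‖ₑ) + ‖g y‖ₑ * M₁ := by
              gcongr
              exact hM₁ y
            _ ≤ (ENNReal.ofReal M₂ * ‖fderiv ℝ V (r • gnomonic y)‖ₑ + M₁ * ‖g y‖ₑ) +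
                (ENNReal.ofReal M₂ * ‖g y‖ₑ + M₁ * ‖fderiv ℝ V (r • gnomonic y)‖ₑ) := by
              rw [one_mul, mul_comm ‖g y‖ₑ]
              exact le_self_add
            _ = _ := by ring
        calc ‖fderiv ℝ v y‖ₑ ^ m ≤ ((ENNReal.ofReal M₂ + M₁) *
            (‖V (r • gnomonic y)‖ₑ + ‖fderiv ℝ V (r • gnomonic y)‖ₑ)) ^ m := by gcongr
          _ ≤ (ENNReal.ofReal M₂ + M₁) ^ m * (2 ^ (m - 1) * F (r • gnomonic y)) := by
            rw [ENNReal.mul_rpow_of_nonneg _ _ hm0.le]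
            gcongr
            exact ENNReal.rpow_add_le_mul_rpow_add_rpow _ _ hm
          _ = K * F (r • gnomonic y) := by simp only [K]; ring
      · rw [indicator_of_notMem hy, fderiv_eq_zero_of_notMem_tsupport, ← ofReal_norm, norm_zero,
          ENNReal.ofReal_zero, ENNReal.zero_rpow_of_pos hm0]
        intro hy2
        have h1 : tsupport v ⊆ closedBall 0 2 :=
          (closure_mono hsupp).trans closure_ball_subset_closedBall
        refine hy ?_
        have := h1 hy2
        rw [mem_closedBall_zero_iff] at this
        rw [mem_ball_zero_iff]
        linarith
  have hfin : (C₁ : ℝ≥0∞) * K ≠ ∞ := by finiteness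
  calc _ ≤ ∫⁻ r in Ioo ρ σ, C₁ * (K * ∫⁻ y in ball (0 : Fin d → ℝ) 3, F (r • gnomonic y)) :=
        setLIntegral_mono' measurableSet_Ioo hr
    _ = C₁ * K * ∫⁻ r in Ioo ρ σ, ∫⁻ y in ball (0 : Fin d → ℝ) 3, F (r • gnomonic y) := by
        rw [← lintegral_const_mul' _ _ hfin]
        exact lintegral_congr fun r => (mul_assoc _ _ _).symm
    _ ≤ C₁ * K * (C₂ * ∫⁻ x in ball (0 : Eu (d + 1)) σ, F x) :=
        mul_le_mul_right (hC₂ ρ σ hρ F hFm) _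
    _ = _ := by
        rw [ENNReal.coe_mul, ENNReal.coe_mul, ENNReal.coe_toNNReal hK, ← mul_assoc]

theorem ENNReal.finset_sum_rpow_le {ι : Type*} (s : Finset ι) (f : ι → ℝ≥0∞) {a : ℝ} (ha0 : 0 < a)
    (ha1 : a ≤ 1) : (∑ i ∈ s, f i) ^ a ≤ ∑ i ∈ s, f i ^ a := by
  classical
  induction s using Finset.induction_on with
  | empty => simp [ha0]
  | insert i s hi ih =>
    rw [Finset.sum_insert hi, Finset.sum_insert hi]
    exact (ENNReal.rpow_add_le_add_rpow _ _ ha0.le ha1).trans (add_le_add_right ih _)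

theorem enorm_fderiv_comp_isometry {V : Eu d → ℝ} (hV : ContDiff ℝ (⊤ : ℕ∞) V)
    (T : Eu d ≃ₗᵢ[ℝ] Eu d) (x : Eu d) :
    ‖fderiv ℝ (fun x => V (T x)) x‖ₑ ≤ ‖fderiv ℝ V (T x)‖ₑ := by
  have h1 : HasFDerivAt (fun x => V (T x))
      ((fderiv ℝ V (T x)).comp (T : Eu d ≃L[ℝ] Eu d).toContinuousLinearMap) x :=
    ((hV.differentiable (by simp)) (T x)).hasFDerivAt.comp x
      (T : Eu d ≃L[ℝ] Eu d).toContinuousLinearMap.hasFDerivAt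
  rw [h1.fderiv, ← ofReal_norm, ← ofReal_norm]
  refine ENNReal.ofReal_le_ofReal ((ContinuousLinearMap.opNorm_comp_le _ _).trans ?_)
  refine mul_le_of_le_one_right (norm_nonneg _) (ContinuousLinearMap.opNorm_le_bound _ zero_le_one
    fun x => ?_)
  simp

theorem exists_chartSum_energy_smooth (hd : 1 ≤ d) {q m : ℝ} (hq : 1 < q) (hm : 1 ≤ m) (hmq' : m ≤ q)
    (hmq : 1 / m = min (1 / q + 1 / d) 1) :
    ∃ C : ℝ≥0, ∀ ρ σ : ℝ, 1 / 2 ≤ ρ → σ ≤ 1 → ∀ V : Eu (d + 1) → ℝ, ContDiff ℝ (⊤ : ℕ∞) V →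
      ∫⁻ r in Ioo ρ σ, chartSum (fun x => ‖V x‖ₑ ^ q) r ^ (m / q) ≤
        C * ((∫⁻ x in ball (0 : Eu (d + 1)) σ, ‖V x‖ₑ ^ m) +
          ∫⁻ x in ball (0 : Eu (d + 1)) σ, ‖fderiv ℝ V x‖ₑ ^ m) := by
  obtain ⟨C, hC⟩ := exists_chart_energy_smooth hd hq hm hmq
  refine ⟨Fintype.card (Fin (d + 1) × Bool) * C, fun ρ σ hρ hσ V hV => ?_⟩
  have hq0 : 0 < q := by linarith
  have hm0 : 0 < m := by linarith
  have hVm : Measurable fun x => ‖V x‖ₑ ^ q := hV.continuous.enorm.measurable.pow_const q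
  set E := (∫⁻ x in ball (0 : Eu (d + 1)) σ, ‖V x‖ₑ ^ m) +
          ∫⁻ x in ball (0 : Eu (d + 1)) σ, ‖fderiv ℝ V x‖ₑ ^ m
  have hτ : ∀ τ : Fin (d + 1) × Bool, ∫⁻ r in Ioo ρ σ, (∫⁻ y in closedBall (0 : Fin d → ℝ) 1,
      ‖V (coneIso τ (r • gnomonic y))‖ₑ ^ q) ^ (m / q) ≤ C * E := by
    intro τ
    have hVτ : ContDiff ℝ (⊤ : ℕ∞) fun x => V (coneIso τ x) := hV.comp (coneIso τ).contDiff
    refine (hC ρ σ hρ hσ (fun x => V (coneIso τ x)) hVτ).trans (mul_le_mul_right ?_ _)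
    rw [lintegral_add_left (hVτ.continuous.enorm.measurable.pow_const m)]
    have hinv : ∀ F : Eu (d + 1) → ℝ≥0∞, Measurable F →
        ∫⁻ x in ball (0 : Eu (d + 1)) σ, F (coneIso τ x) = ∫⁻ x in ball (0 : Eu (d + 1)) σ, F x := by
      intro F hF
      rw [← lintegral_indicator measurableSet_ball, ← lintegral_indicator measurableSet_ball,
        ← (coneIso τ).measurePreserving.lintegral_comp (hF.indicator measurableSet_ball)]
      refine lintegral_congr fun x => ?_
      simp only [indicator, mem_ball_zero_iff, LinearIsometryEquiv.norm_map]
    refine add_le_add (hinv _ (hV.continuous.enorm.measurable.pow_const m)).le ?_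
    rw [← hinv _ ((continuous_enorm_fderiv hV).measurable.pow_const m)]
    refine lintegral_mono fun x => ?_
    gcongr
    exact enorm_fderiv_comp_isometry hV _ x
  calc _ ≤ ∫⁻ r in Ioo ρ σ, ∑ τ, (∫⁻ y in closedBall (0 : Fin d → ℝ) 1,
      ‖V (coneIso τ (r • gnomonic y))‖ₑ ^ q) ^ (m / q) := lintegral_mono fun r =>
        ENNReal.finset_sum_rpow_le _ _ (by positivity) ((div_le_one hq0).2 hmq')
    _ = ∑ τ, ∫⁻ r in Ioo ρ σ, (∫⁻ y in closedBall (0 : Fin d → ℝ) 1,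
      ‖V (coneIso τ (r • gnomonic y))‖ₑ ^ q) ^ (m / q) :=
        lintegral_finsetSum _ fun τ _ =>
          ((measurable_chart hVm τ).lintegral_prod_right').pow_const _
    _ ≤ ∑ _τ : Fin (d + 1) × Bool, C * E := Finset.sum_le_sum fun τ _ => hτ τ
    _ = _ := by
        rw [Finset.sum_const, nsmul_eq_mul, Finset.card_univ]
        push_cast
        ring

theorem ENNReal.liminf_add_liminf_le (f g : ℕ → ℝ≥0∞) :
    liminf f atTop + liminf g atTop ≤ liminf (fun j => f j + g j) atTop := by
  simp only [liminf_eq_iSup_iInf_of_nat]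
  rw [ENNReal.iSup_add_iSup_of_monotone
    (fun a b hab => biInf_mono fun i hi => le_trans hab hi)
    (fun a b hab => biInf_mono fun i hi => le_trans hab hi)]
  refine iSup_mono fun N => le_iInf₂ fun i hi => add_le_add (iInf₂_le i hi) (iInf₂_le i hi)

theorem chartSum_liminf_le {F : ℕ → Eu (d + 1) → ℝ≥0∞} (hF : ∀ j, Measurable (F j)) (r : ℝ) :
    chartSum (fun x => liminf (fun j => F j x) atTop) r ≤
      liminf (fun j => chartSum (F j) r) atTop := by
  have key : ∀ (s : Finset (Fin (d + 1) × Bool)), ∑ τ ∈ s, ∫⁻ y in closedBall (0 : Fin d → ℝ) 1,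
      liminf (fun j => F j (coneIso τ (r • gnomonic y))) atTop ≤
      liminf (fun j => ∑ τ ∈ s, ∫⁻ y in closedBall (0 : Fin d → ℝ) 1,
        F j (coneIso τ (r • gnomonic y))) atTop := by
    classical
    intro s
    induction s using Finset.induction_on with
    | empty => simp
    | insert i s hi ih =>
      simp only [Finset.sum_insert hi]
      refine le_trans (add_le_add (lintegral_liminf_le fun j => ?_) ih) (ENNReal.liminf_add_liminf_le _ _)
      exact (measurable_chart (hF j) i).comp (by fun_prop : Measurable fun y : Fin d → ℝ => (r, y))
  exact key _

theorem exists_shell_energy (hd : 1 ≤ d) {q m : ℝ} (hq : 1 < q) (hm : 1 ≤ m) (hmq' : m ≤ q)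
    (hmq : 1 / m = min (1 / q + 1 / d) 1) :
    ∃ C : ℝ≥0, ∀ ρ σ R : ℝ, 1 / 2 ≤ ρ → σ ≤ 1 → σ < R → ∀ (w : Eu (d + 1) → ℝ)
      (dw : Eu (d + 1) → Eu (d + 1)), IsWeakGradOn (d + 1) (ball 0 R) w dw →
      IntegrableOn w (ball 0 R) → IntegrableOn dw (ball 0 R) →
      ∃ B : ℝ → ℝ≥0∞, Measurable B ∧
        (∀ G : Set ℝ, MeasurableSet G → G ⊆ Ioo ρ σ →
          ∫⁻ x in {x : Eu (d + 1) | ‖x‖ ∈ G}, ‖w x‖ₑ ^ q ≤ ∫⁻ r in G, B r) ∧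
        ∫⁻ r in Ioo ρ σ, B r ^ (m / q) ≤ C * ((∫⁻ x in ball (0 : Eu (d + 1)) R, ‖w x‖ₑ ^ m) +
          ∫⁻ x in ball (0 : Eu (d + 1)) R, ‖dw x‖ₑ ^ m) := by
  obtain ⟨C, hC⟩ := exists_chartSum_energy_smooth hd hq hm hmq' hmq
  refine ⟨C, fun ρ σ R hρ hσ hσR w dw h hw hdw => ?_⟩
  obtain ⟨W, hW, hWt, hWs⟩ := exists_approx_ball h hw hdw
  have hq0 : 0 < q := by linarith
  have hm0 : 0 < m := by linarith
  have hFm : ∀ j, Measurable fun x => ‖W j x‖ₑ ^ q := fun j =>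
    (hW j).continuous.enorm.measurable.pow_const q
  set F : Eu (d + 1) → ℝ≥0∞ := fun x => liminf (fun j => ‖W j x‖ₑ ^ q) atTop
  have hF : Measurable F := Measurable.liminf hFm
  refine ⟨chartSum F, measurable_chartSum hF, fun G hG hGs => ?_, ?_⟩
  · refine le_trans (le_of_eq ?_) (setLIntegral_shell_le_chartSum hF hG fun r hr =>
      ⟨lt_of_lt_of_le (by norm_num) (hρ.trans (hGs hr).1.le), (hGs hr).2.trans_le hσ⟩)
    have hA : MeasurableSet {x : Eu (d + 1) | ‖x‖ ∈ G} := measurable_norm hG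
    refine setLIntegral_congr_fun_ae hA ?_
    filter_upwards [hWt] with x hx hxG
    have hxR : x ∈ ball (0 : Eu (d + 1)) R := mem_ball_zero_iff.2 ((hGs hxG).2.trans hσR)
    exact (((ENNReal.continuous_rpow_const (y := q)).tendsto _).comp (hx hxR).enorm).liminf_eq.symm
  · refine lintegral_le_of_le_liminf
      (f := fun j r => chartSum (fun x => ‖W j x‖ₑ ^ q) r ^ (m / q))
      (fun j => ((measurable_chartSum (hFm j)).pow_const _).aemeasurable)
      (Eventually.of_forall fun r => ?_) ?_
    · have hmono : Monotone fun z : ℝ≥0∞ => z ^ (m / q) :=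
        ENNReal.monotone_rpow_of_nonneg (by positivity)
      refine (hmono (chartSum_liminf_le hFm r)).trans (le_of_eq ?_)
      exact hmono.map_liminf_of_continuousAt _ (ENNReal.continuous_rpow_const.continuousAt)
    · filter_upwards [hWs σ hσR] with j hj
      exact (hC ρ σ hρ hσ (W j) (hW j)).trans
        (mul_le_mul_right (add_le_add (hj m hm).1 (hj m hm).2) _)

end shellEnergy

section cutoff
open Filter

theorem exists_isCompact_le_of_lintegral_le {f : ℝ → ℝ≥0∞} (hf : Measurable f) {ρ σ : ℝ} (hρσ : ρ < σ)
    {E : ℝ≥0∞} (hE : E ≠ ∞) (h : ∫⁻ r in Ioo ρ σ, f r ≤ E) :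
    ∃ K ⊆ Ioo ρ σ, IsCompact K ∧ ENNReal.ofReal ((σ - ρ) / 2) ≤ volume K ∧
      ∀ r ∈ K, f r ≤ ENNReal.ofReal (4 / (σ - ρ)) * E := by
  have hs : 0 < σ - ρ := by linarith
  set t := ENNReal.ofReal (4 / (σ - ρ)) * E
  set b : ℝ≥0∞ := volume (Ioo ρ σ ∩ {r | t < f r})
  have hb : b ≤ ENNReal.ofReal ((σ - ρ) / 4) := by
    have hb1 : b = volume.restrict (Ioo ρ σ) {r | t < f r} := by
      rw [Measure.restrict_apply (measurableSet_lt measurable_const hf), inter_comm]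
    rcases eq_or_ne E 0 with h0 | h0
    · have h1 : ∫⁻ r in Ioo ρ σ, f r = 0 := le_antisymm (h0 ▸ h) zero_le
      rw [lintegral_eq_zero_iff hf] at h1
      have : b = 0 := by
        rw [hb1]
        refine measure_mono_null (fun r hr => ?_) h1
        simp only [t, h0, mul_zero, mem_ofPred_eq] at hr
        exact hr.ne'
      rw [this]; exact zero_le
    · have ht0 : t ≠ 0 := mul_ne_zero (ENNReal.ofReal_pos.2 (by positivity)).ne' h0
      have ht : t ≠ ∞ := ENNReal.mul_ne_top ENNReal.ofReal_ne_top hE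
      have h1 : t * b ≤ E := by
        refine le_trans ?_ ((mul_meas_ge_le_lintegral (μ := volume.restrict (Ioo ρ σ)) hf t).trans h)
        rw [hb1]
        exact mul_le_mul_right (measure_mono fun r (hr : t < f r) => hr.le) _
      refine (ENNReal.mul_le_mul_iff_right ht0 ht).1 (h1.trans (le_of_eq ?_))
      simp only [t]
      rw [mul_right_comm, ← ENNReal.ofReal_mul (by positivity), show 4 / (σ - ρ) * ((σ - ρ) / 4) = 1
        by field_simp, ENNReal.ofReal_one, one_mul]
  have hSm : MeasurableSet (Ioo ρ σ ∩ {r | f r ≤ t}) :=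
    measurableSet_Ioo.inter (measurableSet_le hf measurable_const)
  have hS : ENNReal.ofReal ((σ - ρ) / 2) < volume (Ioo ρ σ ∩ {r | f r ≤ t}) := by
    have h1 : volume (Ioo ρ σ) ≤ volume (Ioo ρ σ ∩ {r | f r ≤ t}) + b := by
      refine le_trans (measure_mono fun r hr => ?_) (measure_union_le _ _)
      rcases le_or_gt (f r) t with h | h
      · exact Or.inl ⟨hr, h⟩
      · exact Or.inr ⟨hr, h⟩
    rw [Real.volume_Ioo] at h1
    by_contra! hcon
    have h2 := h1.trans (add_le_add hcon hb)
    rw [← ENNReal.ofReal_add (by positivity) (by positivity), ENNReal.ofReal_le_ofReal_iff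
      (by positivity)] at h2
    linarith
  obtain ⟨K, hKS, hK, hlt⟩ := hSm.exists_lt_isCompact hS
  exact ⟨K, fun r hr => (hKS hr).1, hK, hlt.le, fun r hr => (hKS hr).2⟩

/-- The cutoff decreasing linearly with respect to the measure of `K`. -/
def measCutoff (K : Set ℝ) (r : ℝ) : ℝ := 1 - volume.real (K ∩ Iio r) / volume.real K

theorem measCutoff_mem {K : Set ℝ} (hK : IsCompact K) (r : ℝ) :
    0 ≤ measCutoff K r ∧ measCutoff K r ≤ 1 := by
  have h1 : volume.real (K ∩ Iio r) ≤ volume.real K :=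
    measureReal_mono inter_subset_left hK.measure_lt_top.ne
  refine ⟨sub_nonneg.2 (div_le_one_of_le₀ h1 measureReal_nonneg), sub_le_self _ (by positivity)⟩

theorem measCutoff_eq_one {K : Set ℝ} {r : ℝ} (h : ∀ s ∈ K, r ≤ s) : measCutoff K r = 1 := by
  have : K ∩ Iio r = ∅ := eq_empty_of_forall_notMem fun s hs => (h s hs.1).not_gt hs.2
  simp [measCutoff, this]

theorem measCutoff_eq_zero {K : Set ℝ} {r : ℝ} (hK : volume.real K ≠ 0) (h : ∀ s ∈ K, s < r) :
    measCutoff K r = 0 := by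
  have : K ∩ Iio r = K := inter_eq_left.2 h
  simp [measCutoff, this, hK]

theorem measCutoff_lipschitz {K : Set ℝ} (hK : IsCompact K) :
    LipschitzWith (volume.real K)⁻¹.toNNReal (measCutoff K) := by
  refine LipschitzWith.of_le_add_mul _ fun r s => ?_
  rw [Real.coe_toNNReal _ (by positivity)]
  have h1 : volume.real (K ∩ Iio s) ≤ volume.real (K ∩ Iio r) + dist r s := by
    have h2 : K ∩ Iio s ⊆ (K ∩ Iio r) ∪ Ico r s := by
      rintro t ⟨ht, hts⟩
      rcases lt_or_ge t r with h | h
      · exact Or.inl ⟨ht, h⟩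
      · exact Or.inr ⟨h, hts⟩
    refine (measureReal_mono h2 (measure_union_lt_top ((measure_mono inter_subset_left).trans_lt
      hK.measure_lt_top) (by simp)).ne).trans ((measureReal_union_le _ _).trans ?_)
    gcongr
    rw [Real.volume_real_Ico, Real.dist_eq]
    exact max_le (by rw [abs_sub_comm]; exact le_abs_self _) (abs_nonneg _)
  have h3 := div_le_div_of_nonneg_right h1 (measureReal_nonneg (μ := volume) (s := K))
  rw [add_div] at h3
  simp only [measCutoff]
  rw [inv_mul_eq_div]
  linarith

theorem measCutoff_eventually {K : Set ℝ} (hK : IsCompact K) {r : ℝ} (hr : r ∉ K) :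
    ∀ᶠ s in 𝓝 r, measCutoff K s = measCutoff K r := by
  obtain ⟨ε, hε, hb⟩ := Metric.isOpen_iff.1 hK.isClosed.isOpen_compl r hr
  filter_upwards [ball_mem_nhds r hε] with s hs
  have : K ∩ Iio s = K ∩ Iio r := by
    ext t
    simp only [mem_inter_iff, mem_Iio, and_congr_right_iff]
    intro ht
    have h1 : ¬ dist t r < ε := fun h => hb h ht
    rw [mem_ball, Real.dist_eq, abs_lt] at hs
    rw [Real.dist_eq, abs_lt, not_and_or] at h1
    constructor
    · intro h; by_contra! h2
      rcases h1 with h1 | h1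
      · linarith
      · linarith [hs.2]
    · intro h; by_contra! h2
      rcases h1 with h1 | h1
      · linarith [hs.1]
      · linarith
  simp [measCutoff, this]

variable {d : ℕ}

theorem gradient_measCutoff_eq_zero {K : Set ℝ} (hK : IsCompact K) {x : Eu d} (hx : ‖x‖ ∉ K) :
    gradient (fun x : Eu d => measCutoff K ‖x‖) x = 0 := by
  have h1 : (fun x : Eu d => measCutoff K ‖x‖) =ᶠ[𝓝 x] fun _ => measCutoff K ‖x‖ :=
    (continuous_norm.tendsto x).eventually (measCutoff_eventually hK hx)
  have h2 := h1.fderiv_eq (𝕜 := ℝ)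
  rw [← norm_eq_zero, norm_gradient, h2]
  simp

theorem exists_shell_cutoff (hd : 1 ≤ d) {q m : ℝ} (hq : 1 < q) (hm : 1 ≤ m) (hmq' : m ≤ q)
    (hmq : 1 / m = min (1 / q + 1 / d) 1) :
    ∃ C : ℝ≥0, ∀ ρ σ R : ℝ, 1 / 2 ≤ ρ → ρ < σ → σ ≤ 1 → σ < R → ∀ (w : Eu (d + 1) → ℝ)
      (dw : Eu (d + 1) → Eu (d + 1)), IsWeakGradOn (d + 1) (ball 0 R) w dw →
      IntegrableOn w (ball 0 R) → IntegrableOn dw (ball 0 R) →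
      ∫⁻ x in ball (0 : Eu (d + 1)) R, ‖w x‖ₑ ^ m ≠ ∞ →
      ∫⁻ x in ball (0 : Eu (d + 1)) R, ‖dw x‖ₑ ^ m ≠ ∞ →
      ∃ η : Eu (d + 1) → ℝ, (∃ K, LipschitzWith K η) ∧ (∀ x, 0 ≤ η x ∧ η x ≤ 1) ∧
        (∀ x, ‖x‖ ≤ ρ → η x = 1) ∧ (∀ x, σ ≤ ‖x‖ → η x = 0) ∧
        ∫⁻ x, ‖gradient η x‖ₑ ^ q * ‖w x‖ₑ ^ q ≤ C * ENNReal.ofReal ((σ - ρ) ^ (-(q - 1 + q / m))) *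
          ((∫⁻ x in ball (0 : Eu (d + 1)) R, ‖w x‖ₑ ^ m) +
            ∫⁻ x in ball (0 : Eu (d + 1)) R, ‖dw x‖ₑ ^ m) ^ (q / m) := by
  obtain ⟨C, hC⟩ := exists_shell_energy hd hq hm hmq' hmq
  have hq0 : 0 < q := by linarith
  have hm0 : 0 < m := by linarith
  refine ⟨(2 ^ (q - 1) * 4 ^ (q / m) : ℝ).toNNReal * C ^ (q / m),
    fun ρ σ R hρ hρσ hσ hσR w dw h hw hdw hwf hdwf => ?_⟩
  obtain ⟨B, hBm, hB1, hB2⟩ := hC ρ σ R hρ hσ hσR w dw h hw hdw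
  set A := (∫⁻ x in ball (0 : Eu (d + 1)) R, ‖w x‖ₑ ^ m) +
            ∫⁻ x in ball (0 : Eu (d + 1)) R, ‖dw x‖ₑ ^ m
  have hA : A ≠ ∞ := ENNReal.add_ne_top.2 ⟨hwf, hdwf⟩
  have hs : 0 < σ - ρ := by linarith
  obtain ⟨K, hKs, hK, hKv, hKB⟩ := exists_isCompact_le_of_lintegral_le (hBm.pow_const (m / q)) hρσ
    (ENNReal.mul_ne_top ENNReal.coe_ne_top hA) hB2
  have hKv' : (σ - ρ) / 2 ≤ volume.real K := by
    rw [← ENNReal.ofReal_le_ofReal_iff measureReal_nonneg, ofReal_measureReal hK.measure_lt_top.ne]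
    exact hKv
  have hK0 : 0 < volume.real K := by linarith
  have hlip : LipschitzWith (volume.real K)⁻¹.toNNReal fun x : Eu (d + 1) => measCutoff K ‖x‖ := by
    refine LipschitzWith.of_dist_le_mul fun x y => ((measCutoff_lipschitz hK).dist_le_mul _ _).trans ?_
    gcongr
    rw [Real.dist_eq, dist_eq_norm]
    exact abs_norm_sub_norm_le x y
  refine ⟨fun x => measCutoff K ‖x‖, ⟨_, hlip⟩, fun x => measCutoff_mem hK _,
    fun x hx => measCutoff_eq_one fun s hs => hx.trans (hKs hs).1.le,
    fun x hx => measCutoff_eq_zero hK0.ne' fun s hs => (hKs hs).2.trans_le hx, ?_⟩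
  have hAm : MeasurableSet {x : Eu (d + 1) | ‖x‖ ∈ K} := measurable_norm hK.measurableSet
  have hpt : ∀ x, ‖gradient (fun x : Eu (d + 1) => measCutoff K ‖x‖) x‖ₑ ^ q * ‖w x‖ₑ ^ q ≤
      {x : Eu (d + 1) | ‖x‖ ∈ K}.indicator
        (fun x => ENNReal.ofReal ((volume.real K)⁻¹ ^ q) * ‖w x‖ₑ ^ q) x := by
    intro x
    by_cases hx : ‖x‖ ∈ K
    · rw [indicator_of_mem (s := {x : Eu (d + 1) | ‖x‖ ∈ K}) hx, ← ENNReal.ofReal_rpow_of_nonneg (by positivity) hq0.le, ← ofReal_norm]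
      gcongr
      have := hlip.norm_gradient_le x
      rwa [Real.coe_toNNReal _ (by positivity)] at this
    · rw [gradient_measCutoff_eq_zero hK hx, enorm_zero, ENNReal.zero_rpow_of_pos hq0, zero_mul]
      exact zero_le
  have hBK : ∀ r ∈ K, B r ≤ (ENNReal.ofReal (4 / (σ - ρ)) * (C * A)) ^ (q / m) := by
    intro r hr
    have h1 := ENNReal.rpow_le_rpow (hKB r hr) (by positivity : 0 ≤ q / m)
    rwa [← ENNReal.rpow_mul, show m / q * (q / m) = 1 by field_simp, ENNReal.rpow_one] at h1
  calc _ ≤ ∫⁻ x, {x : Eu (d + 1) | ‖x‖ ∈ K}.indicator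
        (fun x => ENNReal.ofReal ((volume.real K)⁻¹ ^ q) * ‖w x‖ₑ ^ q) x := lintegral_mono hpt
    _ = ENNReal.ofReal ((volume.real K)⁻¹ ^ q) * ∫⁻ x in {x : Eu (d + 1) | ‖x‖ ∈ K}, ‖w x‖ₑ ^ q := by
        rw [lintegral_indicator hAm, lintegral_const_mul' _ _ ENNReal.ofReal_ne_top]
    _ ≤ ENNReal.ofReal ((volume.real K)⁻¹ ^ q) * ∫⁻ r in K, B r :=
        mul_le_mul_right (hB1 K hK.measurableSet hKs) _
    _ ≤ ENNReal.ofReal ((volume.real K)⁻¹ ^ q) * ∫⁻ r in K,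
          (ENNReal.ofReal (4 / (σ - ρ)) * (C * A)) ^ (q / m) :=
        mul_le_mul_right (setLIntegral_mono' hK.measurableSet hBK) _
    _ = ENNReal.ofReal ((volume.real K)⁻¹ ^ q) * ((ENNReal.ofReal (4 / (σ - ρ)) * (C * A)) ^ (q / m) *
          ENNReal.ofReal (volume.real K)) := by
        rw [setLIntegral_const, ofReal_measureReal hK.measure_lt_top.ne]
    _ = ENNReal.ofReal (volume.real K ^ (1 - q) * (4 / (σ - ρ)) ^ (q / m)) * (C * A) ^ (q / m) := by
        rw [ENNReal.mul_rpow_of_nonneg _ _ (by positivity : 0 ≤ q / m),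
          ENNReal.ofReal_rpow_of_nonneg (by positivity) (by positivity),
          ENNReal.ofReal_mul (by positivity), Real.rpow_sub hK0, Real.rpow_one,
          Real.inv_rpow hK0.le, div_eq_mul_inv (volume.real K), ENNReal.ofReal_mul (by positivity)]
        ring
    _ ≤ ENNReal.ofReal ((2 ^ (q - 1) * 4 ^ (q / m)) * (σ - ρ) ^ (-(q - 1 + q / m))) *
          (C * A) ^ (q / m) := by
        refine mul_le_mul_left (ENNReal.ofReal_le_ofReal ?_) _
        calc volume.real K ^ (1 - q) * (4 / (σ - ρ)) ^ (q / m) ≤ ((σ - ρ) / 2) ^ (1 - q) * (4 / (σ - ρ)) ^ (q / m) := by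
              refine mul_le_mul_of_nonneg_right ?_ (by positivity)
              exact Real.rpow_le_rpow_of_nonpos (by positivity) hKv' (by linarith)
          _ = (2 ^ (q - 1) * 4 ^ (q / m)) * (σ - ρ) ^ (-(q - 1 + q / m)) := by
              have e1 : (σ - ρ) ^ (-(q - 1 + q / m)) = (σ - ρ) ^ (1 - q) / (σ - ρ) ^ (q / m) := by
                rw [← Real.rpow_sub hs]; ring_nf
              have e2 : (2 : ℝ) ^ (q - 1) = (2 ^ (1 - q))⁻¹ := by
                rw [← Real.rpow_neg (by norm_num)]; ring_nf
              rw [e1, e2, Real.div_rpow hs.le (by norm_num), Real.div_rpow (by norm_num) hs.le]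
              ring
    _ = _ := by
        rw [ENNReal.mul_rpow_of_nonneg _ _ (by positivity : 0 ≤ q / m), ENNReal.ofReal_mul (by positivity),
          ENNReal.coe_mul, ENNReal.coe_rpow_of_nonneg _ (by positivity)]
        simp only [ENNReal.ofReal]
        ring

end cutoff

section singleBall
open Filter
variable {n : ℕ}

theorem integral_comp_smul_add (h : Eu n → ℝ) {c : ℝ} (hc : 0 < c) (b : Eu n) :
    ∫ x, h (c • x + b) = (c ^ n)⁻¹ * ∫ x, h x := by
  have h1 := Measure.integral_comp_smul (volume : Measure (Eu n)) (fun y => h (y + b)) c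
  rw [integral_add_right_eq_self h b] at h1
  rw [h1, finrank_euclideanSpace_fin, abs_of_pos (by positivity), smul_eq_mul]

theorem preimage_smul_add_ball {r : ℝ} (hr : 0 < r) (x₀ : Eu n) (s : ℝ) :
    (fun y => r • y + x₀) ⁻¹' ball x₀ (r * s) = ball (0 : Eu n) s := by
  ext y
  rw [mem_preimage, mem_ball, dist_eq_norm, add_sub_cancel_right, norm_smul, Real.norm_eq_abs,
    abs_of_pos hr, mem_ball_zero_iff]
  exact mul_lt_mul_iff_right₀ hr

theorem setLIntegral_ball_comp_smul_add (h : Eu n → ℝ≥0∞) {r : ℝ} (hr : 0 < r) (x₀ : Eu n) (s : ℝ) :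
    ∫⁻ y in ball (0 : Eu n) s, h (r • y + x₀) =
      ENNReal.ofReal ((r ^ n)⁻¹) * ∫⁻ x in ball x₀ (r * s), h x := by
  rw [← lintegral_indicator measurableSet_ball, ← lintegral_indicator measurableSet_ball,
    ← lintegral_comp_smul_add _ hr x₀]
  refine lintegral_congr fun y => ?_
  rw [← preimage_smul_add_ball hr x₀ s]
  rfl

theorem integrableOn_ball_comp_smul_add {F : Type*} [NormedAddCommGroup F] [NormedSpace ℝ F]
    {h : Eu n → F} {r : ℝ} (hr : 0 < r) (x₀ : Eu n) (s : ℝ) (hh : IntegrableOn h (ball x₀ (r * s))) :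
    IntegrableOn (fun y => h (r • y + x₀)) (ball (0 : Eu n) s) := by
  rw [← integrable_indicator_iff measurableSet_ball] at hh ⊢
  have h1 := (hh.comp_add_right x₀).comp_smul hr.ne'
  refine h1.congr (Eventually.of_forall fun y => ?_)
  rw [← preimage_smul_add_ball hr x₀ s]
  rfl

theorem fderiv_comp_inv_smul_sub (φ : Eu n → ℝ) (c : ℝ) (x₀ z : Eu n) :
    fderiv ℝ (fun z => φ (c • (z - x₀))) z = c • fderiv ℝ φ (c • (z - x₀)) := by
  have h1 := fderiv_comp_add_right (𝕜 := ℝ) (f := fun z => φ (c • z)) (x := z) (-x₀)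
  have h2 := fderiv_comp_smul (𝕜 := ℝ) (f := φ) (x := z - x₀) c
  simp only [← sub_eq_add_neg] at h1
  rw [h1, h2]

theorem IsWeakGradOn.comp_smul_add {x₀ : Eu n} {r s : ℝ} (hr : 0 < r) {w : Eu n → ℝ}
    {dw : Eu n → Eu n} (h : IsWeakGradOn n (ball x₀ (r * s)) w dw) :
    IsWeakGradOn n (ball 0 s) (fun y => r⁻¹ * w (r • y + x₀)) (fun y => dw (r • y + x₀)) := by
  rw [isWeakGradOn_iff] at h ⊢
  intro φ hφ hφc hφs i
  set T : Eu n → Eu n := fun z => r⁻¹ • (z - x₀)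
  have hT : ContDiff ℝ (⊤ : ℕ∞) T := (contDiff_id.sub contDiff_const).const_smul _
  have hTe : ∀ y, T (r • y + x₀) = y := fun y => by simp [T, smul_smul, hr.ne']
  let e : Eu n ≃ₜ Eu n := ((Homeomorph.subRight x₀)).trans (Homeomorph.smulOfNeZero r⁻¹ (inv_ne_zero hr.ne'))
  have heT : ∀ z, e z = T z := fun z => rfl
  have hts : tsupport (fun z => φ (T z)) = T ⁻¹' tsupport φ := tsupport_comp_eq_preimage φ e
  have h1 := h (fun z => φ (T z)) (hφ.comp hT) (hφc.comp_homeomorph e) ?_ i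
  · have h2 := integral_comp_smul_add (fun z => w z * fderiv ℝ (fun z => φ (T z)) z
      (EuclideanSpace.single i (1 : ℝ))) hr x₀
    have h3 := integral_comp_smul_add (fun z => dw z i * φ (T z)) hr x₀
    rw [h1, mul_neg, ← h3] at h2
    simp only [hTe, T, fderiv_comp_inv_smul_sub] at h2 h3
    rw [← h2]
    refine integral_congr_ae (Eventually.of_forall fun y => ?_)
    simp only [FunLike.coe_smul, Pi.smul_apply, smul_eq_mul]
    ring
  · rw [hts]
    intro z hz
    have := hφs hz
    rw [mem_ball_zero_iff] at this
    simp only [T, norm_smul, norm_inv, Real.norm_eq_abs, abs_of_pos hr] at this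
    rw [mem_ball, dist_eq_norm]
    rwa [inv_mul_lt_iff₀ hr] at this

theorem volume_ball_eq {r : ℝ} (hr : 0 < r) (x₀ : Eu n) :
    volume (ball x₀ r) = ENNReal.ofReal (r ^ n) * volume (ball (0 : Eu n) 1) := by
  rw [Measure.addHaar_ball_of_pos _ _ hr, finrank_euclideanSpace_fin]

theorem volume_ball_le_two_mul_zeroSet {w : Eu n → ℝ} {B : Set (Eu n)}
    (hB : volume B ≠ ∞) (h : volume (B ∩ {x | w x ≠ 0}) ≤ volume B / 2) :
    volume B ≤ 2 * volume (B ∩ {x | w x = 0}) := by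
  have h1 : volume B ≤ volume (B ∩ {x | w x = 0}) + volume (B ∩ {x | w x ≠ 0}) := by
    refine le_trans (measure_mono fun x hx => ?_) (measure_union_le _ _)
    by_cases h0 : w x = 0
    · exact Or.inl ⟨hx, h0⟩
    · exact Or.inr ⟨hx, h0⟩
  have h2 : volume B / 2 + volume B / 2 ≤ volume (B ∩ {x | w x = 0}) + volume B / 2 := by
    rw [ENNReal.add_halves]
    exact h1.trans (add_le_add_right h _)
  have h3 := ENNReal.le_of_add_le_add_right (by finiteness) h2
  calc volume B = 2 * (volume B / 2) := (ENNReal.mul_div_cancel two_ne_zero ENNReal.ofNat_ne_top).symm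
    _ ≤ _ := by gcongr

theorem exists_ball_cutoff {d : ℕ} (hd : 1 ≤ d) {q m : ℝ} (hq : 1 < q) (hm : 1 ≤ m) (hmq' : m ≤ q)
    (hmq : 1 / m = min (1 / q + 1 / d) 1) {l : ℝ} (hl : 1 / 2 ≤ l) (hl1 : l < 1) :
    ∃ C : ℝ≥0, ∀ (x₀ : Eu (d + 1)) (r : ℝ), 0 < r → ∀ (w : Eu (d + 1) → ℝ)
      (dw : Eu (d + 1) → Eu (d + 1)), IsWeakGradOn (d + 1) (ball x₀ (r * 2)) w dw →
      IntegrableOn w (ball x₀ (r * 2)) → IntegrableOn dw (ball x₀ (r * 2)) →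
      volume (ball x₀ (r * (3 / 2))) ≤ 2 * volume (ball x₀ (r * (3 / 2)) ∩ {x | w x = 0}) →
      ∀ δ : ℝ≥0, ∫⁻ x in ball x₀ (r * 2), ‖dw x‖ₑ ^ m ≤ δ * volume (ball x₀ r) →
      ∃ ψ : Eu (d + 1) → ℝ, (∃ K, LipschitzWith K ψ) ∧ (∀ x, 0 ≤ ψ x ∧ ψ x ≤ 1) ∧
        (∀ x, dist x x₀ ≤ r * l → ψ x = 1) ∧ (∀ x, r ≤ dist x x₀ → ψ x = 0) ∧
        ∫⁻ x, ‖gradient ψ x‖ₑ ^ q * ‖w x‖ₑ ^ q ≤ C * (δ : ℝ≥0∞) ^ (q / m) * volume (ball x₀ r) := by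
  obtain ⟨C, hC⟩ := exists_shell_cutoff hd hq hm hmq' hmq
  have hq0 : 0 < q := by linarith
  have hm0 : 0 < m := by linarith
  set ω := volume (ball (0 : Eu (d + 1)) 1)
  have hω : ω ≠ ∞ := measure_ball_lt_top.ne
  set K : ℝ≥0∞ := C * ENNReal.ofReal ((1 - l) ^ (-(q - 1 + q / m))) *
    ((2 ^ (d + 1 + 1) * 3 ^ m + 1) * ω) ^ (q / m)
  have hK : K ≠ ∞ := by simp only [K]; finiteness
  have hω0 : ω ≠ 0 := (measure_ball_pos volume _ one_pos).ne'
  refine ⟨(K / ω).toNNReal, fun x₀ r hr w dw h hw hdw hZ δ hδ => ?_⟩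
  have hpz := h.poincare_zero hw hdw hm (by linarith : r * (3 / 2) < r * 2) (by positivity) hZ
  have hrn : ENNReal.ofReal ((r ^ (d + 1))⁻¹) * ENNReal.ofReal (r ^ (d + 1)) = 1 := by
    rw [← ENNReal.ofReal_mul (by positivity), inv_mul_cancel₀ (by positivity), ENNReal.ofReal_one]
  rw [volume_ball_eq hr] at hδ ⊢
  have hE : ∫⁻ y in ball (0 : Eu (d + 1)) 2, ‖dw (r • y + x₀)‖ₑ ^ m ≤ δ * ω := by
    rw [setLIntegral_ball_comp_smul_add (fun x => ‖dw x‖ₑ ^ m) hr]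
    refine (mul_le_mul_right hδ _).trans (le_of_eq ?_)
    rw [mul_left_comm (δ : ℝ≥0∞), ← mul_assoc, hrn, one_mul]
  have hE2 : ∫⁻ y in ball (0 : Eu (d + 1)) (3 / 2), ‖dw (r • y + x₀)‖ₑ ^ m ≤ δ * ω :=
    (lintegral_mono_set (ball_subset_ball (by norm_num))).trans hE
  have hW : ∫⁻ y in ball (0 : Eu (d + 1)) (3 / 2), ‖r⁻¹ * w (r • y + x₀)‖ₑ ^ m ≤
      2 ^ (d + 1 + 1) * 3 ^ m * (δ * ω) := by
    have h1 : ∀ y, ‖r⁻¹ * w (r • y + x₀)‖ₑ ^ m =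
        ENNReal.ofReal (r⁻¹) ^ m * ‖w (r • y + x₀)‖ₑ ^ m := fun y => by
      rw [enorm_mul, ENNReal.mul_rpow_of_nonneg _ _ hm0.le, Real.enorm_of_nonneg (by positivity)]
    simp only [h1]
    rw [lintegral_const_mul' _ _ (by finiteness),
      setLIntegral_ball_comp_smul_add (fun x => ‖w x‖ₑ ^ m) hr]
    have h2 : ENNReal.ofReal (r⁻¹) ^ m * ENNReal.ofReal (2 * (r * (3 / 2))) ^ m = 3 ^ m := by
      rw [← ENNReal.mul_rpow_of_nonneg _ _ hm0.le, ← ENNReal.ofReal_mul (by positivity),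
        show r⁻¹ * (2 * (r * (3 / 2))) = 3 by field_simp, ENNReal.ofReal_ofNat]
    calc _ ≤ ENNReal.ofReal (r⁻¹) ^ m * (ENNReal.ofReal ((r ^ (d + 1))⁻¹) * (2 ^ (d + 1 + 1) *
          (ENNReal.ofReal (2 * (r * (3 / 2))) ^ m *
            (δ * (ENNReal.ofReal (r ^ (d + 1)) * ω))))) := by
          gcongr
          exact hpz.trans (by gcongr)
      _ = (ENNReal.ofReal (r⁻¹) ^ m * ENNReal.ofReal (2 * (r * (3 / 2))) ^ m) *
          (ENNReal.ofReal ((r ^ (d + 1))⁻¹) * ENNReal.ofReal (r ^ (d + 1))) *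
          (2 ^ (d + 1 + 1) * (δ * ω)) := by ring
      _ = _ := by rw [h2, hrn]; ring
  have hws := (h.comp_smul_add hr).mono (ball_subset_ball (by norm_num : (3 / 2 : ℝ) ≤ 2))
  obtain ⟨η, ⟨Kη, hηK⟩, hη01, hη1, hη0, hηE⟩ := hC l 1 (3 / 2) hl hl1 le_rfl (by norm_num) _ _ hws
    (IntegrableOn.mono_set ((integrableOn_ball_comp_smul_add hr x₀ 2 hw).const_mul _)
      (ball_subset_ball (by norm_num)))
    ((integrableOn_ball_comp_smul_add hr x₀ 2 hdw).mono_set (ball_subset_ball (by norm_num)))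
    (ne_top_of_le_ne_top (by finiteness) hW) (ne_top_of_le_ne_top (by finiteness) hE2)
  have hlipT : LipschitzWith (Real.toNNReal r⁻¹) fun x : Eu (d + 1) => r⁻¹ • (x - x₀) := by
    refine LipschitzWith.of_dist_le_mul fun x y => ?_
    rw [dist_eq_norm, dist_eq_norm, ← smul_sub, norm_smul, Real.norm_of_nonneg (by positivity),
      Real.coe_toNNReal _ (by positivity), sub_sub_sub_cancel_right]
  have hnT : ∀ x : Eu (d + 1), ‖r⁻¹ • (x - x₀)‖ = r⁻¹ * dist x x₀ := fun x => by
    rw [norm_smul, Real.norm_of_nonneg (by positivity), dist_eq_norm]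
  refine ⟨fun x => η (r⁻¹ • (x - x₀)), ⟨_, hηK.comp hlipT⟩, fun x => hη01 _, fun x hx => hη1 _ ?_,
    fun x hx => hη0 _ ?_, ?_⟩
  · rw [hnT, inv_mul_le_iff₀ hr]; exact hx
  · rw [hnT, le_inv_mul_iff₀ hr, mul_one]; exact hx
  · set H : Eu (d + 1) → ℝ≥0∞ := fun x =>
      ‖gradient (fun x => η (r⁻¹ • (x - x₀))) x‖ₑ ^ q * ‖w x‖ₑ ^ q
    have h1 := lintegral_comp_smul_add H hr x₀
    have h2 : ∀ y, H (r • y + x₀) = ‖gradient η y‖ₑ ^ q * ‖r⁻¹ * w (r • y + x₀)‖ₑ ^ q := by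
      intro y
      simp only [H]
      rw [← ENNReal.mul_rpow_of_nonneg _ _ hq0.le, ← ENNReal.mul_rpow_of_nonneg _ _ hq0.le,
        enorm_mul, ← mul_assoc]
      congr 2
      rw [← ofReal_norm, ← ofReal_norm, ← ofReal_norm, norm_gradient, norm_gradient,
        fderiv_comp_inv_smul_sub, add_sub_cancel_right, smul_smul, inv_mul_cancel₀ hr.ne', one_smul,
        norm_smul, ENNReal.ofReal_mul (norm_nonneg _), mul_comm]
    simp only [h2] at h1
    have h3 : ∫⁻ x, H x = ENNReal.ofReal (r ^ (d + 1)) *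
        ∫⁻ y, ‖gradient η y‖ₑ ^ q * ‖r⁻¹ * w (r • y + x₀)‖ₑ ^ q := by
      rw [h1, ← mul_assoc, mul_comm (ENNReal.ofReal (r ^ (d + 1))), hrn, one_mul]
    rw [h3, ENNReal.coe_toNNReal (ENNReal.div_ne_top hK hω0)]
    refine (mul_le_mul_right (hηE.trans (mul_le_mul_right (ENNReal.rpow_le_rpow
      (add_le_add hW hE2) (by positivity)) _)) _).trans (le_of_eq ?_)
    rw [show 2 ^ (d + 1 + 1) * 3 ^ m * (δ * ω) + δ * ω =
      ((2 ^ (d + 1 + 1) * 3 ^ m + 1) * ω) * (δ : ℝ≥0∞) by ring,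
      ENNReal.mul_rpow_of_nonneg _ _ (by positivity : 0 ≤ q / m)]
    calc _ = K * (δ : ℝ≥0∞) ^ (q / m) * ENNReal.ofReal (r ^ (d + 1)) := by simp only [K]; ring
      _ = (K / ω * ω) * (δ : ℝ≥0∞) ^ (q / m) * ENNReal.ofReal (r ^ (d + 1)) := by
          rw [ENNReal.div_mul_cancel hω0 hω]
      _ = _ := by ring

end singleBall

section holes
open Filter
variable {n : ℕ} {ι : Type*}

theorem LipschitzWith.exists_finset_sum {ψ : ι → Eu n → ℝ} (h : ∀ i, ∃ K, LipschitzWith K (ψ i))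
    (F : Finset ι) : ∃ K, LipschitzWith K fun x => ∑ i ∈ F, ψ i x := by
  classical
  induction F using Finset.induction_on with
  | empty => exact ⟨0, by simp only [Finset.sum_empty]; exact LipschitzWith.const 0⟩
  | insert i s hi ih =>
    obtain ⟨K₁, h₁⟩ := h i
    obtain ⟨K₂, h₂⟩ := ih
    simp only [Finset.sum_insert hi]
    exact ⟨_, h₁.add h₂⟩

theorem sum_eq_of_mem {ψ : ι → Eu n → ℝ} {B : ι → Set (Eu n)} (hB : Pairwise (Function.onFun Disjoint B))
    (h0 : ∀ i, ∀ x ∉ B i, ψ i x = 0) {F : Finset ι} {i : ι} (hi : i ∈ F) {x : Eu n} (hx : x ∈ B i) :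
    ∑ j ∈ F, ψ j x = ψ i x :=
  Finset.sum_eq_single i (fun j _ hj => h0 j x fun h => (disjoint_left.1 (hB hj) h hx).elim)
    fun h => (h hi).elim

theorem enorm_gradient_sum_rpow_le {ψ : ι → Eu n → ℝ} {B : ι → Set (Eu n)}
    (hBc : ∀ i, IsClosed (B i)) (hB : Pairwise (Function.onFun Disjoint B))
    (h0 : ∀ i, ∀ x ∉ B i, ψ i x = 0) (F : Finset ι) {q : ℝ} (hq : 0 < q) (x : Eu n) :
    ‖gradient (fun x => ∑ j ∈ F, ψ j x) x‖ₑ ^ q ≤ ∑ j ∈ F, ‖gradient (ψ j) x‖ₑ ^ q := by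
  classical
  by_cases hx : ∃ i ∈ F, x ∈ B i
  · obtain ⟨i, hi, hxi⟩ := hx
    have hO : IsOpen (⋃ j ∈ F.erase i, B j)ᶜ :=
      (isClosed_biUnion_finset fun j _ => hBc j).isOpen_compl
    have hxO : x ∈ (⋃ j ∈ F.erase i, B j)ᶜ := by
      simp only [mem_compl_iff, mem_iUnion, not_exists]
      exact fun j hj hxj => (disjoint_left.1 (hB (Finset.ne_of_mem_erase hj)) hxj hxi).elim
    have h1 : (fun x => ∑ j ∈ F, ψ j x) =ᶠ[𝓝 x] ψ i := by
      filter_upwards [hO.mem_nhds hxO] with y hy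
      simp only [mem_compl_iff, mem_iUnion, not_exists] at hy
      exact Finset.sum_eq_single i (fun j hj hji => h0 j y (hy j (Finset.mem_erase.2 ⟨hji, hj⟩)))
        fun h => (h hi).elim
    have h2 : gradient (fun x => ∑ j ∈ F, ψ j x) x = gradient (ψ i) x := by
      simp only [gradient, h1.fderiv_eq]
    rw [h2]
    exact Finset.single_le_sum (f := fun j => ‖gradient (ψ j) x‖ₑ ^ q) (fun _ _ => zero_le) hi
  · push Not at hx
    have hO : IsOpen (⋃ j ∈ F, B j)ᶜ := (isClosed_biUnion_finset fun j _ => hBc j).isOpen_compl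
    have hxO : x ∈ (⋃ j ∈ F, B j)ᶜ := by
      simp only [mem_compl_iff, mem_iUnion, not_exists]
      exact hx
    have h1 : (fun x => ∑ j ∈ F, ψ j x) =ᶠ[𝓝 x] fun _ => 0 := by
      filter_upwards [hO.mem_nhds hxO] with y hy
      simp only [mem_compl_iff, mem_iUnion, not_exists] at hy
      exact Finset.sum_eq_zero fun j hj => h0 j y (hy j hj)
    have h2 : gradient (fun x => ∑ j ∈ F, ψ j x) x = 0 := by
      rw [← norm_eq_zero, norm_gradient, h1.fderiv_eq]; simp
    rw [h2, enorm_zero, ENNReal.zero_rpow_of_pos hq]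
    exact zero_le

theorem volume_closedBall_diff_ball_le {x : Eu n} {r l : ℝ} (hr : 0 < r) (hl : 0 < l) (hl1 : l < 1) :
    volume (closedBall x r \ ball x (r * l)) ≤ ENNReal.ofReal (1 - l ^ n) * volume (closedBall x r) := by
  rcases Nat.eq_zero_or_pos n with rfl | hn
  · have : closedBall x r \ ball x (r * l) = ∅ := by
      refine eq_empty_of_forall_notMem fun y hy => hy.2 ?_
      rw [Subsingleton.elim y x]; exact mem_ball_self (by positivity)
    rw [this, measure_empty]; exact zero_le
  have : Nonempty (Fin n) := ⟨⟨0, hn⟩⟩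
  have hsub : ball x (r * l) ⊆ closedBall x r :=
    (ball_subset_ball (by nlinarith)).trans ball_subset_closedBall
  rw [measure_sdiff hsub measurableSet_ball.nullMeasurableSet measure_ball_lt_top.ne,
    Measure.addHaar_closedBall_eq_addHaar_ball, volume_ball_eq (by positivity : 0 < r * l),
    volume_ball_eq hr, ← mul_assoc, ← ENNReal.ofReal_mul (by
      rw [sub_nonneg]; exact pow_le_one₀ hl.le hl1.le),
    ← ENNReal.sub_mul (fun _ _ => measure_ball_lt_top.ne), ← ENNReal.ofReal_sub _ (by positivity),
    mul_pow]
  exact le_of_eq (by ring_nf)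

theorem exists_ball_ratio (n : ℕ) {ε : ℝ≥0∞} (hε : ε ≠ 0) {V : ℝ≥0∞} (hV : V ≠ ∞) :
    ∃ l : ℝ, 1 / 2 ≤ l ∧ l < 1 ∧ ENNReal.ofReal (1 - l ^ n) * V ≤ ε := by
  have h1 : Tendsto (fun l : ℝ => ENNReal.ofReal (1 - l ^ n) * V) (𝓝[<] 1) (𝓝 0) := by
    have h2 : Tendsto (fun l : ℝ => ENNReal.ofReal (1 - l ^ n)) (𝓝[<] 1) (𝓝 (ENNReal.ofReal (1 - 1 ^ n))) :=
      (ENNReal.continuous_ofReal.comp (by fun_prop : Continuous fun l : ℝ => 1 - l ^ n)).tendsto 1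
        |>.mono_left nhdsWithin_le_nhds
    have h3 := ENNReal.Tendsto.mul_const h2 (b := V) (Or.inr hV)
    simpa using h3
  have h2 : ∀ᶠ l : ℝ in 𝓝[<] 1, 1 / 2 ≤ l :=
    (eventually_ge_nhds (by norm_num : (1 / 2 : ℝ) < 1)).filter_mono nhdsWithin_le_nhds
  obtain ⟨l, h3, h4⟩ := (((h1.eventually_le_const (pos_iff_ne_zero.2 hε)).and h2).and
    self_mem_nhdsWithin).exists
  exact ⟨l, h3.2, h4, h3.1⟩

theorem exists_small_rpow_bound (C V ε : ℝ≥0) (hε : 0 < ε) {a : ℝ} (ha : 0 < a) :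
    ∃ δ : ℝ≥0, 0 < δ ∧ δ ≤ 1 / 2 ∧ δ * V ≤ ε ∧ C * δ ^ a * V ≤ ε := by
  have h1 : ∀ᶠ δ : ℝ≥0 in 𝓝 0, δ ≤ 1 / 2 := eventually_le_nhds (by norm_num)
  have h2 : ∀ᶠ δ : ℝ≥0 in 𝓝 0, δ * V ≤ ε := by
    have : Tendsto (fun δ : ℝ≥0 => δ * V) (𝓝 0) (𝓝 (0 * V)) := tendsto_id.mul_const V
    rw [zero_mul] at this
    exact this.eventually_le_const hε
  have h3 : ∀ᶠ δ : ℝ≥0 in 𝓝 0, C * δ ^ a * V ≤ ε := by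
    have : Tendsto (fun δ : ℝ≥0 => C * δ ^ a * V) (𝓝 0) (𝓝 (C * 0 ^ a * V)) :=
      ((NNReal.continuousAt_rpow_const (Or.inr ha.le)).tendsto.const_mul C).mul_const V
    rw [NNReal.zero_rpow ha.ne', mul_zero, zero_mul] at this
    exact this.eventually_le_const hε
  have h4 : ∀ᶠ δ : ℝ≥0 in 𝓝[>] 0, 0 < δ := self_mem_nhdsWithin
  obtain ⟨δ, hδ, hδ1, hδ2, hδ3⟩ := (h4.and ((h1.and (h2.and h3)).filter_mono nhdsWithin_le_nhds)).exists
  exact ⟨δ, hδ, hδ1, hδ2, hδ3⟩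

theorem exists_forall_lintegral_ball_le {f : Eu n → ℝ≥0∞} {x : Eu n} {δ : ℝ≥0∞} (hδ : δ ≠ 0)
    (h : Tendsto (fun r => (∫⁻ y in closedBall x r, f y) / volume (closedBall x r)) (𝓝[>] 0) (𝓝 0)) :
    ∃ R > 0, ∀ r, 0 < r → r < R → ∫⁻ y in ball x (r * 2), f y ≤ δ * volume (ball x r) := by
  have hδ' : 0 < δ / 2 ^ n := ENNReal.div_pos hδ (by finiteness)
  obtain ⟨R, hR, hRs⟩ := mem_nhdsGT_iff_exists_Ioo_subset.1 (h.eventually_le_const hδ')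
  have hR0 : 0 < R := hR
  refine ⟨R / 2, by positivity, fun r hr hrR => ?_⟩
  have h1 := hRs ⟨by positivity, by linarith⟩ (a := r * 2)
  simp only [mem_ofPred_eq] at h1
  have hv : volume (ball x (r * 2)) = 2 ^ n * volume (ball x r) := by
    rw [volume_ball_eq (by positivity : 0 < r * 2), volume_ball_eq hr, mul_pow,
      ENNReal.ofReal_mul (by positivity), ENNReal.ofReal_pow (by norm_num : (0:ℝ) ≤ 2), ENNReal.ofReal_ofNat]
    ring
  rw [ENNReal.div_le_iff (measure_closedBall_pos _ _ (by positivity)).ne' measure_closedBall_lt_top.ne] at h1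
  refine (lintegral_mono_set ball_subset_closedBall).trans (h1.trans ?_)
  rcases Nat.eq_zero_or_pos n with rfl | hn
  · have : closedBall x (r * 2) = ball x r := by
      ext y; rw [Subsingleton.elim y x]; simp [hr]
    rw [this]; simp
  have : Nonempty (Fin n) := ⟨⟨0, hn⟩⟩
  rw [Measure.addHaar_closedBall_eq_addHaar_ball, hv, ← mul_assoc,
    ENNReal.div_mul_cancel (by simp) (by finiteness)]

end holes

section holes
open Filter
variable {n d : ℕ}

theorem exists_disjoint_closedBalls {S B : Set (Eu n)} (hB : volume B ≠ ∞)
    {P : Eu n → ℝ → Prop}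
    (hP : ∀ᵐ x, x ∈ S → ∃ R > 0, ∀ r, 0 < r → r < R → P x r)
    (hPB : ∀ x r, P x r → closedBall x r ⊆ B) {ε : ℝ≥0∞} (hε : ε ≠ 0) :
    ∃ (t : Set (Eu n)) (r : Eu n → ℝ) (F : Finset t),
      (∀ i : t, 0 < r i ∧ P i (r i)) ∧
      Pairwise (Function.onFun Disjoint fun i : t => closedBall (i : Eu n) (r i)) ∧
      volume (S \ ⋃ i ∈ F, closedBall (i : Eu n) (r i)) ≤ ε ∧
      ∑ i ∈ F, volume (closedBall (i : Eu n) (r i)) ≤ volume B := by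
  classical
  set S' : Set (Eu n) := S ∩ {x | ∃ R > 0, ∀ r, 0 < r → r < R → P x r} with hS'
  have hSS' : volume (S \ S') = 0 := by
    refine measure_mono_null ?_ (ae_iff.1 hP)
    intro x hx
    exact fun h => hx.2 ⟨hx.1, h hx.1⟩
  have hR : ∀ x, ∃ R > 0, x ∈ S' → ∀ r, 0 < r → r < R → P x r := by
    intro x
    by_cases hx : x ∈ S'
    · obtain ⟨R, hR, h⟩ := hx.2
      exact ⟨R, hR, fun _ => h⟩
    · exact ⟨1, one_pos, fun h => (hx h).elim⟩
  choose R hR0 hRP using hR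
  obtain ⟨t, r, htc, hts, hr, hcov, hdis⟩ :=
    Besicovitch.exists_disjoint_closedBall_covering_ae (volume : Measure (Eu n))
    (fun _ => univ) S' (fun x _ δ hδ => by simpa using hδ) R (fun x _ => hR0 x)
  have hgood : ∀ i : t, 0 < r i ∧ P i (r i) := fun i =>
    ⟨(hr i i.2).2.1, hRP i (hts i.2) _ (hr i i.2).2.1 (hr i i.2).2.2⟩
  have hpw : Pairwise (Function.onFun Disjoint fun i : t => closedBall (i : Eu n) (r i)) :=
    fun i j hij => hdis i.2 j.2 fun h => hij (Subtype.ext h)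
  have : Countable t := htc.to_subtype
  have hsum : ∑' i : t, volume (closedBall (i : Eu n) (r i)) ≤ volume B := by
    rw [← measure_iUnion hpw fun i => measurableSet_closedBall]
    exact measure_mono (iUnion_subset fun i => hPB _ _ (hgood i).2)
  obtain ⟨F, hF⟩ := ((ENNReal.tendsto_tsum_compl_atTop_zero
    (ne_top_of_le_ne_top hB hsum)).eventually_le_const (pos_iff_ne_zero.2 hε)).exists
  refine ⟨t, r, F, hgood, hpw, ?_, (ENNReal.sum_le_tsum F).trans hsum⟩
  have hsub : S \ ⋃ i ∈ F, closedBall (i : Eu n) (r i) ⊆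
      (S \ S') ∪ (S' \ ⋃ x ∈ t, closedBall x (r x)) ∪
        ⋃ i : {i // i ∉ F}, closedBall ((i : t) : Eu n) (r i) := by
    intro x hx
    by_cases h1 : x ∈ S'
    · by_cases h2 : x ∈ ⋃ x ∈ t, closedBall x (r x)
      · right
        obtain ⟨y, hy, hxy⟩ := mem_iUnion₂.1 h2
        refine mem_iUnion.2 ⟨⟨⟨y, hy⟩, fun hyF => hx.2 (mem_iUnion₂.2 ⟨⟨y, hy⟩, hyF, hxy⟩)⟩, hxy⟩
      · exact Or.inl (Or.inr ⟨h1, h2⟩)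
    · exact Or.inl (Or.inl ⟨hx.1, h1⟩)
  calc _ ≤ _ := measure_mono hsub
    _ ≤ volume (S \ S') + volume (S' \ ⋃ x ∈ t, closedBall x (r x)) +
        ∑' i : {i // i ∉ F}, volume (closedBall ((i : t) : Eu n) (r i)) :=
      (measure_union_le _ _).trans (add_le_add (measure_union_le _ _) (measure_iUnion_le _))
    _ ≤ ε := by rw [hSS', hcov, zero_add, zero_add]; exact hF

theorem gradient_eq_zero_of_forall_notMem {ψ : Eu n → ℝ} {K : Set (Eu n)} (hK : IsClosed K)
    (h : ∀ x ∉ K, ψ x = 0) {x : Eu n} (hx : x ∉ K) : gradient ψ x = 0 := by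
  have h1 : ψ =ᶠ[𝓝 x] fun _ => 0 := by
    filter_upwards [hK.isOpen_compl.mem_nhds hx] with y hy using h y hy
  rw [← norm_eq_zero, norm_gradient, h1.fderiv_eq]; simp

theorem exists_hole_cutoff (hd : 1 ≤ d) {q m : ℝ} (hq : 1 < q) (hm : 1 ≤ m) (hmq' : m ≤ q)
    (hmq : 1 / m = min (1 / q + 1 / d) 1) {w : Eu (d + 1) → ℝ} {dw : Eu (d + 1) → Eu (d + 1)}
    (h : IsWeakGradOn (d + 1) (ball 0 1) w dw) (hw : IntegrableOn w (ball 0 1))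
    (hdw : IntegrableOn dw (ball 0 1)) (hfin : ∫⁻ x in ball 0 1, ‖dw x‖ₑ ^ m ≠ ∞)
    (h0 : ∀ x, w x = 0 → dw x = 0) {ε : ℝ≥0} (hε : 0 < ε) :
    ∃ (ψ : Eu (d + 1) → ℝ) (U : Set (Eu (d + 1))), IsOpen U ∧ (∃ K, LipschitzWith K ψ) ∧
      (∀ x, 0 ≤ ψ x ∧ ψ x ≤ 1) ∧ (∀ x ∈ U, ψ x = 1) ∧
      volume ((ball 0 1 ∩ {x | w x = 0}) \ U) ≤ ε ∧
      volume (ball 0 1 ∩ {x | w x ≠ 0 ∧ ψ x ≠ 0}) ≤ ε ∧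
      ∫⁻ x, ‖gradient ψ x‖ₑ ^ q * ‖w x‖ₑ ^ q ≤ ε := by
  classical
  have hm0 : 0 < m := by linarith
  have hq0 : 0 < q := by linarith
  set B : Set (Eu (d + 1)) := ball 0 1 with hB
  have hBfin : volume B ≠ ∞ := measure_ball_lt_top.ne
  lift volume B to ℝ≥0 using hBfin with V hV
  obtain ⟨l, hl, hl1, hlV⟩ := exists_ball_ratio (d + 1)
    (show ((ε / 2 : ℝ≥0) : ℝ≥0∞) ≠ 0 by simpa using hε.ne') (V := V) (by simp)
  obtain ⟨C, hC⟩ := exists_ball_cutoff hd hq hm hmq' hmq hl hl1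
  obtain ⟨δ, hδ0, hδ1, hδV, hδC⟩ := exists_small_rpow_bound C V ε hε (show 0 < q / m by positivity)
  set f : Eu (d + 1) → ℝ≥0∞ :=
    B.indicator fun x => ‖dw x‖ₑ ^ m + {x | w x ≠ 0}.indicator 1 x with hf
  have hind : AEMeasurable ({x | w x ≠ 0}.indicator (1 : Eu (d + 1) → ℝ≥0∞)) (volume.restrict B) := by
    have : ({x | w x ≠ 0}.indicator (1 : Eu (d + 1) → ℝ≥0∞)) =
        (({0}ᶜ : Set ℝ).indicator (1 : ℝ → ℝ≥0∞)) ∘ w := by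
      ext x; simp [indicator]
    rw [this]
    exact (measurable_one.indicator (measurableSet_singleton (0:ℝ)).compl).comp_aemeasurable
      hw.aestronglyMeasurable.aemeasurable
  have hfm : AEMeasurable f := by
    rw [hf, aemeasurable_indicator_iff measurableSet_ball]
    exact (hdw.aestronglyMeasurable.enorm.pow_const m).add hind
  have hffin : ∫⁻ x, f x ≠ ∞ := by
    rw [hf, lintegral_indicator measurableSet_ball,
      lintegral_add_right' _ hind]
    refine ENNReal.add_ne_top.2 ⟨hfin, ne_top_of_le_ne_top ?_
      ((lintegral_indicator_one_le _).trans (measure_mono (subset_univ _)))⟩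
    rw [Measure.restrict_apply_univ]
    exact measure_ball_lt_top.ne
  have hder := (Besicovitch.vitaliFamily (volume : Measure (Eu (d + 1)))).ae_tendsto_lintegral_div
    hfm hffin
  have hP : ∀ᵐ x : Eu (d + 1), x ∈ B ∩ {x | w x = 0} → ∃ R > 0, ∀ r, 0 < r → r < R →
      ball x (r * 2) ⊆ B ∧ ∫⁻ y in ball x (r * 2), f y ≤ δ * volume (ball x r) := by
    filter_upwards [hder] with x hx hxS
    have hfx : f x = 0 := by
      have := hxS.2
      rw [mem_ofPred_eq] at this
      rw [hf, indicator_of_mem hxS.1, h0 x this]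
      simp [this, hm0]
    rw [hfx] at hx
    obtain ⟨R, hR, hRx⟩ := exists_forall_lintegral_ball_le (δ := δ) (by simpa using hδ0.ne')
      (hx.comp (Besicovitch.tendsto_filterAt volume x))
    have hx1 : dist x 0 < 1 := hxS.1
    refine ⟨min R ((1 - dist x 0) / 2), lt_min hR (by linarith), fun r hr hrR => ?_⟩
    have h1 := hrR.trans_le (min_le_left _ _)
    have h2 := hrR.trans_le (min_le_right _ _)
    exact ⟨ball_subset_ball' (by linarith), hRx r hr h1⟩
  have hcb : ∀ (x : Eu (d + 1)) (r : ℝ), 0 < r → closedBall x r ⊆ ball x (r * 2) := fun x r hr =>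
    closedBall_subset_ball (by linarith)
  obtain ⟨t, r, F, hgood, hdis, hcov, hsum⟩ := exists_disjoint_closedBalls (S := B ∩ {x | w x = 0})
    (B := B) measure_ball_lt_top.ne (P := fun x r => 0 < r ∧ ball x (r * 2) ⊆ B ∧
      ∫⁻ y in ball x (r * 2), f y ≤ δ * volume (ball x r))
    (by
      filter_upwards [hP] with x hx hxS
      obtain ⟨R, hR, hRx⟩ := hx hxS
      exact ⟨R, hR, fun r hr hrR => ⟨hr, hRx r hr hrR⟩⟩)
    (fun x r hx => (hcb x r hx.1).trans hx.2.1)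
    (ε := ((ε / 2 : ℝ≥0) : ℝ≥0∞)) (by simpa using hε.ne')
  have hfB : ∀ i : t, ∫⁻ y in ball (i : Eu (d + 1)) (r i * 2), f y =
      ∫⁻ y in ball (i : Eu (d + 1)) (r i * 2), (‖dw y‖ₑ ^ m + {x | w x ≠ 0}.indicator 1 y) := by
    intro i
    refine setLIntegral_congr_fun measurableSet_ball fun y hy => ?_
    rw [hf, indicator_of_mem ((hgood i).2.2.1 hy)]
  have hwi : ∀ i : t, volume (ball (i : Eu (d + 1)) (r i * 2) ∩ {x | w x ≠ 0}) ≤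
      δ * volume (ball (i : Eu (d + 1)) (r i)) := by
    intro i
    refine le_trans ?_ (hgood i).2.2.2
    have h1 := mul_meas_ge_le_lintegral₀ (hfm.mono_measure
      (Measure.restrict_le_self (s := ball (i : Eu (d + 1)) (r i * 2)))) 1
    rw [one_mul] at h1
    refine le_trans ?_ h1
    refine le_trans (measure_mono ?_) (Measure.le_restrict_apply _ _)
    rintro x ⟨hx, hxw⟩
    refine ⟨?_, hx⟩
    rw [mem_ofPred_eq, hf, indicator_of_mem ((hgood i).2.2.1 hx), indicator_of_mem hxw]
    exact le_add_self
  have hcut : ∀ i : t, ∃ ψ : Eu (d + 1) → ℝ, (∃ K, LipschitzWith K ψ) ∧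
      (∀ x, 0 ≤ ψ x ∧ ψ x ≤ 1) ∧ (∀ x, dist x (i : Eu (d + 1)) ≤ r i * l → ψ x = 1) ∧
      (∀ x, r i ≤ dist x (i : Eu (d + 1)) → ψ x = 0) ∧
      ∫⁻ x, ‖gradient ψ x‖ₑ ^ q * ‖w x‖ₑ ^ q ≤
        C * (δ : ℝ≥0∞) ^ (q / m) * volume (ball (i : Eu (d + 1)) (r i)) := by
    intro i
    obtain ⟨hr, -, hsub, h_int⟩ := hgood i
    refine hC i (r i) hr w dw (h.mono hsub) (hw.mono_set hsub) (hdw.mono_set hsub)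
      (volume_ball_le_two_mul_zeroSet measure_ball_lt_top.ne ?_) δ ?_
    · calc volume (ball (i : Eu (d + 1)) (r i * (3 / 2)) ∩ {x | w x ≠ 0})
          ≤ volume (ball (i : Eu (d + 1)) (r i * 2) ∩ {x | w x ≠ 0}) :=
            measure_mono (inter_subset_inter_left _ (ball_subset_ball (by linarith)))
        _ ≤ δ * volume (ball (i : Eu (d + 1)) (r i)) := hwi i
        _ ≤ 2⁻¹ * volume (ball (i : Eu (d + 1)) (r i * (3 / 2))) := by
            refine mul_le_mul' ?_ (measure_mono (ball_subset_ball (by linarith)))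
            rw [show (2⁻¹ : ℝ≥0∞) = ((1 / 2 : ℝ≥0) : ℝ≥0∞) by simp]
            exact_mod_cast hδ1
        _ = _ := by rw [mul_comm, ENNReal.div_eq_inv_mul, mul_comm]
    · refine le_trans ?_ h_int
      rw [hfB]
      exact lintegral_mono fun _ => le_self_add
  choose ψ hψL hψ01 hψ1 hψ0 hψI using hcut
  have hψ0' : ∀ i : t, ∀ x ∉ closedBall (i : Eu (d + 1)) (r i), ψ i x = 0 := fun i x hx =>
    hψ0 i x (by rw [mem_closedBall, not_le] at hx; exact hx.le)
  have hΨ : ∀ x, (∃ i ∈ F, x ∈ closedBall (i : Eu (d + 1)) (r i) ∧ ∑ j ∈ F, ψ j x = ψ i x) ∨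
      ∑ j ∈ F, ψ j x = 0 := by
    intro x
    by_cases hx : ∃ i ∈ F, x ∈ closedBall (i : Eu (d + 1)) (r i)
    · obtain ⟨i, hi, hxi⟩ := hx
      exact Or.inl ⟨i, hi, hxi, sum_eq_of_mem hdis hψ0' hi hxi⟩
    · push Not at hx
      exact Or.inr (Finset.sum_eq_zero fun j hj => hψ0' j x (hx j hj))
  have hsumV : ∑ i ∈ F, volume (ball (i : Eu (d + 1)) (r i)) ≤ V :=
    (Finset.sum_le_sum fun i _ => measure_mono ball_subset_closedBall).trans (hsum.trans hV.ge)
  refine ⟨fun x => ∑ i ∈ F, ψ i x, ⋃ i ∈ F, ball (i : Eu (d + 1)) (r i * l),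
    isOpen_biUnion fun i _ => isOpen_ball, LipschitzWith.exists_finset_sum hψL F, ?_, ?_, ?_, ?_, ?_⟩
  · intro x
    rcases hΨ x with ⟨i, -, -, hi⟩ | hx
    · simp only [hi]; exact hψ01 i x
    · simp [hx]
  · intro x hx
    obtain ⟨i, hi, hxi⟩ := mem_iUnion₂.1 hx
    have hri := (hgood i).1
    have : x ∈ closedBall (i : Eu (d + 1)) (r i) := by
      rw [mem_closedBall]; rw [mem_ball] at hxi; nlinarith
    exact (sum_eq_of_mem hdis hψ0' hi this).trans (hψ1 i x (le_of_lt hxi))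
  · calc volume ((B ∩ {x | w x = 0}) \ ⋃ i ∈ F, ball (i : Eu (d + 1)) (r i * l))
        ≤ volume (((B ∩ {x | w x = 0}) \ ⋃ i ∈ F, closedBall (i : Eu (d + 1)) (r i)) ∪
          ⋃ i ∈ F, (closedBall (i : Eu (d + 1)) (r i) \ ball (i : Eu (d + 1)) (r i * l))) := by
          refine measure_mono fun x hx => ?_
          by_cases h1 : x ∈ ⋃ i ∈ F, closedBall (i : Eu (d + 1)) (r i)
          · obtain ⟨i, hi, hxi⟩ := mem_iUnion₂.1 h1
            exact Or.inr (mem_iUnion₂.2 ⟨i, hi, hxi, fun h2 => hx.2 (mem_iUnion₂.2 ⟨i, hi, h2⟩)⟩)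
          · exact Or.inl ⟨hx.1, h1⟩
      _ ≤ (ε / 2 : ℝ≥0) + ∑ i ∈ F, ENNReal.ofReal (1 - l ^ (d + 1)) *
          volume (closedBall (i : Eu (d + 1)) (r i)) :=
          (measure_union_le _ _).trans (add_le_add hcov ((measure_biUnion_finset_le _ _).trans
            (Finset.sum_le_sum fun i _ => volume_closedBall_diff_ball_le (hgood i).1 (by linarith) hl1)))
      _ ≤ (ε / 2 : ℝ≥0) + ENNReal.ofReal (1 - l ^ (d + 1)) * V := by
          rw [← Finset.mul_sum]
          gcongr
          exact hsum.trans hV.ge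
      _ ≤ (ε / 2 : ℝ≥0) + (ε / 2 : ℝ≥0) := by gcongr
      _ = ε := by rw [← ENNReal.coe_add, add_halves]
  · calc volume (B ∩ {x | w x ≠ 0 ∧ ∑ i ∈ F, ψ i x ≠ 0})
        ≤ volume (⋃ i ∈ F, (ball (i : Eu (d + 1)) (r i * 2) ∩ {x | w x ≠ 0})) := by
          refine measure_mono fun x hx => ?_
          rcases hΨ x with ⟨i, hi, hxi, -⟩ | h1
          · exact mem_iUnion₂.2 ⟨i, hi, hcb _ _ (hgood i).1 hxi, hx.2.1⟩
          · exact (hx.2.2 h1).elim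
      _ ≤ ∑ i ∈ F, δ * volume (ball (i : Eu (d + 1)) (r i)) :=
          (measure_biUnion_finset_le _ _).trans (Finset.sum_le_sum fun i _ => hwi i)
      _ ≤ δ * V := by rw [← Finset.mul_sum]; gcongr
      _ ≤ ε := by exact_mod_cast hδV
  · have hgm : ∀ i : t, AEMeasurable fun x => ‖gradient (ψ i) x‖ₑ ^ q * ‖w x‖ₑ ^ q := by
      intro i
      have h1 : (fun x => ‖gradient (ψ i) x‖ₑ ^ q * ‖w x‖ₑ ^ q) =
          B.indicator fun x => ‖gradient (ψ i) x‖ₑ ^ q * ‖w x‖ₑ ^ q := by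
        refine (indicator_eq_self.2 fun x hx => ?_).symm
        by_contra hxB
        refine hx ?_
        have h2 : x ∉ closedBall (i : Eu (d + 1)) (r i) := fun h3 =>
          hxB ((hgood i).2.2.1 (hcb _ _ (hgood i).1 h3))
        simp only [gradient_eq_zero_of_forall_notMem isClosed_closedBall (hψ0' i) h2, enorm_zero,
          ENNReal.zero_rpow_of_pos hq0, zero_mul]
      rw [h1, aemeasurable_indicator_iff measurableSet_ball]
      exact (((measurable_gradient _).enorm.pow_const q).aemeasurable).mul
        (hw.aestronglyMeasurable.enorm.pow_const q)
    calc ∫⁻ x, ‖gradient (fun x => ∑ i ∈ F, ψ i x) x‖ₑ ^ q * ‖w x‖ₑ ^ q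
        ≤ ∫⁻ x, ∑ i ∈ F, ‖gradient (ψ i) x‖ₑ ^ q * ‖w x‖ₑ ^ q := by
          refine lintegral_mono fun x => ?_
          rw [← Finset.sum_mul]
          exact mul_le_mul_left (enorm_gradient_sum_rpow_le (fun i => isClosed_closedBall) hdis
            hψ0' F hq0 x) _
      _ = ∑ i ∈ F, ∫⁻ x, ‖gradient (ψ i) x‖ₑ ^ q * ‖w x‖ₑ ^ q :=
          lintegral_finsetSum' _ fun i _ => hgm i
      _ ≤ ∑ i ∈ F, C * (δ : ℝ≥0∞) ^ (q / m) * volume (ball (i : Eu (d + 1)) (r i)) :=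
          Finset.sum_le_sum fun i _ => hψI i
      _ ≤ C * (δ : ℝ≥0∞) ^ (q / m) * V := by
          rw [← Finset.mul_sum]; exact mul_le_mul_right hsumV _
      _ ≤ ε := by
          rw [← ENNReal.coe_rpow_of_nonneg _ (by positivity)]
          exact_mod_cast hδC

end holes

section caratheodory
open Filter

theorem aemeasurable_apply_simpleFunc {α E : Type*} [MeasurableSpace α] {μ : Measure α}
    {f : α → E → ℝ} (hf : ∀ z, AEMeasurable (fun x => f x z) μ) (s : SimpleFunc α E) :
    AEMeasurable (fun x => f x (s x)) μ := by
  classical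
  have h : (fun x => f x (s x)) =
      fun x => ∑ z ∈ s.range, (s ⁻¹' {z}).indicator (fun x => f x z) x := by
    ext x
    rw [Finset.sum_eq_single (s x)]
    · rw [indicator_of_mem]; simp
    · intro z _ hz
      exact indicator_of_notMem (fun h => hz (by simpa using h.symm)) _
    · intro h; exact (h (s.mem_range_self x)).elim
  rw [h]
  exact Finset.aemeasurable_fun_sum _ fun z _ => (hf z).indicator (s.measurableSet_fiber z)

theorem aemeasurable_caratheodory {α E : Type*} [MeasurableSpace α] {μ : Measure α}
    [TopologicalSpace E] {f : α → E → ℝ}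
    (hf : ∀ z, AEMeasurable (fun x => f x z) μ) (hc : ∀ᵐ x ∂μ, Continuous (f x)) {v : α → E}
    (hv : AEStronglyMeasurable v μ) : AEMeasurable (fun x => f x (v x)) μ := by
  have h1 : AEMeasurable (fun x => f x (hv.mk v x)) μ := by
    refine aemeasurable_of_tendsto_metrizable_ae' (f := fun k x => f x
      (hv.stronglyMeasurable_mk.approx k x)) (fun k => aemeasurable_apply_simpleFunc hf _) ?_
    filter_upwards [hc] with x hx
    exact (hx.tendsto _).comp (hv.stronglyMeasurable_mk.tendsto_approx x)
  refine h1.congr ?_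
  filter_upwards [hv.ae_eq_mk] with x hx
  rw [hx]

theorem exists_iteration_const {θ γ : ℝ} (hθ : 0 ≤ θ) (hθ1 : θ < 1) (hγ : 0 < γ) :
    ∃ C : ℝ, 1 ≤ C ∧ ∀ (Φ : ℝ → ℝ) (M A B ρ σ : ℝ), ρ < σ → 0 ≤ A → 0 ≤ B →
      (∀ s, ρ ≤ s → s < σ → Φ s ≤ M) →
      (∀ s t, ρ ≤ s → s < t → t < σ → Φ s ≤ θ * Φ t + A * (t - s) ^ (-γ) + B) →
      Φ ρ ≤ C * (A * (σ - ρ) ^ (-γ) + B) := by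
  obtain ⟨τ, ⟨hτκ, hτ0⟩, hτ1⟩ : ∃ τ : ℝ, (θ * τ ^ (-γ) < 1 ∧ 0 < τ) ∧ τ < 1 := by
    have h1 : Tendsto (fun τ : ℝ => θ * τ ^ (-γ)) (𝓝[<] 1) (𝓝 (θ * 1 ^ (-γ))) :=
      ((Real.continuousAt_rpow_const 1 (-γ) (Or.inl one_ne_zero)).const_mul θ).tendsto.mono_left
        nhdsWithin_le_nhds
    rw [Real.one_rpow, mul_one] at h1
    have h2 : ∀ᶠ τ : ℝ in 𝓝[<] 1, 0 < τ :=
      (eventually_gt_nhds (by norm_num : (0 : ℝ) < 1)).filter_mono nhdsWithin_le_nhds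
    exact (((h1.eventually_lt_const hθ1).and h2).and self_mem_nhdsWithin).exists
  set κ := θ * τ ^ (-γ) with hκ
  have hτγ : 1 ≤ τ ^ (-γ) := Real.one_le_rpow_of_pos_of_le_one_of_nonpos hτ0 hτ1.le (by linarith)
  have h1τ : 0 < 1 - τ := by linarith
  have hκ0 : 0 ≤ κ := by positivity
  have hθκ : θ ≤ κ := le_mul_of_one_le_right hθ hτγ
  have hD : 1 ≤ (1 - τ) ^ (-γ) :=
    Real.one_le_rpow_of_pos_of_le_one_of_nonpos h1τ (by linarith) (by linarith)
  have hinv : 1 ≤ (1 - κ)⁻¹ := (one_le_inv₀ (by linarith)).2 (by linarith)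
  refine ⟨(1 - κ)⁻¹ * (1 - τ) ^ (-γ), one_le_mul_of_one_le_of_one_le hinv hD, ?_⟩
  intro Φ M A B ρ σ hρσ hA hB hM hΦ
  have hσρ : 0 < σ - ρ := by linarith
  set E := A * (1 - τ) ^ (-γ) * (σ - ρ) ^ (-γ) + B with hE
  have hE0 : 0 ≤ E := by positivity
  set t : ℕ → ℝ := fun i => ρ + (1 - τ ^ i) * (σ - ρ) with ht
  have htρ : ∀ i, ρ ≤ t i := fun i => by
    have : τ ^ i ≤ 1 := pow_le_one₀ hτ0.le hτ1.le
    have := mul_nonneg (sub_nonneg.2 this) hσρ.le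
    simp only [ht]; linarith
  have htσ : ∀ i, t i < σ := fun i => by
    have : 0 < τ ^ i * (σ - ρ) := by positivity
    simp only [ht]; nlinarith
  have hdiff : ∀ i, t (i + 1) - t i = τ ^ i * (1 - τ) * (σ - ρ) := fun i => by
    simp only [ht]; ring
  have hstep : ∀ k, Φ ρ ≤ θ ^ k * Φ (t k) + (∑ i ∈ Finset.range k, κ ^ i) * E := by
    intro k
    induction k with
    | zero => simp [ht]
    | succ k ih =>
      have h1 : t k < t (k + 1) := by
        have : 0 < τ ^ k * (1 - τ) * (σ - ρ) := by positivity
        linarith [hdiff k]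
      have h2 := hΦ _ _ (htρ k) h1 (htσ (k + 1))
      rw [hdiff, Real.mul_rpow (by positivity) hσρ.le, Real.mul_rpow (by positivity) h1τ.le,
        ← Real.rpow_natCast, ← Real.rpow_mul hτ0.le, mul_comm (k : ℝ) (-γ), Real.rpow_mul hτ0.le,
        Real.rpow_natCast] at h2
      have h3 : θ ^ k * Φ (t k) ≤ θ ^ (k + 1) * Φ (t (k + 1)) +
          κ ^ k * (A * (1 - τ) ^ (-γ) * (σ - ρ) ^ (-γ)) + θ ^ k * B := by
        refine (mul_le_mul_of_nonneg_left h2 (pow_nonneg hθ k)).trans (le_of_eq ?_)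
        rw [hκ, mul_pow]; ring
      have h4 : θ ^ k * B ≤ κ ^ k * B :=
        mul_le_mul_of_nonneg_right (pow_le_pow_left₀ hθ hθκ k) hB
      rw [Finset.sum_range_succ, add_mul]
      have h5 : κ ^ k * E = κ ^ k * (A * (1 - τ) ^ (-γ) * (σ - ρ) ^ (-γ)) + κ ^ k * B := by
        rw [hE]; ring
      linarith
  have hgeom : ∀ k, ∑ i ∈ Finset.range k, κ ^ i ≤ (1 - κ)⁻¹ := fun k => by
    rw [← tsum_geometric_of_lt_one hκ0 hτκ]
    exact (summable_geometric_of_lt_one hκ0 hτκ).sum_le_tsum _ fun i _ => pow_nonneg hκ0 i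
  have hbound : ∀ k, Φ ρ ≤ θ ^ k * M + (1 - κ)⁻¹ * E := fun k =>
    (hstep k).trans (add_le_add (mul_le_mul_of_nonneg_left (hM _ (htρ k) (htσ k)) (pow_nonneg hθ k))
      (mul_le_mul_of_nonneg_right (hgeom k) hE0))
  have hlim : Tendsto (fun k : ℕ => θ ^ k * M + (1 - κ)⁻¹ * E) atTop (𝓝 (0 * M + (1 - κ)⁻¹ * E)) :=
    ((tendsto_pow_atTop_nhds_zero_of_lt_one hθ hθ1).mul_const M).add_const _
  have hfinal := ge_of_tendsto' hlim hbound
  rw [zero_mul, zero_add] at hfinal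
  refine hfinal.trans ?_
  rw [mul_assoc]
  refine mul_le_mul_of_nonneg_left ?_ (by linarith)
  rw [mul_add, hE]
  have : B ≤ (1 - τ) ^ (-γ) * B := le_mul_of_one_le_left hB hD
  linarith [mul_comm A ((1 - τ) ^ (-γ))]

end caratheodory

section rearrangement
open Filter
variable {n : ℕ}

theorem exists_measure_lt_le {H : Eu n → ℝ} {p : ℝ} (hp : 0 < p) (hH : AEMeasurable H)
    (hfin : ∫⁻ x, ENNReal.ofReal (|H x| ^ p) ≠ ∞) {t : ℝ} (ht : 0 < t) :
    {σ : ℝ | 0 < σ ∧ volume {x | σ < |H x|} ≤ ENNReal.ofReal t}.Nonempty := by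
  set I := ∫⁻ x, ENNReal.ofReal (|H x| ^ p) with hI
  have h1 : Tendsto (fun σ : ℝ => I / ENNReal.ofReal (σ ^ p)) atTop (𝓝 0) := by
    have := ENNReal.tendsto_ofReal_atTop.comp (tendsto_rpow_atTop hp)
    simpa using ENNReal.Tendsto.const_div this (Or.inr hfin)
  obtain ⟨σ, h2, h3⟩ := ((h1.eventually_le_const (ENNReal.ofReal_pos.2 ht)).and
    (eventually_gt_atTop 0)).exists
  refine ⟨σ, h3, le_trans ?_ h2⟩
  have h4 : 0 < σ ^ p := by positivity
  have hm : AEMeasurable fun x => ENNReal.ofReal (|H x| ^ p) :=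
    ((continuous_abs.measurable.comp_aemeasurable hH).pow_const p).ennreal_ofReal
  refine le_trans (measure_mono fun x hx => ?_)
    (meas_ge_le_lintegral_div hm (ENNReal.ofReal_pos.2 h4).ne' ENNReal.ofReal_ne_top)
  exact ENNReal.ofReal_le_ofReal (Real.rpow_le_rpow h3.le (le_of_lt hx) hp.le)

theorem rearr_nonneg (H : Eu n → ℝ) (t : ℝ) : 0 ≤ rearr n H t :=
  Real.sInf_nonneg fun _ hσ => hσ.1.le

theorem lt_measure_of_lt_rearr {H : Eu n → ℝ} {s t : ℝ} (hs : 0 < s) (h : s < rearr n H t) :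
    ENNReal.ofReal t < volume {x | s < |H x|} := by
  by_contra! h1
  exact (csInf_le (s := {σ : ℝ | 0 < σ ∧ volume {x | σ < |H x|} ≤ ENNReal.ofReal t})
    ⟨0, fun σ hσ => hσ.1.le⟩ ⟨hs, h1⟩).not_gt h

theorem le_rearr_of_lt_measure {H : Eu n → ℝ} {s t : ℝ}
    (hne : {σ : ℝ | 0 < σ ∧ volume {x | σ < |H x|} ≤ ENNReal.ofReal t}.Nonempty)
    (h : ENNReal.ofReal t < volume {x | s < |H x|}) : s ≤ rearr n H t := by
  refine le_csInf hne fun σ hσ => ?_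
  by_contra! h1
  exact (hσ.2.trans_lt h).not_ge (measure_mono fun x hx => h1.trans hx)

theorem volume_setOf_ofReal_lt_le (D : ℝ≥0∞) : volume {t : ℝ | 0 < t ∧ ENNReal.ofReal t < D} ≤ D := by
  rcases eq_or_ne D ∞ with rfl | hD
  · exact le_top
  · calc volume {t : ℝ | 0 < t ∧ ENNReal.ofReal t < D} ≤ volume (Ioo 0 D.toReal) := by
          refine measure_mono fun t ht => ⟨ht.1, ?_⟩
          exact (ENNReal.ofReal_lt_iff_lt_toReal ht.1.le hD).1 ht.2
      _ = D := by rw [Real.volume_Ioo, sub_zero, ENNReal.ofReal_toReal hD]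

theorem aemeasurable_rearr {H : Eu n → ℝ} {p : ℝ} (hp : 0 < p) (hH : AEMeasurable H)
    (hfin : ∫⁻ x, ENNReal.ofReal (|H x| ^ p) ≠ ∞) (T : ℝ) :
    AEMeasurable (rearr n H) (volume.restrict (Ioo 0 T)) := by
  refine aemeasurable_restrict_of_antitoneOn measurableSet_Ioo fun s hs t ht hst => ?_
  refine csInf_le_csInf ⟨0, fun σ hσ => hσ.1.le⟩ (exists_measure_lt_le hp hH hfin hs.1) ?_
  exact fun σ hσ => ⟨hσ.1, hσ.2.trans (ENNReal.ofReal_le_ofReal hst)⟩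

theorem lintegral_rearr_rpow_le {H : Eu n → ℝ} {p : ℝ} (hp : 0 < p) (hH : AEMeasurable H)
    (hfin : ∫⁻ x, ENNReal.ofReal (|H x| ^ p) ≠ ∞) (T : ℝ) :
    ∫⁻ t in Ioo 0 T, ENNReal.ofReal (rearr n H t ^ p) ≤ ∫⁻ x, ENNReal.ofReal (|H x| ^ p) := by
  rw [lintegral_rpow_eq_lintegral_meas_lt_mul _ (ae_of_all _ fun t => rearr_nonneg H t)
      (aemeasurable_rearr hp hH hfin T) hp,
    lintegral_rpow_eq_lintegral_meas_lt_mul _ (ae_of_all _ fun x => abs_nonneg (H x))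
      (continuous_abs.measurable.comp_aemeasurable hH) hp]
  refine mul_le_mul_right (setLIntegral_mono' measurableSet_Ioi fun s hs => ?_) _
  refine mul_le_mul_left ?_ _
  refine le_trans ?_ (volume_setOf_ofReal_lt_le _)
  rw [Measure.restrict_apply₀' measurableSet_Ioo.nullMeasurableSet]
  exact measure_mono fun t ht => ⟨ht.2.1, lt_measure_of_lt_rearr hs ht.1⟩

theorem setLIntegral_rpow_le_lintegral_rearr {H : Eu n → ℝ} {p : ℝ} (hp : 0 < p)
    (hH : AEMeasurable H) (hfin : ∫⁻ x, ENNReal.ofReal (|H x| ^ p) ≠ ∞) {A : Set (Eu n)} {T : ℝ}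
    (hA : volume A ≤ ENNReal.ofReal T) :
    ∫⁻ x in A, ENNReal.ofReal (|H x| ^ p) ≤ ∫⁻ t in Ioo 0 T, ENNReal.ofReal (rearr n H t ^ p) := by
  rw [lintegral_rpow_eq_lintegral_meas_le_mul _ (ae_of_all _ fun t => rearr_nonneg H t)
      (aemeasurable_rearr hp hH hfin T) hp,
    lintegral_rpow_eq_lintegral_meas_lt_mul _ (ae_of_all _ fun x => abs_nonneg (H x))
      (continuous_abs.measurable.comp_aemeasurable hH.restrict) hp]
  refine mul_le_mul_right (setLIntegral_mono' measurableSet_Ioi fun s hs => ?_) _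
  refine mul_le_mul_left ?_ _
  set m : ℝ≥0∞ := min (ENNReal.ofReal T) (volume {x | s < |H x|}) with hm
  have hmfin : m ≠ ∞ := ne_top_of_le_ne_top ENNReal.ofReal_ne_top (min_le_left _ _)
  calc (volume.restrict A) {x | s < |H x|} ≤ m := by
        refine le_min (le_trans ?_ hA) (Measure.restrict_le_self _)
        exact (measure_mono (subset_univ _)).trans (Measure.restrict_apply_univ _).le
    _ = volume (Ioo 0 m.toReal) := by rw [Real.volume_Ioo, sub_zero, ENNReal.ofReal_toReal hmfin]
    _ ≤ _ := by
        rw [Measure.restrict_apply₀' measurableSet_Ioo.nullMeasurableSet]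
        refine measure_mono fun t ht => ?_
        have h1 : ENNReal.ofReal t < m := (ENNReal.ofReal_lt_iff_lt_toReal ht.1.le hmfin).2 ht.2
        refine ⟨le_rearr_of_lt_measure (exists_measure_lt_le hp hH hfin ht.1)
          (h1.trans_le (min_le_right _ _)), ht.1, ?_⟩
        exact (ENNReal.ofReal_lt_ofReal_iff_of_nonneg ht.1.le).1 (h1.trans_le (min_le_left _ _))

theorem setIntegral_le_omegaFn {g : Eu n → ℝ} {p : ℝ} (hp : 1 ≤ p)
    (hg0 : ∀ᵐ x ∂volume.restrict (ball (0 : Eu n) 1), 0 ≤ g x)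
    (hgm : AEMeasurable g (volume.restrict (ball (0 : Eu n) 1)))
    (hgi : IntegrableOn (fun x => g x ^ (p / (p - 1))) (ball (0 : Eu n) 1)) {A : Set (Eu n)}
    (hA : A ⊆ ball 0 1) {T : ℝ} (hT : volume A ≤ ENNReal.ofReal T) :
    ∫ x in A, g x ^ (p / (p - 1)) ≤ omegaFn n p g T := by
  have hp0 : 0 < p := by linarith
  set H : Eu n → ℝ := (ball (0 : Eu n) 1).indicator fun x => g x ^ (1 / (p - 1)) with hH
  have hHm : AEMeasurable H := by
    rw [hH, aemeasurable_indicator_iff measurableSet_ball]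
    exact hgm.pow_const _
  have hHp : ∀ᵐ x ∂volume.restrict (ball (0 : Eu n) 1), |H x| ^ p = g x ^ (p / (p - 1)) := by
    filter_upwards [hg0, ae_restrict_mem measurableSet_ball] with x hx hxB
    rw [hH, indicator_of_mem hxB, abs_of_nonneg (by positivity), ← Real.rpow_mul hx]
    congr 1; ring
  have hG0 : ∀ᵐ x ∂volume.restrict (ball (0 : Eu n) 1), 0 ≤ g x ^ (p / (p - 1)) := by
    filter_upwards [hg0] with x hx using by positivity
  have hfin : ∫⁻ x, ENNReal.ofReal (|H x| ^ p) ≠ ∞ := by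
    have h1 : (fun x => ENNReal.ofReal (|H x| ^ p)) =
        (ball (0 : Eu n) 1).indicator fun x => ENNReal.ofReal (|H x| ^ p) := by
      refine (indicator_eq_self.2 fun x hx => ?_).symm
      by_contra hxB
      refine hx ?_
      simp only [hH, indicator_of_notMem hxB, abs_zero, Real.zero_rpow hp0.ne', ENNReal.ofReal_zero]
    rw [h1, lintegral_indicator measurableSet_ball, lintegral_congr_ae
        (hHp.mono fun x hx => congrArg ENNReal.ofReal hx),
      ← ofReal_integral_eq_lintegral_ofReal hgi hG0]
    exact ENNReal.ofReal_ne_top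
  have hle : volume.restrict A ≤ volume.restrict (ball (0 : Eu n) 1) := Measure.restrict_mono hA le_rfl
  rw [integral_eq_lintegral_of_nonneg_ae (ae_mono hle hG0) (hgi.mono_set hA).aestronglyMeasurable,
    omegaFn, integral_eq_lintegral_of_nonneg_ae
      (ae_of_all _ fun t => Real.rpow_nonneg (rearr_nonneg H t) p)
      ((aemeasurable_rearr hp0 hHm hfin T).pow_const p).aestronglyMeasurable]
  refine ENNReal.toReal_mono
    (ne_top_of_le_ne_top hfin (lintegral_rearr_rpow_le hp0 hHm hfin T)) ?_
  rw [← lintegral_congr_ae (ae_mono hle (hHp.mono fun x hx => congrArg ENNReal.ofReal hx))]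
  exact setLIntegral_rpow_le_lintegral_rearr hp0 hHm hfin hT

end rearrangement

section energy
open Filter
variable {n : ℕ}

theorem LipschitzWith.isWeakGradOn_gradient {Z : Eu n → ℝ} {C : ℝ≥0} (hZ : LipschitzWith C Z)
    (Ω : Set (Eu n)) : IsWeakGradOn n Ω Z (gradient Z) := by
  rw [isWeakGradOn_iff]
  intro φ h1 h2 _ i
  simp only [gradient_apply]
  rw [hZ.integral_fderiv_mul_eq h1 h2, neg_neg]

/-- The structural assumptions on the integrand `f` and the `Q`-minimizer `u`, with the
inhomogeneity `G` of the growth condition and measurable representatives of `u` and `du`. -/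
structure IsGrowthMinimizer (n : ℕ) (Ω : Set (Eu n)) (p q Q L : ℝ) (G : Eu n → ℝ)
    (f : Eu n → Eu n → ℝ) (u : Eu n → ℝ) (du : Eu n → Eu n) : Prop where
  isOpen : IsOpen Ω
  closedBall_subset : closedBall 0 1 ⊆ Ω
  one_le_exponent : 1 ≤ p
  one_lt_exponent : 1 < q
  one_le_const : 1 ≤ Q
  const_nonneg : 0 ≤ L
  nonneg : ∀ᵐ x ∂volume.restrict Ω, 0 ≤ G x
  integrableOn : IntegrableOn G Ω
  aemeasurable : ∀ z, AEMeasurable (fun x => f x z) (volume.restrict Ω)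
  continuous : ∀ᵐ x ∂volume.restrict Ω, Continuous (f x)
  convexOn : ∀ᵐ x ∂volume.restrict Ω, ConvexOn ℝ univ (f x)
  growth : ∀ᵐ x ∂volume.restrict Ω, ∀ z, ‖z‖ ^ p - G x ≤ f x z ∧ f x z ≤ L * ‖z‖ ^ q + G x
  isQMinimizer : IsQMinimizer n Ω f Q u du
  measurable : Measurable u
  measurable_grad : Measurable du

/-- The nonnegative energy density `f(x, v(x)) + G(x)`. -/
def energyDensity (f : Eu n → Eu n → ℝ) (G : Eu n → ℝ) (v : Eu n → Eu n) (x : Eu n) : ℝ≥0∞ :=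
  ENNReal.ofReal (f x (v x) + G x)

namespace IsGrowthMinimizer

variable {Ω : Set (Eu n)} {p q Q L : ℝ} {G : Eu n → ℝ} {f : Eu n → Eu n → ℝ} {u : Eu n → ℝ}
  {du : Eu n → Eu n}

theorem aemeasurable_energyDensity (H : IsGrowthMinimizer n Ω p q Q L G f u du) {v : Eu n → Eu n}
    (hv : AEStronglyMeasurable v (volume.restrict Ω)) :
    AEMeasurable (energyDensity f G v) (volume.restrict Ω) :=
  ((aemeasurable_caratheodory H.aemeasurable H.continuous hv).add
    H.integrableOn.aestronglyMeasurable.aemeasurable).ennreal_ofReal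

theorem enorm_rpow_le_energyDensity (H : IsGrowthMinimizer n Ω p q Q L G f u du)
    (v : Eu n → Eu n) : ∀ᵐ x ∂volume.restrict Ω, ‖v x‖ₑ ^ p ≤ energyDensity f G v x := by
  have := H.one_le_exponent
  filter_upwards [H.growth] with x hx
  rw [← ofReal_norm, ENNReal.ofReal_rpow_of_nonneg (norm_nonneg _) (by linarith), energyDensity]
  exact ENNReal.ofReal_le_ofReal (by linarith [(hx (v x)).1])

theorem add_nonneg (H : IsGrowthMinimizer n Ω p q Q L G f u du) :
    ∀ᵐ x ∂volume.restrict Ω, ∀ z, 0 ≤ f x z + G x := by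
  filter_upwards [H.growth] with x hx z
  have : 0 ≤ ‖z‖ ^ p := by positivity
  linarith [(hx z).1]

theorem lintegral_energyDensity_le (H : IsGrowthMinimizer n Ω p q Q L G f u du) {φ : Eu n → ℝ}
    {dφ : Eu n → Eu n} (hφ : IsWeakGradOn n Ω φ dφ) (hi : IntegrableOn φ Ω)
    (hdi : IntegrableOn dφ Ω) (hc : IsCompact (tsupport φ)) (hs : tsupport φ ⊆ Ω) :
    ∫⁻ x in tsupport φ, energyDensity f G du x ≠ ∞ ∧
    ∫⁻ x in tsupport φ, energyDensity f G du x ≤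
      ENNReal.ofReal Q * ∫⁻ x in tsupport φ, energyDensity f G (fun x => du x + dφ x) x := by
  obtain ⟨h1, h2⟩ := H.isQMinimizer.2.2.2 φ dφ hφ hi hdi hc hs
  have hQ := H.one_le_const
  have hle : volume.restrict (tsupport φ) ≤ volume.restrict Ω := Measure.restrict_mono hs le_rfl
  have hG : IntegrableOn G (tsupport φ) := H.integrableOn.mono_set hs
  have hnn : ∀ᵐ x ∂volume.restrict (tsupport φ), ∀ z, 0 ≤ f x z + G x := ae_mono hle H.add_nonneg
  have e1 : ∫⁻ x in tsupport φ, energyDensity f G du x =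
      ENNReal.ofReal (∫ x in tsupport φ, (f x (du x) + G x)) :=
    (ofReal_integral_eq_lintegral_ofReal (h1.add hG) (hnn.mono fun x hx => hx _)).symm
  refine ⟨by rw [e1]; exact ENNReal.ofReal_ne_top, ?_⟩
  by_cases htop : ∫⁻ x in tsupport φ, energyDensity f G (fun x => du x + dφ x) x = ∞
  · rw [htop, ENNReal.mul_top (by simp; linarith)]; exact le_top
  have hm : AEMeasurable (fun x => f x (du x + dφ x)) (volume.restrict (tsupport φ)) :=
    (aemeasurable_caratheodory H.aemeasurable H.continuous
      (H.measurable_grad.aestronglyMeasurable.add hdi.aestronglyMeasurable)).mono_measure hle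
  have h3 : IntegrableOn (fun x => f x (du x + dφ x) + G x) (tsupport φ) := by
    refine ⟨(hm.add hG.aestronglyMeasurable.aemeasurable).aestronglyMeasurable, ?_⟩
    rw [hasFiniteIntegral_iff_ofReal (hnn.mono fun x hx => hx _)]
    exact lt_top_iff_ne_top.2 htop
  have h4 : IntegrableOn (fun x => f x (du x + dφ x)) (tsupport φ) := by
    have := h3.sub hG
    simpa only [Pi.sub_def, add_sub_cancel_right] using this
  have e2 : ∫⁻ x in tsupport φ, energyDensity f G (fun x => du x + dφ x) x =
      ENNReal.ofReal (∫ x in tsupport φ, (f x (du x + dφ x) + G x)) :=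
    (ofReal_integral_eq_lintegral_ofReal h3 (hnn.mono fun x hx => hx _)).symm
  rw [e1, e2, ← ENNReal.ofReal_mul (by linarith), integral_add h1 hG, integral_add h4 hG]
  refine ENNReal.ofReal_le_ofReal ?_
  have h5 : 0 ≤ ∫ x in tsupport φ, G x :=
    integral_nonneg_of_ae (ae_mono hle H.nonneg)
  nlinarith [h2 h4]

theorem lintegral_ball_energyDensity_ne_top (H : IsGrowthMinimizer n Ω p q Q L G f u du) :
    ∫⁻ x in ball 0 1, energyDensity f G du x ≠ ∞ := by
  obtain ⟨δ, hδ, hδΩ⟩ := (isCompact_closedBall (0 : Eu n) 1).exists_cthickening_subset_open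
    H.isOpen H.closedBall_subset
  rw [cthickening_closedBall hδ.le (by norm_num)] at hδΩ
  let φ : ContDiffBump (0 : Eu n) := ⟨1, 1 + δ, by norm_num, by linarith⟩
  have hts : tsupport φ = closedBall 0 (1 + δ) := φ.tsupport_eq
  have hcs : HasCompactSupport φ := φ.hasCompactSupport
  obtain ⟨C, hC⟩ := (φ.contDiff (n := 1)).lipschitzWith_of_hasCompactSupport hcs (by simp)
  have hgi : Integrable (gradient φ) := by
    refine Integrable.mono' (g := (closedBall (0 : Eu n) (1 + δ)).indicator fun _ => (C : ℝ))
      ((integrable_indicator_iff measurableSet_closedBall).2 (integrableOn_const measure_closedBall_lt_top.ne))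
      (measurable_gradient _).aestronglyMeasurable (ae_of_all _ fun x => ?_)
    by_cases hx : x ∈ closedBall (0 : Eu n) (1 + δ)
    · rw [indicator_of_mem hx]; exact hC.norm_gradient_le x
    · rw [gradient_eq_zero_of_forall_notMem isClosed_closedBall
        (fun y hy => image_eq_zero_of_notMem_tsupport (hts ▸ hy)) hx, indicator_of_notMem hx, norm_zero]
  have := (H.lintegral_energyDensity_le (hC.isWeakGradOn_gradient Ω)
    (φ.continuous.integrable_of_hasCompactSupport hcs).integrableOn hgi.integrableOn hcs
    (by rw [hts, add_comm]; exact hδΩ)).1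
  refine ne_top_of_le_ne_top this (lintegral_mono_set ?_)
  rw [hts]
  exact ball_subset_closedBall.trans (closedBall_subset_closedBall (by linarith))

end IsGrowthMinimizer

theorem exists_lipschitzWith_rpow {η : Eu n → ℝ} {K : ℝ≥0} (hη : LipschitzWith K η)
    (h01 : ∀ x, 0 ≤ η x ∧ η x ≤ 1) {q : ℝ} (hq : 1 ≤ q) :
    ∃ K', LipschitzWith K' fun x => η x ^ q := by
  refine ⟨q.toNNReal * K, LipschitzWith.of_dist_le_mul fun x y => ?_⟩
  have h1 : ‖η x ^ q - η y ^ q‖ ≤ q * ‖η x - η y‖ := by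
    refine Convex.norm_image_sub_le_of_norm_deriv_le (f := fun t : ℝ => t ^ q) (s := Icc 0 1)
      (fun t _ => (Real.hasDerivAt_rpow_const (Or.inr hq)).differentiableAt) (fun t ht => ?_)
      (convex_Icc 0 1) (h01 y) (h01 x)
    rw [(Real.hasDerivAt_rpow_const (Or.inr hq)).deriv, Real.norm_of_nonneg (by have := ht.1; positivity)]
    exact mul_le_of_le_one_right (by linarith) (Real.rpow_le_one ht.1 ht.2 (by linarith))
  have h2 := hη.dist_le_mul x y
  rw [Real.dist_eq, ← Real.norm_eq_abs] at h2 ⊢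
  rw [NNReal.coe_mul, Real.coe_toNNReal q (by linarith), mul_assoc]
  exact h1.trans (mul_le_mul_of_nonneg_left h2 (by linarith))

theorem gradient_neg_rpow {η : Eu n → ℝ} {x : Eu n} (hx : DifferentiableAt ℝ η x) {q : ℝ}
    (hq : 1 ≤ q) :
    gradient (fun x => -(η x ^ q)) x = -((q * η x ^ (q - 1)) • gradient η x) := by
  have h := (hx.hasFDerivAt.rpow_const (p := q) (Or.inr hq)).neg
  have h' : fderiv ℝ (fun x => -(η x ^ q)) x = -((q * η x ^ (q - 1)) • fderiv ℝ η x) := h.fderiv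
  rw [gradient, h', map_neg, LinearIsometryEquiv.map_smul, gradient]

end energy

section energy
open Filter
variable {n : ℕ}

theorem convex_cutoff_le {F : Eu n → ℝ} (hF : ConvexOn ℝ univ F) {L q G : ℝ} (hL : 0 ≤ L)
    (hq : 1 < q) (hG : 0 ≤ G) (hup : ∀ z, F z ≤ L * ‖z‖ ^ q + G) {η w : ℝ} (h0 : 0 ≤ η) (h1 : η ≤ 1)
    (hw : 0 ≤ w) (z D : Eu n) :
    F (z + (-(η ^ q) • z + w • -((q * η ^ (q - 1)) • D))) + G ≤
      (1 - η ^ q) * (F z + G) + L * q ^ q * (‖D‖ ^ q * w ^ q) + 2 * G := by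
  have hE : 0 ≤ L * q ^ q * (‖D‖ ^ q * w ^ q) := by positivity
  rcases h0.eq_or_lt with rfl | hη
  · rw [Real.zero_rpow (by linarith), Real.zero_rpow (by linarith)]
    simp only [neg_zero, zero_smul, mul_zero, smul_zero, add_zero, sub_zero, one_mul]
    linarith
  · set y : Eu n := (-(q * w / η)) • D with hy
    have hZ0 : 0 ≤ η ^ q := by positivity
    have hZ1 : η ^ q ≤ 1 := Real.rpow_le_one h0 h1 (by linarith)
    have harg : z + (-(η ^ q) • z + w • -((q * η ^ (q - 1)) • D)) = (1 - η ^ q) • z + η ^ q • y := by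
      rw [hy, Real.rpow_sub_one hη.ne']
      module
    have hyq : η ^ q * ‖y‖ ^ q = q ^ q * (‖D‖ ^ q * w ^ q) := by
      rw [hy, norm_smul, norm_neg, Real.norm_of_nonneg (by positivity),
        Real.mul_rpow (by positivity) (by positivity), Real.div_rpow (by positivity) (by positivity),
        Real.mul_rpow (by positivity) (by positivity)]
      field_simp
    rw [harg]
    have h2 := hF.2 (mem_univ z) (mem_univ y) (sub_nonneg.2 hZ1) hZ0 (by ring)
    simp only [smul_eq_mul] at h2
    have h3 := mul_le_mul_of_nonneg_left (hup y) hZ0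
    have h4 : η ^ q * G ≤ G := mul_le_of_le_one_left hG hZ1
    have h5 : η ^ q * (L * ‖y‖ ^ q + G) = L * q ^ q * (‖D‖ ^ q * w ^ q) + η ^ q * G := by
      rw [mul_add, mul_left_comm, hyq]; ring
    linarith

namespace IsGrowthMinimizer

variable {Ω : Set (Eu n)} {p q Q L : ℝ} {G : Eu n → ℝ} {f : Eu n → Eu n → ℝ} {u : Eu n → ℝ}
  {du : Eu n → Eu n}

theorem energyDensity_cutoff_le (H : IsGrowthMinimizer n Ω p q Q L G f u du) (k : ℝ)
    {η : Eu n → ℝ} {K : ℝ≥0} (hη : LipschitzWith K η) (h01 : ∀ x, 0 ≤ η x ∧ η x ≤ 1) :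
    ∀ᵐ x ∂volume.restrict Ω, k < u x →
      energyDensity f G (fun x => du x + (-(η x ^ q) • ({x | k < u x}.indicator du x) +
        max (u x - k) 0 • gradient (fun x => -(η x ^ q)) x)) x ≤
      ENNReal.ofReal (1 - η x ^ q) * energyDensity f G du x +
        ENNReal.ofReal (L * q ^ q) * (‖gradient η x‖ₑ ^ q * ‖max (u x - k) 0‖ₑ ^ q) +
        2 * ENNReal.ofReal (G x) := by
  have hq := H.one_lt_exponent
  have hL := H.const_nonneg
  filter_upwards [H.nonneg, H.convexOn, H.growth, H.add_nonneg,
    ae_restrict_of_ae (hη.ae_differentiableAt (μ := volume))] with x hG hc hgr hnn hd hk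
  have hw : 0 ≤ max (u x - k) 0 := le_max_right _ _
  have hind : {x | k < u x}.indicator du x = du x := indicator_of_mem (s := {x | k < u x}) hk du
  obtain ⟨h0, h1⟩ := h01 x
  have hη1 : η x ^ q ≤ 1 := Real.rpow_le_one h0 h1 (by linarith)
  have hη1' : 0 ≤ 1 - η x ^ q := by linarith
  have hnn' := hnn (du x)
  have h2 : (2 : ℝ≥0∞) * ENNReal.ofReal (G x) = ENNReal.ofReal (2 * G x) := by
    rw [ENNReal.ofReal_mul (by norm_num), ENNReal.ofReal_ofNat]
  rw [energyDensity, hind, gradient_neg_rpow hd hq.le, energyDensity, ← ofReal_norm, ← ofReal_norm,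
    Real.norm_of_nonneg hw, ENNReal.ofReal_rpow_of_nonneg (norm_nonneg _) (by linarith),
    ENNReal.ofReal_rpow_of_nonneg hw (by linarith), ← ENNReal.ofReal_mul hη1',
    ← ENNReal.ofReal_mul (by positivity), ← ENNReal.ofReal_mul (by positivity),
    ← ENNReal.ofReal_add (by positivity) (by positivity), h2,
    ← ENNReal.ofReal_add (by positivity) (by positivity)]
  exact ENNReal.ofReal_le_ofReal
    (convex_cutoff_le hc hL hq hG (fun z => (hgr z).2) h0 h1 hw (du x) (gradient η x))

theorem lintegral_cutoff_le (H : IsGrowthMinimizer n Ω p q Q L G f u du) (k : ℝ)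
    {η : Eu n → ℝ} {K : ℝ≥0} (hη : LipschitzWith K η) (h01 : ∀ x, 0 ≤ η x ∧ η x ≤ 1)
    {C : Set (Eu n)} (hC : IsClosed C) (hC1 : C ⊆ closedBall 0 1) (hηC : ∀ x ∉ C, η x = 0) :
    ∃ T ⊆ C, MeasurableSet T ∧ (∀ x, k < u x → η x ≠ 0 → x ∈ T) ∧
      ∫⁻ x in T, energyDensity f G du x ≤ ENNReal.ofReal Q *
        ((∫⁻ x in T ∩ {x | k < u x}, ENNReal.ofReal (1 - η x ^ q) * energyDensity f G du x) +
        ENNReal.ofReal (L * q ^ q) * (∫⁻ x, ‖gradient η x‖ₑ ^ q * ‖max (u x - k) 0‖ₑ ^ q) +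
        2 * (∫⁻ x in T ∩ {x | k < u x}, ENNReal.ofReal (G x)) +
        ∫⁻ x in T \ {x | k < u x}, energyDensity f G du x) := by
  have hq := H.one_lt_exponent
  obtain ⟨hwg, hul, hdul, -⟩ := H.isQMinimizer
  have hq0 : q ≠ 0 := by linarith
  set P : Set (Eu n) := {x | k < u x} with hP
  have hPm : MeasurableSet P := measurableSet_lt measurable_const H.measurable
  set w : Eu n → ℝ := fun x => max (u x - k) 0 with hw
  set Z : Eu n → ℝ := fun x => -(η x ^ q) with hZ
  obtain ⟨K', hK'⟩ := exists_lipschitzWith_rpow hη h01 hq.le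
  have hZL : LipschitzWith K' Z := hK'.neg
  have hZ1 : ∀ x, ‖Z x‖ ≤ 1 := fun x => by
    have := (h01 x).1
    rw [hZ, norm_neg, Real.norm_of_nonneg (by positivity)]
    exact Real.rpow_le_one (h01 x).1 (h01 x).2 (by linarith)
  have hZC : ∀ x ∉ C, Z x = 0 := fun x hx => by simp [hZ, hηC x hx, Real.zero_rpow hq0]
  have hCΩ : C ⊆ Ω := hC1.trans H.closedBall_subset
  have hCc : IsCompact C := (isCompact_closedBall (0 : Eu n) 1).of_isClosed_subset hC hC1
  have hwm : Measurable w := (H.measurable.sub_const k).max measurable_const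
  have hwl : LocallyIntegrableOn w Ω := by
    rw [locallyIntegrableOn_iff H.isOpen.isLocallyClosed] at hul ⊢
    intro K hK hKc
    exact ((hul K hK hKc).sub (integrableOn_const hKc.measure_lt_top.ne)).pos_part
  have hdwl : LocallyIntegrableOn (P.indicator du) Ω := by
    rw [locallyIntegrableOn_iff H.isOpen.isLocallyClosed] at hdul ⊢
    intro K hK hKc
    exact (hdul K hK hKc).indicator hPm
  have hgZC : ∀ x ∉ C, gradient Z x = 0 := fun x hx =>
    gradient_eq_zero_of_forall_notMem hC hZC hx
  have hφ := (hwg.posPart H.isOpen hul hdul k).lipschitz_mul H.isOpen hwl hdwl hZL hZ1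
  set φ : Eu n → ℝ := fun x => Z x * w x with hφd
  set dφ : Eu n → Eu n := fun x => Z x • P.indicator du x + w x • gradient Z x with hdφ
  have hts : tsupport φ ⊆ C := by
    refine closure_minimal (fun x hx => ?_) hC
    by_contra hxC
    exact hx (by simp [hφd, hZC x hxC])
  have hwC := (hwl.mono_set hCΩ).integrableOn_isCompact hCc
  have hφi : IntegrableOn φ Ω := by
    have h1 : IntegrableOn φ C :=
      hwC.bdd_mul hZL.continuous.aestronglyMeasurable (ae_of_all _ hZ1)
    refine h1.of_forall_sdiff_eq_zero H.isOpen.measurableSet fun x hx => ?_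
    simp [hφd, hZC x hx.2]
  have hdφi : IntegrableOn dφ Ω := by
    have h1 : IntegrableOn dφ C := by
      refine Integrable.add ?_ ?_
      · exact ((hdwl.mono_set hCΩ).integrableOn_isCompact hCc).bdd_smul 1 hZL.continuous.aestronglyMeasurable
          (ae_of_all _ hZ1)
      · exact hwC.smul_bdd K' (measurable_gradient Z).aestronglyMeasurable
          (ae_of_all _ fun x => hZL.norm_gradient_le x)
    refine h1.of_forall_sdiff_eq_zero H.isOpen.measurableSet fun x hx => ?_
    simp [hdφ, hZC x hx.2, hgZC x hx.2]
  have hcT : IsCompact (tsupport φ) := hCc.of_isClosed_subset (isClosed_tsupport φ) hts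
  have hTm : MeasurableSet (tsupport φ) := (isClosed_tsupport φ).measurableSet
  have hTΩ := hts.trans hCΩ
  refine ⟨tsupport φ, hts, hTm, fun x hx hηx => subset_tsupport φ ?_, ?_⟩
  · have h1 : w x ≠ 0 := by simp only [hw]; rw [max_eq_left (by linarith)]; linarith
    have h2 : Z x ≠ 0 := by
      have := (h01 x).1.lt_of_ne' hηx
      simp only [hZ]; exact neg_ne_zero.2 (by positivity)
    exact mul_ne_zero h2 h1
  refine (H.lintegral_energyDensity_le hφ hφi hdφi hcT hTΩ).2.trans (mul_le_mul_right ?_ _)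
  rw [← lintegral_inter_add_sdiff _ (tsupport φ) hPm]
  refine add_le_add ?_ (le_of_eq ?_)
  · have hle : volume.restrict (tsupport φ ∩ P) ≤ volume.restrict Ω :=
      Measure.restrict_mono (inter_subset_left.trans hTΩ) le_rfl
    have hae : ∀ᵐ x ∂volume.restrict (tsupport φ ∩ P), energyDensity f G (fun x => du x + dφ x) x ≤
        ENNReal.ofReal (1 - η x ^ q) * energyDensity f G du x +
        ENNReal.ofReal (L * q ^ q) * (‖gradient η x‖ₑ ^ q * ‖w x‖ₑ ^ q) +
        2 * ENNReal.ofReal (G x) := by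
      filter_upwards [ae_mono hle (H.energyDensity_cutoff_le k hη h01),
        ae_restrict_mem (hTm.inter hPm)] with x hx hxP using hx hxP.2
    have hgm : Measurable fun x => ‖gradient η x‖ₑ ^ q * ‖w x‖ₑ ^ q :=
      ((measurable_gradient η).enorm.pow_const q).mul (hwm.enorm.pow_const q)
    refine (lintegral_mono_ae hae).trans ?_
    rw [lintegral_add_left', lintegral_add_right _ (hgm.const_mul _), lintegral_const_mul _ hgm,
      lintegral_const_mul' _ _ (by simp)]
    · refine add_le_add_left (add_le_add_right (mul_le_mul_right ?_ _) _) _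
      exact setLIntegral_le_lintegral _ _
    · refine AEMeasurable.add (AEMeasurable.mul ?_ ?_) (hgm.const_mul _).aemeasurable
      · exact (continuous_const.sub hK'.continuous).measurable.ennreal_ofReal.aemeasurable
      · exact (H.aemeasurable_energyDensity H.measurable_grad.aestronglyMeasurable).mono_measure hle
  · refine setLIntegral_congr_fun (hTm.diff hPm) fun x hx => ?_
    have h1 : P.indicator du x = 0 := indicator_of_notMem hx.2 _
    have h3 : ¬ k < u x := hx.2
    have h2 : w x = 0 := max_eq_right (by linarith)
    simp only [energyDensity, hdφ, h1, h2, smul_zero, zero_smul, add_zero]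

end IsGrowthMinimizer
end energy

section holeFilling
open Filter
variable {n d : ℕ}

theorem ENNReal.rpow_le_one_add_rpow (y : ℝ≥0∞) {m p : ℝ} (hm : 0 ≤ m) (hmp : m ≤ p) :
    y ^ m ≤ 1 + y ^ p := by
  rcases le_total y 1 with h | h
  · exact (ENNReal.rpow_le_one h hm).trans le_self_add
  · exact (ENNReal.rpow_le_rpow_of_exponent_le h hmp).trans le_add_self

theorem LipschitzWith.mul_one_sub {θ ψ : Eu n → ℝ} {K K' : ℝ≥0} (hθ : LipschitzWith K θ)
    (hψ : LipschitzWith K' ψ) (hθ01 : ∀ x, 0 ≤ θ x ∧ θ x ≤ 1) (hψ01 : ∀ x, 0 ≤ ψ x ∧ ψ x ≤ 1) :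
    LipschitzWith (K + K') fun x => θ x * (1 - ψ x) := by
  refine LipschitzWith.of_dist_le_mul fun x y => ?_
  have h1 := hθ.dist_le_mul x y
  have h2 := hψ.dist_le_mul x y
  rw [Real.dist_eq] at h1 h2 ⊢
  have e : θ x * (1 - ψ x) - θ y * (1 - ψ y) =
      (θ x - θ y) * (1 - ψ x) + θ y * -(ψ x - ψ y) := by ring
  rw [e]
  refine (abs_add_le _ _).trans ?_
  rw [abs_mul, abs_mul, abs_neg, abs_of_nonneg (hθ01 y).1,
    abs_of_nonneg (show 0 ≤ 1 - ψ x by linarith [(hψ01 x).2]), NNReal.coe_add]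
  have h3 : |θ x - θ y| * (1 - ψ x) ≤ |θ x - θ y| * 1 :=
    mul_le_mul_of_nonneg_left (by linarith [(hψ01 x).1]) (abs_nonneg _)
  have h4 : θ y * |ψ x - ψ y| ≤ 1 * |ψ x - ψ y| :=
    mul_le_mul_of_nonneg_right (hθ01 y).2 (abs_nonneg _)
  linarith

theorem enorm_gradient_mul_one_sub_le {θ ψ : Eu n → ℝ} {x : Eu n} (hθ : DifferentiableAt ℝ θ x)
    (hψ : DifferentiableAt ℝ ψ x) (hθ01 : 0 ≤ θ x ∧ θ x ≤ 1) (hψ01 : 0 ≤ ψ x ∧ ψ x ≤ 1) :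
    ‖gradient (fun x => θ x * (1 - ψ x)) x‖ₑ ≤ ‖gradient θ x‖ₑ + ‖gradient ψ x‖ₑ := by
  have h : fderiv ℝ (fun x => θ x * (1 - ψ x)) x =
      θ x • -fderiv ℝ ψ x + (1 - ψ x) • fderiv ℝ θ x :=
    (hθ.hasFDerivAt.mul (hψ.hasFDerivAt.const_sub 1)).fderiv
  have h2 : ‖gradient (fun x => θ x * (1 - ψ x)) x‖ ≤ ‖gradient θ x‖ + ‖gradient ψ x‖ := by
    rw [norm_gradient, norm_gradient, norm_gradient, h]
    refine (norm_add_le _ _).trans ?_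
    rw [norm_smul, norm_smul, norm_neg, Real.norm_of_nonneg hθ01.1,
      Real.norm_of_nonneg (by linarith [hψ01.2] : (0 : ℝ) ≤ 1 - ψ x)]
    have h3 : θ x * ‖fderiv ℝ ψ x‖ ≤ 1 * ‖fderiv ℝ ψ x‖ :=
      mul_le_mul_of_nonneg_right hθ01.2 (norm_nonneg _)
    have h4 : (1 - ψ x) * ‖fderiv ℝ θ x‖ ≤ 1 * ‖fderiv ℝ θ x‖ :=
      mul_le_mul_of_nonneg_right (by linarith [hψ01.1]) (norm_nonneg _)
    linarith
  rw [← ofReal_norm, ← ofReal_norm, ← ofReal_norm, ← ENNReal.ofReal_add (norm_nonneg _)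
    (norm_nonneg _)]
  exact ENNReal.ofReal_le_ofReal h2

theorem lintegral_gradient_mul_one_sub_le {θ ψ w : Eu n → ℝ} {K K' : ℝ≥0}
    (hθ : LipschitzWith K θ) (hψ : LipschitzWith K' ψ) (hθ01 : ∀ x, 0 ≤ θ x ∧ θ x ≤ 1)
    (hψ01 : ∀ x, 0 ≤ ψ x ∧ ψ x ≤ 1) (hw : Measurable w) {q : ℝ} (hq : 1 ≤ q) :
    ∫⁻ x, ‖gradient (fun x => θ x * (1 - ψ x)) x‖ₑ ^ q * ‖w x‖ₑ ^ q ≤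
      2 ^ (q - 1) * ((∫⁻ x, ‖gradient θ x‖ₑ ^ q * ‖w x‖ₑ ^ q) +
        ∫⁻ x, ‖gradient ψ x‖ₑ ^ q * ‖w x‖ₑ ^ q) := by
  have hgm : ∀ Z : Eu n → ℝ, Measurable fun x => ‖gradient Z x‖ₑ ^ q * ‖w x‖ₑ ^ q := fun Z =>
    ((measurable_gradient Z).enorm.pow_const q).mul (hw.enorm.pow_const q)
  rw [← lintegral_add_left (hgm θ), ← lintegral_const_mul' _ _
    (ENNReal.rpow_ne_top_of_nonneg (by linarith) (by simp))]
  refine lintegral_mono_ae ?_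
  filter_upwards [hθ.ae_differentiableAt, hψ.ae_differentiableAt] with x h1 h2
  rw [← add_mul, ← mul_assoc]
  refine mul_le_mul_left ?_ _
  exact (ENNReal.rpow_le_rpow (enorm_gradient_mul_one_sub_le h1 h2 (hθ01 x) (hψ01 x))
    (by linarith)).trans (ENNReal.rpow_add_le_mul_rpow_add_rpow _ _ hq)

namespace IsGrowthMinimizer

variable {Ω : Set (Eu (d + 1))} {p q Q L : ℝ} {G : Eu (d + 1) → ℝ}
  {f : Eu (d + 1) → Eu (d + 1) → ℝ} {u : Eu (d + 1) → ℝ} {du : Eu (d + 1) → Eu (d + 1)}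

theorem isWeakGradOn_posPart (H : IsGrowthMinimizer (d + 1) Ω p q Q L G f u du) (k : ℝ) :
    IsWeakGradOn (d + 1) (ball 0 1) (fun x => max (u x - k) 0) ({x | k < u x}.indicator du) ∧
    IntegrableOn (fun x => max (u x - k) 0) (ball 0 1) ∧
    IntegrableOn ({x | k < u x}.indicator du) (ball 0 1) := by
  obtain ⟨hwg, hul, hdul, -⟩ := H.isQMinimizer
  have hBΩ : ball (0 : Eu (d + 1)) 1 ⊆ Ω := ball_subset_closedBall.trans H.closedBall_subset
  have hcpt := isCompact_closedBall (0 : Eu (d + 1)) 1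
  have hui : IntegrableOn u (ball 0 1) := ((locallyIntegrableOn_iff H.isOpen.isLocallyClosed).1 hul
    _ H.closedBall_subset hcpt).mono_set ball_subset_closedBall
  have hdui : IntegrableOn du (ball 0 1) := ((locallyIntegrableOn_iff
    H.isOpen.isLocallyClosed).1 hdul _ H.closedBall_subset hcpt).mono_set ball_subset_closedBall
  exact ⟨(hwg.posPart H.isOpen hul hdul k).mono hBΩ,
    (hui.sub (integrableOn_const measure_ball_lt_top.ne)).pos_part,
    hdui.indicator (measurableSet_lt measurable_const H.measurable)⟩

theorem lintegral_indicator_grad_ne_top (H : IsGrowthMinimizer (d + 1) Ω p q Q L G f u du) (k : ℝ)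
    {m : ℝ} (hm : 0 ≤ m) (hmp : m ≤ p) :
    ∫⁻ x in ball 0 1, ‖{x | k < u x}.indicator du x‖ₑ ^ m ≠ ∞ := by
  have hBΩ : ball (0 : Eu (d + 1)) 1 ⊆ Ω := ball_subset_closedBall.trans H.closedBall_subset
  refine ne_top_of_le_ne_top (ENNReal.add_ne_top.2 ⟨measure_ball_lt_top.ne,
    H.lintegral_ball_energyDensity_ne_top⟩) (b := volume (ball (0 : Eu (d + 1)) 1) + _) ?_
  rw [← setLIntegral_one, ← lintegral_add_left measurable_const]
  have := ae_mono (Measure.restrict_mono hBΩ le_rfl) (H.enorm_rpow_le_energyDensity du)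
  refine lintegral_mono_ae ?_
  filter_upwards [this] with x hx
  refine (ENNReal.rpow_le_one_add_rpow _ hm hmp).trans (add_le_add_right ?_ _)
  refine le_trans (ENNReal.rpow_le_rpow ?_ (by linarith)) hx
  by_cases hxP : x ∈ {x | k < u x}
  · rw [indicator_of_mem hxP]
  · rw [indicator_of_notMem hxP]; simp

theorem lintegral_hole_filling (H : IsGrowthMinimizer (d + 1) Ω p q Q L G f u du) (hd : 1 ≤ d)
    {m : ℝ} (hm : 1 ≤ m) (hmp : m ≤ p) (hpq : p ≤ q) (hmq : 1 / m = min (1 / q + 1 / d) 1)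
    (k : ℝ) {θ : Eu (d + 1) → ℝ} {K : ℝ≥0} (hθ : LipschitzWith K θ)
    (hθ01 : ∀ x, 0 ≤ θ x ∧ θ x ≤ 1) {s t : ℝ} (hs : s < 1) (ht : t < 1)
    (hθ1 : ∀ x, ‖x‖ ≤ s → θ x = 1) (hθ0 : ∀ x, t ≤ ‖x‖ → θ x = 0) :
    ∫⁻ x in closedBall 0 s ∩ {x | k < u x}, energyDensity f G du x ≤ ENNReal.ofReal Q *
      ((∫⁻ x in (closedBall 0 t ∩ {x | k < u x}) \ closedBall 0 s, energyDensity f G du x) +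
      ENNReal.ofReal (L * q ^ q) * 2 ^ (q - 1) *
        (∫⁻ x, ‖gradient θ x‖ₑ ^ q * ‖max (u x - k) 0‖ₑ ^ q) +
      2 * ∫⁻ x in closedBall 0 t ∩ {x | k < u x}, ENNReal.ofReal (G x)) := by
  have hq := H.one_lt_exponent
  set P : Set (Eu (d + 1)) := {x | k < u x} with hP
  have hPm : MeasurableSet P := measurableSet_lt measurable_const H.measurable
  set w : Eu (d + 1) → ℝ := fun x => max (u x - k) 0 with hw
  have hwm : Measurable w := (H.measurable.sub_const k).max measurable_const
  have hBΩ : ball (0 : Eu (d + 1)) 1 ⊆ Ω := ball_subset_closedBall.trans H.closedBall_subset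
  obtain ⟨hWG, hwi, hdwi⟩ := H.isWeakGradOn_posPart k
  have hwP : ∀ x, w x = 0 ↔ x ∉ P := fun x => by
    simp only [hw, hP, Set.mem_ofPred_eq, max_eq_right_iff, not_lt, sub_nonpos]
  have hfin := H.lintegral_indicator_grad_ne_top k (by linarith) hmp
  have h0 : ∀ x, w x = 0 → P.indicator du x = 0 := fun x hx =>
    indicator_of_notMem ((hwP x).1 hx) _
  set a := energyDensity f G du with ha
  have ham : AEMeasurable a (volume.restrict (ball 0 1)) :=
    (H.aemeasurable_energyDensity H.measurable_grad.aestronglyMeasurable).mono_measure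
      (Measure.restrict_mono hBΩ le_rfl)
  have hfa : ∫⁻ x, (ball 0 1).indicator a x ≠ ∞ := by
    rw [lintegral_indicator measurableSet_ball]; exact H.lintegral_ball_energyDensity_ne_top
  set c : ℝ≥0∞ := ENNReal.ofReal (L * q ^ q) with hc
  set X := ∫⁻ x, ‖gradient θ x‖ₑ ^ q * ‖w x‖ₑ ^ q with hX
  set M : ℝ≥0∞ := 2 * ENNReal.ofReal Q + ENNReal.ofReal Q * (c * 2 ^ (q - 1)) + 1 with hM
  have hM0 : M ≠ 0 := by simp [hM]
  have hMt : M ≠ ∞ := by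
    have : (2 : ℝ≥0∞) ^ (q - 1) ≠ ∞ := ENNReal.rpow_ne_top_of_nonneg (by linarith) (by simp)
    simp only [hM, hc]
    finiteness
  refine ENNReal.le_of_forall_pos_le_add fun ε hε _ => ?_
  set κ : ℝ≥0∞ := ε / M with hκ
  have hκ0 : κ ≠ 0 := (ENNReal.div_pos (by simpa using hε.ne') hMt).ne'
  obtain ⟨δ, hδ, hδa⟩ := exists_pos_setLIntegral_lt_of_measure_lt hfa hκ0
  obtain ⟨ε₀, hε₀, hε₀'⟩ := ENNReal.lt_iff_exists_nnreal_btwn.1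
    (lt_min hδ (pos_iff_ne_zero.2 hκ0))
  obtain ⟨ψ, U, hU, ⟨K', hψ⟩, hψ01, hψU, hsm1, hsm2, hsm3⟩ := exists_hole_cutoff hd hq hm
    (hmp.trans hpq) hmq hWG hwi hdwi hfin h0 (ε := ε₀) (by simpa using hε₀)
  have small : ∀ A : Set (Eu (d + 1)), A ⊆ ball 0 1 → volume A ≤ ε₀ → ∫⁻ x in A, a x ≤ κ := by
    intro A hA hAv
    have hlt := hδa A (hAv.trans_lt (hε₀'.trans_le (min_le_left _ _)))
    rw [lintegral_indicator measurableSet_ball, Measure.restrict_restrict measurableSet_ball,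
      inter_eq_self_of_subset_right hA] at hlt
    exact hlt.le
  set N : Set (Eu (d + 1)) := ball 0 1 ∩ {x | w x ≠ 0 ∧ ψ x ≠ 0} with hN
  have hNκ : ∫⁻ x in N, a x ≤ κ := small N inter_subset_left hsm2
  have hcs : closedBall (0 : Eu (d + 1)) s ⊆ ball 0 1 := closedBall_subset_ball hs
  have hct : closedBall (0 : Eu (d + 1)) t ⊆ ball 0 1 := closedBall_subset_ball ht
  obtain ⟨T, hTC, hTm, hT, hmain⟩ := H.lintegral_cutoff_le k (hθ.mul_one_sub hψ hθ01 hψ01)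
    (fun x => ⟨mul_nonneg (hθ01 x).1 (by linarith [(hψ01 x).2]), mul_le_one₀ (hθ01 x).2
      (by linarith [(hψ01 x).2]) (by linarith [(hψ01 x).1])⟩)
    (C := closedBall 0 t ∩ Uᶜ) (isClosed_closedBall.inter hU.isClosed_compl)
    (inter_subset_left.trans (hct.trans ball_subset_closedBall)) (fun x hx => by
      by_cases hxU : x ∈ U
      · simp [hψU x hxU]
      · have : t < ‖x‖ := by
          by_contra hxt
          exact hx ⟨mem_closedBall_zero_iff.2 (not_lt.1 hxt), hxU⟩
        simp [hθ0 x this.le])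
  have hTB : T ⊆ ball 0 1 := hTC.trans (inter_subset_left.trans hct)
  have i1 : ∫⁻ x in closedBall 0 s ∩ P, a x ≤ (∫⁻ x in T, a x) + ∫⁻ x in N, a x := by
    refine (lintegral_mono_set fun x hx => ?_).trans (lintegral_union_le a T N)
    by_cases hψx : ψ x = 0
    · refine Or.inl (hT x hx.2 ?_)
      rw [hθ1 x (mem_closedBall_zero_iff.1 hx.1), hψx]; norm_num
    · exact Or.inr ⟨hcs hx.1, fun h => (hwP x).1 h hx.2, hψx⟩
  have i2 : ∫⁻ x in T ∩ P, ENNReal.ofReal (1 - (θ x * (1 - ψ x)) ^ q) * a x ≤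
      (∫⁻ x in (closedBall 0 t ∩ P) \ closedBall 0 s, a x) + κ := by
    have hR : MeasurableSet ((closedBall 0 t ∩ P) \ closedBall (0 : Eu (d + 1)) s) :=
      (measurableSet_closedBall.inter hPm).diff measurableSet_closedBall
    have hNm : MeasurableSet N := measurableSet_ball.inter
      ((measurableSet_eq_fun hwm measurable_const).compl.inter
        (measurableSet_eq_fun hψ.continuous.measurable measurable_const).compl)
    refine le_trans ?_ ((lintegral_union_le a ((closedBall 0 t ∩ P) \ closedBall 0 s) N).trans
      (add_le_add_right hNκ _))
    rw [← lintegral_indicator (hTm.inter hPm), ← lintegral_indicator (hR.union hNm)]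
    refine lintegral_mono fun x => ?_
    by_cases hx : x ∈ T ∩ P
    · rw [indicator_of_mem hx]
      by_cases hx2 : x ∈ (closedBall 0 t ∩ P) \ closedBall 0 s ∪ N
      · rw [indicator_of_mem hx2]
        have h1 : 0 ≤ (θ x * (1 - ψ x)) ^ q :=
          Real.rpow_nonneg (mul_nonneg (hθ01 x).1 (by linarith [(hψ01 x).2])) _
        have : ENNReal.ofReal (1 - (θ x * (1 - ψ x)) ^ q) ≤ 1 := by
          rw [ENNReal.ofReal_le_one]; linarith
        simpa using mul_le_mul_left this (a x)
      · have h2 : ‖x‖ ≤ s := by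
          by_contra hxs
          exact hx2 (Or.inl ⟨⟨(hTC hx.1).1, hx.2⟩, fun h => hxs (mem_closedBall_zero_iff.1 h)⟩)
        have h3 : ψ x = 0 := by
          by_contra hxψ
          exact hx2 (Or.inr ⟨hTB hx.1, fun h => (hwP x).1 h hx.2, hxψ⟩)
        simp [hθ1 x h2, h3]
    · rw [indicator_of_notMem hx]; exact zero_le
  have i3 : ∫⁻ x in T \ P, a x ≤ κ := by
    refine (lintegral_mono_set (t := (ball 0 1 ∩ {x | w x = 0}) \ U) fun x hx => ?_).trans
      (small _ (sdiff_subset.trans inter_subset_left) hsm1)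
    exact ⟨⟨hTB hx.1, (hwP x).2 hx.2⟩, (hTC hx.1).2⟩
  have i4 := lintegral_gradient_mul_one_sub_le hθ hψ hθ01 hψ01 hwm hq.le
  have i5 : ∫⁻ x in T ∩ P, ENNReal.ofReal (G x) ≤
      ∫⁻ x in closedBall 0 t ∩ P, ENNReal.ofReal (G x) :=
    lintegral_mono_set fun x hx => ⟨(hTC hx.1).1, hx.2⟩
  have hε₀κ : (ε₀ : ℝ≥0∞) ≤ κ := (hε₀'.trans_le (min_le_right _ _)).le
  have hκM : κ * M = ε := ENNReal.div_mul_cancel hM0 hMt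
  calc ∫⁻ x in closedBall 0 s ∩ P, a x ≤ (∫⁻ x in T, a x) + ∫⁻ x in N, a x := i1
    _ ≤ ENNReal.ofReal Q *
        (((∫⁻ x in (closedBall 0 t ∩ P) \ closedBall 0 s, a x) + κ) +
          c * (2 ^ (q - 1) * (X + κ)) +
          2 * (∫⁻ x in closedBall 0 t ∩ P, ENNReal.ofReal (G x)) + κ) + κ := by
      refine add_le_add (hmain.trans ?_) hNκ
      gcongr
      exact i4.trans (by gcongr; exact hsm3.trans hε₀κ)
    _ = _ := by
      rw [← hκM, hM]
      ring

end IsGrowthMinimizer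
end holeFilling

section caccioppoli
open Filter
variable {n d : ℕ}

theorem exists_caccioppoli_const (hd : 1 ≤ d) {p q m Q : ℝ} (hq : 1 < q) (hm : 1 ≤ m)
    (hmp : m ≤ p) (hpq : p ≤ q) (hmq : 1 / m = min (1 / q + 1 / d) 1) (hQ : 1 ≤ Q) :
    ∃ C : ℝ, 1 ≤ C ∧ ∀ (Ω : Set (Eu (d + 1))) (L : ℝ) (G : Eu (d + 1) → ℝ)
      (f : Eu (d + 1) → Eu (d + 1) → ℝ) (u : Eu (d + 1) → ℝ) (du : Eu (d + 1) → Eu (d + 1)),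
      IsGrowthMinimizer (d + 1) Ω p q Q L G f u du → ∀ k ρ σ A B : ℝ, 1 / 2 ≤ ρ → ρ < σ → σ < 1 →
      0 ≤ A → 0 ≤ B →
      ((∫⁻ x in ball 0 σ, ‖max (u x - k) 0‖ₑ ^ m) +
        ∫⁻ x in ball 0 σ, ‖{x | k < u x}.indicator du x‖ₑ ^ m) ≤ ENNReal.ofReal A →
      ∫⁻ x in ball 0 σ ∩ {x | k < u x}, ENNReal.ofReal (G x) ≤ ENNReal.ofReal B →
      ∫⁻ x in closedBall 0 ρ ∩ {x | k < u x}, energyDensity f G du x ≤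
        ENNReal.ofReal (C * (L * A ^ (q / m) * (σ - ρ) ^ (-(q - 1 + q / m)) + B)) := by
  have hq0 : 0 < q := by linarith
  have hm0 : 0 < m := by linarith
  obtain ⟨C₁, hC₁⟩ := exists_shell_cutoff hd hq hm (hmp.trans hpq) hmq
  have hγ : 0 < q - 1 + q / m := by
    have := div_pos hq0 hm0
    linarith
  set γ := q - 1 + q / m with hγd
  obtain ⟨C₂, hC₂, hit⟩ := exists_iteration_const (θ := Q / (1 + Q)) (γ := γ) (by positivity)
    (by rw [div_lt_one (by linarith)]; linarith) hγ
  set D : ℝ := q ^ q * 2 ^ (q - 1) * C₁ with hD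
  have hD0 : 0 ≤ D := by positivity
  refine ⟨C₂ * (D + 2), by nlinarith, fun Ω L G f u du H k ρ σ A B hρ hρσ hσ hA hB hAle hBle => ?_⟩
  have hL := H.const_nonneg
  set P : Set (Eu (d + 1)) := {x | k < u x} with hP
  have hPm : MeasurableSet P := measurableSet_lt measurable_const H.measurable
  obtain ⟨hWG, hwi, hdwi⟩ := H.isWeakGradOn_posPart k
  have hσ1 : ball (0 : Eu (d + 1)) σ ⊆ ball 0 1 := ball_subset_ball hσ.le
  set a := energyDensity f G du with ha
  set I : ℝ → ℝ≥0∞ := fun r => ∫⁻ x in closedBall 0 r ∩ P, a x with hI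
  have hIfin : ∀ r < 1, I r ≤ ∫⁻ x in ball 0 1, a x := fun r hr =>
    lintegral_mono_set (inter_subset_left.trans (closedBall_subset_ball hr))
  have hItop : ∀ r < 1, I r ≠ ∞ := fun r hr =>
    ne_top_of_le_ne_top H.lintegral_ball_energyDensity_ne_top (hIfin r hr)
  set Am := A ^ (q / m) with hAm
  have hAm0 : 0 ≤ Am := by positivity
  have hstep : ∀ s t, ρ ≤ s → s < t → t < σ → (I s).toReal ≤
      Q / (1 + Q) * (I t).toReal + (D * L * Am) * (t - s) ^ (-γ) + 2 * B := by
    intro s t hs hst ht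
    have hst0 : 0 < t - s := by linarith
    obtain ⟨θ, ⟨K, hθ⟩, hθ01, hθ1, hθ0, hX⟩ := hC₁ s t σ (by linarith) hst (by linarith) ht _ _
      (hWG.mono hσ1) (hwi.mono_set hσ1) (hdwi.mono_set hσ1)
      (ne_top_of_le_ne_top ENNReal.ofReal_ne_top (le_self_add.trans hAle))
      (ne_top_of_le_ne_top ENNReal.ofReal_ne_top (le_add_self.trans hAle))
    have hhf := H.lintegral_hole_filling hd hm hmp hpq hmq k hθ hθ01 (by linarith)
      (by linarith : t < 1) hθ1 hθ0
    have hring : I t = I s + ∫⁻ x in (closedBall 0 t ∩ P) \ closedBall 0 s, a x := by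
      rw [hI]
      dsimp only
      rw [← lintegral_inter_add_sdiff a (closedBall 0 t ∩ P)
        (measurableSet_closedBall (x := (0 : Eu (d + 1))) (ε := s))]
      congr 3
      ext x
      simp only [Set.mem_inter_iff, mem_closedBall]
      constructor
      · rintro ⟨⟨_, h2⟩, h3⟩; exact ⟨h3, h2⟩
      · rintro ⟨h1, h2⟩; exact ⟨⟨h1.trans hst.le, h2⟩, h1⟩
    set S := ∫⁻ x in (closedBall 0 t ∩ P) \ closedBall 0 s, a x with hS
    have hSt : S ≠ ∞ := ne_top_of_le_ne_top (hItop t (by linarith)) (hring ▸ le_add_self)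
    have hY : ENNReal.ofReal (L * q ^ q) * 2 ^ (q - 1) *
        (∫⁻ x, ‖gradient θ x‖ₑ ^ q * ‖max (u x - k) 0‖ₑ ^ q) +
        2 * (∫⁻ x in closedBall 0 t ∩ P, ENNReal.ofReal (G x)) ≤
        ENNReal.ofReal (D * L * Am * (t - s) ^ (-γ) + 2 * B) := by
      have e2 : (2 : ℝ≥0∞) ^ (q - 1) = ENNReal.ofReal (2 ^ (q - 1)) := by
        rw [← ENNReal.ofReal_rpow_of_pos (by norm_num), ENNReal.ofReal_ofNat]
      have e3 : (C₁ : ℝ≥0∞) = ENNReal.ofReal C₁ := by simp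
      have e4 : (2 : ℝ≥0∞) = ENNReal.ofReal 2 := by simp
      rw [ENNReal.ofReal_add (by positivity) (by positivity)]
      refine add_le_add ?_ ?_
      · calc _ ≤ ENNReal.ofReal (L * q ^ q) * 2 ^ (q - 1) * (C₁ * ENNReal.ofReal ((t - s) ^ (-γ)) *
              ENNReal.ofReal Am) := by
              refine mul_le_mul_right (hX.trans (mul_le_mul_right ?_ _)) _
              rw [hAm, ← ENNReal.ofReal_rpow_of_nonneg hA (by positivity)]
              exact ENNReal.rpow_le_rpow hAle (by positivity)
          _ = _ := by
              rw [e2, e3, ← ENNReal.ofReal_mul (by positivity), ← ENNReal.ofReal_mul (by positivity),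
                ← ENNReal.ofReal_mul (by positivity), ← ENNReal.ofReal_mul (by positivity), hD]
              congr 1; ring
      · rw [ENNReal.ofReal_mul (by norm_num), ← e4]
        refine mul_le_mul_right (le_trans (lintegral_mono_set ?_) hBle) _
        exact inter_subset_inter_left _ (closedBall_subset_ball ht)
    have hfin : I s ≤ ENNReal.ofReal
        (Q * (S.toReal + (D * L * Am * (t - s) ^ (-γ) + 2 * B))) := by
      rw [ENNReal.ofReal_mul (by linarith), ENNReal.ofReal_add (by positivity) (by positivity),
        ENNReal.ofReal_toReal hSt]
      refine hhf.trans (mul_le_mul_right ?_ _)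
      rw [add_assoc]
      exact add_le_add_right hY _
    have hr := ENNReal.toReal_le_of_le_ofReal (by positivity) hfin
    have hring' : (I t).toReal = (I s).toReal + S.toReal := by
      rw [hring, ENNReal.toReal_add (hItop s (by linarith)) hSt]
    have hY0 : 0 ≤ D * L * Am * (t - s) ^ (-γ) + 2 * B := by positivity
    set Y := D * L * Am * (t - s) ^ (-γ) + 2 * B with hYd
    have h1 : Q / (1 + Q) * (I t).toReal + D * L * Am * (t - s) ^ (-γ) + 2 * B =
        (Q * (I t).toReal + (1 + Q) * Y) / (1 + Q) := by
      rw [hYd]; field_simp; ring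
    rw [h1, le_div_iff₀ (by linarith)]
    nlinarith
  have hres := hit (fun r => (I r).toReal) (∫⁻ x in ball 0 1, a x).toReal (D * L * Am) (2 * B) ρ σ
    hρσ (by positivity) (by positivity)
    (fun s _ hs => ENNReal.toReal_mono H.lintegral_ball_energyDensity_ne_top
      (hIfin s (by linarith))) hstep
  have hρ1 := hItop ρ (by linarith)
  change I ρ ≤ _
  rw [← ENNReal.ofReal_toReal hρ1]
  refine ENNReal.ofReal_le_ofReal (hres.trans ?_)
  have hx : 0 ≤ L * Am * (σ - ρ) ^ (-γ) := by
    have : 0 < σ - ρ := by linarith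
    positivity
  rw [mul_assoc C₂]
  refine mul_le_mul_of_nonneg_left ?_ (by linarith)
  nlinarith [mul_nonneg hD0 hB]

end caccioppoli

section levelSets
open Filter
variable {n d : ℕ}

theorem lintegral_Ioi_rpow_shift {b l : ℝ} (hb : b < -1) (hl : 0 < l) :
    ∫⁻ t in Ioi (0 : ℝ), ENNReal.ofReal ((t + l) ^ b) =
      ENNReal.ofReal (l ^ (b + 1) / -(b + 1)) := by
  have h1 : ∫⁻ t in Ioi (0 : ℝ), ENNReal.ofReal ((t + l) ^ b) =
      ∫⁻ t in Ioi l, ENNReal.ofReal (t ^ b) := by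
    rw [← lintegral_indicator measurableSet_Ioi, ← lintegral_indicator measurableSet_Ioi,
      ← lintegral_add_right_eq_self ((Ioi l).indicator _) l]
    refine lintegral_congr fun t => ?_
    simp [indicator_apply]
  rw [h1, ← ofReal_integral_eq_lintegral_ofReal (integrableOn_Ioi_rpow_of_lt hb hl),
    integral_Ioi_rpow_of_lt hb hl]
  · congr 1
    rw [neg_div, div_neg]
  · filter_upwards [ae_restrict_mem measurableSet_Ioi] with t ht
    exact Real.rpow_nonneg (hl.le.trans (le_of_lt ht)) _

/-- A function of weak type `r` has truncations above positive levels in `L^p`, for `p < r`. -/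
theorem lintegral_rpow_posPart_sub_le {α : Type*} [MeasurableSpace α] (μ : Measure α)
    {v : α → ℝ} (hv : Measurable v) {p r l K : ℝ} (hp : 1 ≤ p) (hr : p < r) (hl : 0 < l)
    (hK : 0 ≤ K) (h : ∀ t, 0 < t → μ {x | t < v x} ≤ ENNReal.ofReal (K * t ^ (-r))) :
    ∫⁻ x, ENNReal.ofReal (max (v x - l) 0 ^ p) ∂μ ≤
      ENNReal.ofReal (p / (r - p) * K * l ^ (p - r)) := by
  rw [lintegral_rpow_eq_lintegral_meas_lt_mul μ (f := fun x => max (v x - l) 0) (Eventually.of_forall fun x => le_max_right _ _)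
    ((hv.sub_const l).max measurable_const).aemeasurable (by linarith)]
  have h1 : ∫⁻ t in Ioi (0 : ℝ), μ {x | t < max (v x - l) 0} * ENNReal.ofReal (t ^ (p - 1)) ≤
      ∫⁻ t in Ioi (0 : ℝ), ENNReal.ofReal K * ENNReal.ofReal ((t + l) ^ (p - 1 - r)) := by
    refine setLIntegral_mono' measurableSet_Ioi fun t ht => ?_
    have ht0 : (0 : ℝ) < t := ht
    have h2 : μ {x | t < max (v x - l) 0} ≤ ENNReal.ofReal (K * (t + l) ^ (-r)) := by
      refine (measure_mono fun x hx => ?_).trans (h (t + l) (by linarith))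
      rcases lt_max_iff.1 (show t < max (v x - l) 0 from hx) with h3 | h3
      · show t + l < v x; linarith
      · linarith
    calc _ ≤ ENNReal.ofReal (K * (t + l) ^ (-r)) * ENNReal.ofReal ((t + l) ^ (p - 1)) := by
          refine mul_le_mul' h2 (ENNReal.ofReal_le_ofReal ?_)
          exact Real.rpow_le_rpow ht0.le (by linarith) (by linarith)
      _ = _ := by
          rw [← ENNReal.ofReal_mul (by positivity), ← ENNReal.ofReal_mul hK, mul_assoc,
            ← Real.rpow_add (by linarith)]
          congr 3; ring
  refine (mul_le_mul_right h1 _).trans ?_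
  rw [lintegral_const_mul' _ _ (by simp), lintegral_Ioi_rpow_shift (by linarith) hl,
    ← ENNReal.ofReal_mul hK, ← ENNReal.ofReal_mul (by linarith)]
  refine ENNReal.ofReal_le_ofReal (le_of_eq ?_)
  have e1 : p - 1 - r + 1 = p - r := by ring
  rw [e1, neg_sub]; ring

/-- Hölder's inequality for a function that vanishes outside a set of small measure. -/
theorem lintegral_enorm_rpow_le_of_support {F : Type*} [NormedAddCommGroup F] {V P : Set (Eu n)}
    {w : Eu n → F} (hP : MeasurableSet P)
    (hw : AEMeasurable (fun x => ‖w x‖ₑ) (volume.restrict V)) (hw0 : ∀ x ∉ P, w x = 0) {m p T J : ℝ}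
    (hm : 0 < m) (hmp : m ≤ p) (hT0 : 0 ≤ T) (hJ0 : 0 ≤ J)
    (hT : volume (V ∩ P) ≤ ENNReal.ofReal T)
    (hJ : ∫⁻ x in V, ‖w x‖ₑ ^ p ≤ ENNReal.ofReal J) :
    ∫⁻ x in V, ‖w x‖ₑ ^ m ≤ ENNReal.ofReal ((T ^ (p / m - 1) * J) ^ (m / p)) := by
  have hp : 0 < p := by linarith
  have h1 : 1 ≤ p / m := by rwa [le_div_iff₀ hm, one_mul]
  have hrestr : ∫⁻ x in V, ‖w x‖ₑ ^ m = ∫⁻ x in V ∩ P, ‖w x‖ₑ ^ m := by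
    rw [inter_comm, ← Measure.restrict_restrict hP, ← lintegral_indicator hP]
    refine lintegral_congr fun x => ?_
    by_cases hx : x ∈ P
    · rw [indicator_of_mem hx]
    · rw [indicator_of_notMem hx, hw0 x hx]; simp [hm]
  have h2 := lintegral_rpow_le_measure_rpow_mul (volume.restrict (V ∩ P))
    ((hw.mono_measure (Measure.restrict_mono inter_subset_left le_rfl)).pow_const m) h1
  rw [← hrestr, Measure.restrict_apply_univ] at h2
  have h3 : ∫⁻ x in V ∩ P, (‖w x‖ₑ ^ m) ^ (p / m) ≤ ENNReal.ofReal J := by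
    refine le_trans (le_of_eq (lintegral_congr fun x => ?_))
      ((lintegral_mono_set inter_subset_left).trans hJ)
    rw [← ENNReal.rpow_mul, mul_div_cancel₀ _ hm.ne']
  have h4 : (∫⁻ x in V, ‖w x‖ₑ ^ m) ^ (p / m) ≤ ENNReal.ofReal (T ^ (p / m - 1) * J) := by
    rw [ENNReal.ofReal_mul (by positivity), ← ENNReal.ofReal_rpow_of_nonneg hT0 (by linarith)]
    exact h2.trans (mul_le_mul' (ENNReal.rpow_le_rpow hT (by linarith)) h3)
  have h5 := ENNReal.rpow_le_rpow h4 (show 0 ≤ m / p by positivity)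
  rwa [← ENNReal.rpow_mul, div_mul_div_cancel₀ hm.ne', div_self hp.ne', ENNReal.rpow_one,
    ENNReal.ofReal_rpow_of_nonneg (by positivity) (by positivity)] at h5

theorem jfun_nonneg (p : ℝ) (u : Eu n → ℝ) (du : Eu n → Eu n) (k r : ℝ) :
    0 ≤ Jfun n p u du k r :=
  add_nonneg (integral_nonneg fun _ => Real.rpow_nonneg (le_max_right _ _) _)
    (integral_nonneg fun _ => Real.rpow_nonneg (norm_nonneg _) _)

namespace IsGrowthMinimizer

variable {Ω : Set (Eu (d + 1))} {p q Q L : ℝ} {G : Eu (d + 1) → ℝ}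
  {f : Eu (d + 1) → Eu (d + 1) → ℝ} {u : Eu (d + 1) → ℝ} {du : Eu (d + 1) → Eu (d + 1)}

theorem ofReal_jfun (H : IsGrowthMinimizer (d + 1) Ω p q Q L G f u du) (k : ℝ) {r : ℝ}
    (hr : r < 1) : ENNReal.ofReal (Jfun (d + 1) p u du k r) =
      (∫⁻ x in ball 0 r, ‖max (u x - k) 0‖ₑ ^ p) +
        ∫⁻ x in ball 0 r, ‖{x | k < u x}.indicator du x‖ₑ ^ p := by
  have hp := H.one_le_exponent
  have hp0 : 0 < p := by linarith
  obtain ⟨hWG, hwi, hdwi⟩ := H.isWeakGradOn_posPart k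
  have hPm : MeasurableSet {x | k < u x} := measurableSet_lt measurable_const H.measurable
  have hdfin := H.lintegral_indicator_grad_ne_top k hp0.le le_rfl
  have hwfin := hWG.lintegral_rpow_lt_top hwi hdwi hp hdfin.lt_top hr
  have e1 : ∫⁻ x in ball 0 r, ‖max (u x - k) 0‖ₑ ^ p =
      ENNReal.ofReal (∫ x in ball (0 : Eu (d + 1)) r, max (u x - k) 0 ^ p) := by
    have hc : ∀ x, ‖max (u x - k) 0‖ₑ ^ p = ENNReal.ofReal (max (u x - k) 0 ^ p) := fun x => by
      rw [← ofReal_norm, Real.norm_of_nonneg (le_max_right _ _),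
        ENNReal.ofReal_rpow_of_nonneg (le_max_right _ _) hp0.le]
    simp_rw [hc] at hwfin ⊢
    rw [integral_eq_lintegral_of_nonneg_ae (Eventually.of_forall fun x =>
      Real.rpow_nonneg (le_max_right _ _) _) ((((H.measurable.sub_const k).max
      measurable_const).pow_const p).aestronglyMeasurable), ENNReal.ofReal_toReal hwfin.ne]
  have e2 : ∫⁻ x in ball 0 r, ‖{x | k < u x}.indicator du x‖ₑ ^ p =
      ENNReal.ofReal (∫ x in ball (0 : Eu (d + 1)) r ∩ {x | k < u x}, ‖du x‖ ^ p) := by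
    have hc : ∀ x, ‖{x | k < u x}.indicator du x‖ₑ ^ p =
        {x | k < u x}.indicator (fun x => ENNReal.ofReal (‖du x‖ ^ p)) x := fun x => by
      by_cases hx : x ∈ {x | k < u x}
      · rw [indicator_of_mem hx, indicator_of_mem hx, ← ofReal_norm,
          ENNReal.ofReal_rpow_of_nonneg (norm_nonneg _) hp0.le]
      · rw [indicator_of_notMem hx, indicator_of_notMem hx]; simp [hp0]
    have hfin : ∫⁻ x in ball 0 r, ‖{x | k < u x}.indicator du x‖ₑ ^ p ≠ ∞ :=
      ne_top_of_le_ne_top hdfin (lintegral_mono_set (ball_subset_ball hr.le))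
    simp_rw [hc] at hfin ⊢
    rw [lintegral_indicator hPm, Measure.restrict_restrict hPm, inter_comm] at hfin ⊢
    rw [integral_eq_lintegral_of_nonneg_ae (Eventually.of_forall fun x =>
      Real.rpow_nonneg (norm_nonneg _) _)
      ((H.measurable_grad.norm.pow_const p).aestronglyMeasurable), ENNReal.ofReal_toReal hfin]
  rw [e1, e2, ← ENNReal.ofReal_add (integral_nonneg fun x => Real.rpow_nonneg (le_max_right _ _) _)
    (integral_nonneg fun x => Real.rpow_nonneg (norm_nonneg _) _)]
  rfl

end IsGrowthMinimizer
end levelSets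

section oneStep
open Filter
variable {d : ℕ}

theorem exists_one_step_const (hd : 1 ≤ d) {p q m Q : ℝ} (hp : 1 ≤ p) (hpq : p < q)
    (hpn : p < ((d + 1 : ℕ) : ℝ)) (hm : 1 ≤ m) (hmp : m ≤ p)
    (hmq : 1 / m = min (1 / q + 1 / d) 1) (hQ : 1 ≤ Q) :
    ∃ c₁ c₂ : ℝ, 1 ≤ c₁ ∧ 1 ≤ c₂ ∧ ∀ (Ω : Set (Eu (d + 1))) (L : ℝ) (g : Eu (d + 1) → ℝ)
      (f : Eu (d + 1) → Eu (d + 1) → ℝ) (u : Eu (d + 1) → ℝ) (du : Eu (d + 1) → Eu (d + 1)),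
      IsGrowthMinimizer (d + 1) Ω p q Q L (fun x => g x ^ (p / (p - 1))) f u du →
      (∀ᵐ x ∂volume.restrict Ω, 0 ≤ g x) → AEMeasurable g (volume.restrict Ω) →
      ∀ h k ρ σ : ℝ, h < k → 1 / 2 ≤ ρ → ρ < σ → σ < 1 →
        Jfun (d + 1) p u du k ρ ≤ c₁ * (omegaFn (d + 1) p g
          (c₂ * Jfun (d + 1) p u du h σ ^
            ((p * (d + 1 : ℕ) / (((d + 1 : ℕ) : ℝ) - p)) / p) *
            (k - h) ^ (-(p * (d + 1 : ℕ) / (((d + 1 : ℕ) : ℝ) - p)))) +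
          L * (Jfun (d + 1) p u du h σ ^ (1 / p) / (k - h)) ^
            ((p * (d + 1 : ℕ) / (((d + 1 : ℕ) : ℝ) - p)) * q * (1 / m - 1 / p)) *
            Jfun (d + 1) p u du h σ ^ (q / p) * (σ - ρ) ^ (-(q - 1 + q / m)) +
          (Jfun (d + 1) p u du h σ ^ (1 / p) / (k - h)) ^
            ((p * (d + 1 : ℕ) / (((d + 1 : ℕ) : ℝ) - p)) * p / ((d + 1 : ℕ) : ℝ)) *
            Jfun (d + 1) p u du h σ) := by
  have hq : 1 < q := by linarith
  have hp0 : 0 < p := by linarith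
  have hm0 : 0 < m := by linarith
  obtain ⟨C, hC0, hC⟩ := weak_sobolev hp hpn
  obtain ⟨C', hC'1, hC'⟩ := exists_caccioppoli_const hd hq hm hmp hpq.le hmq hQ
  set N : ℝ := ((d + 1 : ℕ) : ℝ) with hN
  have hN0 : 0 < N := by linarith
  have hNp : 0 < N - p := by linarith
  set r : ℝ := p * N / (N - p) with hr
  have hrp : r - p = r * p / N := by
    rw [hr]; field_simp; ring
  have hr0 : 0 < r := by positivity
  have hrp0 : 0 < r - p := by rw [hrp]; positivity
  set c₂ : ℝ := max 1 C with hc₂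
  have hc₂1 : 1 ≤ c₂ := le_max_left _ _
  have hc₂0 : 0 < c₂ := by linarith
  set e : ℝ := q * (1 / m - 1 / p) with he
  have he0 : 0 ≤ 1 / m - 1 / p := sub_nonneg.2 (one_div_le_one_div_of_le hm0 hmp)
  set D₁ : ℝ := 2 ^ (q / m) * c₂ ^ e with hD₁
  have hD₁0 : 0 ≤ D₁ := by positivity
  set D₂ : ℝ := p / (r - p) * c₂ with hD₂
  have hD₂0 : 0 ≤ D₂ := by positivity
  refine ⟨C' * (1 + D₁) + D₂, c₂, by nlinarith, hc₂1,
    fun Ω L g f u du H hg0 hgm h k ρ σ hhk hρ hρσ hσ => ?_⟩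
  have hL := H.const_nonneg
  have hl : 0 < k - h := by linarith
  have hσρ : 0 < σ - ρ := by linarith
  set J : ℝ := Jfun (d + 1) p u du h σ with hJ
  have hJ0 : 0 ≤ J := jfun_nonneg _ _ _ _ _
  set a : ℝ := J ^ (1 / p) with ha
  have ha0 : 0 ≤ a := by positivity
  have hap : a ^ p = J := by rw [ha, ← Real.rpow_mul hJ0, one_div_mul_cancel hp0.ne', Real.rpow_one]
  set y : ℝ := a / (k - h) with hy
  have hy0 : 0 ≤ y := by positivity
  set T : ℝ := c₂ * J ^ (r / p) * (k - h) ^ (-r) with hT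
  have hTy : T = c₂ * y ^ r := by
    rw [hT, hy, Real.div_rpow ha0 hl.le, ha, ← Real.rpow_mul hJ0, Real.rpow_neg hl.le]
    rw [one_div_mul_eq_div]
    ring
  have hT0 : 0 ≤ T := by rw [hTy]; positivity
  have hB1 : ball (0 : Eu (d + 1)) σ ⊆ ball 0 1 := ball_subset_ball hσ.le
  have hBΩ : ball (0 : Eu (d + 1)) 1 ⊆ Ω := ball_subset_closedBall.trans H.closedBall_subset
  set P : Set (Eu (d + 1)) := {x | k < u x} with hP
  have hPm : MeasurableSet P := measurableSet_lt measurable_const H.measurable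
  -- level sets of the truncation at the lower level
  obtain ⟨hv, hvi, hdvi⟩ := H.isWeakGradOn_posPart h
  have hJh := H.ofReal_jfun h hσ
  rw [← hJ, ← hap] at hJh
  have hweak : ∀ t, 0 < t → volume (ball (0 : Eu (d + 1)) σ ∩ {x | t < max (u x - h) 0}) ≤
      ENNReal.ofReal (c₂ * (a / t) ^ r) := by
    intro t ht
    refine le_trans (measure_mono (inter_subset_inter_right _ fun x hx => ?_))
      ((hC σ (by linarith) hσ.le _ _ (hv.mono hB1) (hvi.mono_set hB1) (hdvi.mono_set hB1) a ha0
        (hJh ▸ le_self_add) (hJh ▸ le_add_self) t ht).trans (ENNReal.ofReal_le_ofReal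
        (mul_le_mul_of_nonneg_right (le_max_right _ _) (by positivity))))
    have hx' : t < max (u x - h) 0 := hx
    show ENNReal.ofReal t < ‖max (u x - h) 0‖ₑ
    rw [← ofReal_norm, Real.norm_of_nonneg (le_max_right _ _)]
    exact (ENNReal.ofReal_lt_ofReal_iff (ht.trans hx')).2 hx'
  have hPT : volume (ball (0 : Eu (d + 1)) σ ∩ P) ≤ ENNReal.ofReal T := by
    rw [hTy]
    refine (measure_mono (inter_subset_inter_right _ fun x hx => ?_)).trans (hweak _ hl)
    have hx' : k < u x := hx
    have hx2 : k - h < u x - h := by linarith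
    exact hx2.trans_le (le_max_left _ _)
  -- the truncation at the higher level
  have hpos_le : ∀ x, ‖max (u x - k) 0‖ₑ ≤ ‖max (u x - h) 0‖ₑ := fun x => by
    rw [← ofReal_norm, ← ofReal_norm, Real.norm_of_nonneg (le_max_right _ _),
      Real.norm_of_nonneg (le_max_right _ _)]
    exact ENNReal.ofReal_le_ofReal (max_le_max (by linarith) le_rfl)
  have hgrad_le : ∀ x, ‖P.indicator du x‖ₑ ≤ ‖{x | h < u x}.indicator du x‖ₑ := fun x => by
    by_cases hx : x ∈ P
    · rw [indicator_of_mem hx, indicator_of_mem (show x ∈ {x | h < u x} from hhk.trans hx)]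
    · rw [indicator_of_notMem hx]; simp
  have hwm : Measurable fun x => max (u x - k) 0 := (H.measurable.sub_const k).max measurable_const
  have hwJ : ∫⁻ x in ball 0 σ, ‖max (u x - k) 0‖ₑ ^ p ≤ ENNReal.ofReal J := by
    rw [← hap, hJh]
    exact (lintegral_mono fun x => ENNReal.rpow_le_rpow (hpos_le x) hp0.le).trans le_self_add
  have hdwJ : ∫⁻ x in ball 0 σ, ‖P.indicator du x‖ₑ ^ p ≤ ENNReal.ofReal J := by
    rw [← hap, hJh]
    exact (lintegral_mono fun x => ENNReal.rpow_le_rpow (hgrad_le x) hp0.le).trans le_add_self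
  set S : ℝ := (T ^ (p / m - 1) * J) ^ (m / p) with hS
  have hS0 : 0 ≤ S := by positivity
  have hw1 : ∫⁻ x in ball 0 σ, ‖max (u x - k) 0‖ₑ ^ m ≤ ENNReal.ofReal S :=
    lintegral_enorm_rpow_le_of_support hPm hwm.enorm.aemeasurable
      (fun x hx => max_eq_right (by
        have : ¬ k < u x := hx
        linarith)) hm0 hmp hT0 hJ0 hPT hwJ
  have hw2 : ∫⁻ x in ball 0 σ, ‖P.indicator du x‖ₑ ^ m ≤ ENNReal.ofReal S :=
    lintegral_enorm_rpow_le_of_support hPm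
      (H.measurable_grad.indicator hPm).enorm.aemeasurable
      (fun x hx => indicator_of_notMem hx _) hm0 hmp hT0 hJ0 hPT hdwJ
  -- the inhomogeneity
  set B : ℝ := ∫ x in ball (0 : Eu (d + 1)) σ ∩ P, g x ^ (p / (p - 1)) with hB
  have hGi : IntegrableOn (fun x => g x ^ (p / (p - 1))) (ball (0 : Eu (d + 1)) σ ∩ P) :=
    H.integrableOn.mono_set (inter_subset_left.trans (hB1.trans hBΩ))
  have hG0 : ∀ᵐ x ∂volume.restrict (ball (0 : Eu (d + 1)) σ ∩ P), 0 ≤ g x ^ (p / (p - 1)) :=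
    ae_mono (Measure.restrict_mono (inter_subset_left.trans (hB1.trans hBΩ)) le_rfl) H.nonneg
  have hB0 : 0 ≤ B := integral_nonneg_of_ae hG0
  have hBlint : ∫⁻ x in ball 0 σ ∩ P, ENNReal.ofReal (g x ^ (p / (p - 1))) = ENNReal.ofReal B :=
    (ofReal_integral_eq_lintegral_ofReal hGi hG0).symm
  have hBω : B ≤ omegaFn (d + 1) p g T :=
    setIntegral_le_omegaFn hp (ae_mono (Measure.restrict_mono hBΩ le_rfl) hg0)
      (hgm.mono_measure (Measure.restrict_mono hBΩ le_rfl)) (H.integrableOn.mono_set hBΩ)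
      (inter_subset_left.trans hB1) hPT
  have hcacc := hC' Ω L _ f u du H k ρ σ (2 * S) B hρ hρσ hσ (by positivity) hB0
    (by
      rw [ENNReal.ofReal_mul (by norm_num), ENNReal.ofReal_ofNat, two_mul]
      exact add_le_add hw1 hw2) hBlint.le
  -- the function itself
  have hwp : ∫⁻ x in ball 0 ρ, ‖max (u x - k) 0‖ₑ ^ p ≤
      ENNReal.ofReal (D₂ * (y ^ (r * p / N) * J)) := by
    have h1 := lintegral_rpow_posPart_sub_le (volume.restrict (ball (0 : Eu (d + 1)) σ))
      ((H.measurable.sub_const h).max measurable_const) hp (by linarith : p < r) hl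
      (K := c₂ * a ^ r) (by positivity) (fun t ht => by
        have hms : MeasurableSet {x | t < max (u x - h) 0} :=
          measurableSet_lt measurable_const ((H.measurable.sub_const h).max measurable_const)
        rw [Measure.restrict_apply hms, inter_comm]
        refine (hweak t ht).trans (le_of_eq ?_)
        rw [Real.div_rpow ha0 ht.le, Real.rpow_neg ht.le]
        congr 1; ring)
    have h2 : p / (r - p) * (c₂ * a ^ r) * (k - h) ^ (p - r) = D₂ * (y ^ (r * p / N) * J) := by
      have h3 : a ^ r = a ^ (r - p) * a ^ p := by
        rw [← Real.rpow_add_of_nonneg ha0 hrp0.le hp0.le]; congr 1; ring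
      have h4 : (k - h) ^ (p - r) = ((k - h) ^ (r - p))⁻¹ := by
        rw [← Real.rpow_neg hl.le, neg_sub]
      rw [← hrp, hy, Real.div_rpow ha0 hl.le, h3, h4, hap, hD₂]
      ring
    rw [← h2]
    refine le_trans ((lintegral_mono_set (ball_subset_ball hρσ.le)).trans
      (lintegral_mono fun x => ?_)) h1
    rw [← ofReal_norm, Real.norm_of_nonneg (le_max_right _ _),
      ENNReal.ofReal_rpow_of_nonneg (le_max_right _ _) hp0.le]
    refine ENNReal.ofReal_le_ofReal (Real.rpow_le_rpow (le_max_right _ _) ?_ hp0.le)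
    exact max_le_max (by linarith [le_max_left (u x - h) 0]) le_rfl
  -- the gradient
  have hdwp : ∫⁻ x in ball 0 ρ, ‖P.indicator du x‖ₑ ^ p ≤
      ∫⁻ x in closedBall 0 ρ ∩ P, energyDensity f (fun x => g x ^ (p / (p - 1))) du x := by
    have h1 : ∫⁻ x in ball 0 ρ, ‖P.indicator du x‖ₑ ^ p =
        ∫⁻ x in P ∩ ball 0 ρ, ‖du x‖ₑ ^ p := by
      rw [← Measure.restrict_restrict hPm, ← lintegral_indicator hPm]
      refine lintegral_congr fun x => ?_
      by_cases hx : x ∈ P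
      · rw [indicator_of_mem hx, indicator_of_mem hx]
      · rw [indicator_of_notMem hx, indicator_of_notMem hx]; simp [hp0]
    have hsub : closedBall (0 : Eu (d + 1)) ρ ∩ P ⊆ Ω :=
      inter_subset_left.trans ((closedBall_subset_closedBall (by linarith)).trans
        H.closedBall_subset)
    rw [h1, inter_comm]
    exact (lintegral_mono_set (inter_subset_inter_left _ ball_subset_closedBall)).trans
      (lintegral_mono_ae (ae_mono (Measure.restrict_mono hsub le_rfl)
        (H.enorm_rpow_le_energyDensity du)))
  have hSq : (2 * S) ^ (q / m) = D₁ * (y ^ (r * q * (1 / m - 1 / p)) * J ^ (q / p)) := by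
    have h1 : S ^ (q / m) = T ^ e * J ^ (q / p) := by
      rw [hS, ← Real.rpow_mul (by positivity), Real.mul_rpow (by positivity) hJ0,
        ← Real.rpow_mul hT0]
      congr 2
      · rw [he]; field_simp
      · field_simp
    rw [Real.mul_rpow (by norm_num) hS0, h1, hTy, Real.mul_rpow hc₂0.le (by positivity),
      ← Real.rpow_mul hy0, hD₁, he, mul_assoc r]
    ring
  set X₂ : ℝ := L * (y ^ (r * q * (1 / m - 1 / p)) * J ^ (q / p)) *
    (σ - ρ) ^ (-(q - 1 + q / m)) with hX₂
  have hX₂0 : 0 ≤ X₂ := by positivity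
  set X₃ : ℝ := y ^ (r * p / N) * J with hX₃
  have hX₃0 : 0 ≤ X₃ := by positivity
  have hmain : Jfun (d + 1) p u du k ρ ≤ D₂ * X₃ + C' * (D₁ * X₂ + B) := by
    rw [← ENNReal.ofReal_le_ofReal_iff (by positivity), H.ofReal_jfun k (by linarith),
      ENNReal.ofReal_add (by positivity) (by positivity)]
    refine add_le_add hwp (hdwp.trans (hcacc.trans (le_of_eq ?_)))
    rw [hSq, hX₂]
    congr 1; ring
  set W := omegaFn (d + 1) p g T with hW
  have hfin : D₂ * X₃ + C' * (D₁ * X₂ + B) ≤ (C' * (1 + D₁) + D₂) * (W + X₂ + X₃) := by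
    have hC'0 : 0 ≤ C' := by linarith
    have hW0 : 0 ≤ W := hB0.trans hBω
    have t1 : C' * B ≤ C' * W := mul_le_mul_of_nonneg_left hBω hC'0
    have t2 : 0 ≤ C' * D₁ * (W + X₃) := by positivity
    have t3 : 0 ≤ C' * (X₂ + X₃) := by positivity
    have t4 : 0 ≤ D₂ * (W + X₂) := by positivity
    linarith
  refine (hmain.trans hfin).trans (le_of_eq ?_)
  rw [hX₂]
  ring

end oneStep

section representatives
open Filter
variable {n : ℕ}

theorem IsWeakGradOn.congr {Ω : Set (Eu n)} {u u' : Eu n → ℝ} {du du' : Eu n → Eu n}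
    (h : IsWeakGradOn n Ω u du) (hu : u =ᵐ[volume.restrict Ω] u')
    (hdu : du =ᵐ[volume.restrict Ω] du') : IsWeakGradOn n Ω u' du' := by
  intro φ h1 h2 h3 i
  have e1 := h φ h1 h2 h3 i
  have e2 : ∫ x in Ω, u x * (fderiv ℝ φ x (EuclideanSpace.single i (1 : ℝ))) =
      ∫ x in Ω, u' x * (fderiv ℝ φ x (EuclideanSpace.single i (1 : ℝ))) :=
    integral_congr_ae (hu.mono fun x hx => by simp only [hx])
  have e3 : ∫ x in Ω, du x i * φ x = ∫ x in Ω, du' x i * φ x :=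
    integral_congr_ae (hdu.mono fun x hx => by simp only [hx])
  rw [← e2, e1, e3]

theorem IsQMinimizer.congr {Ω : Set (Eu n)} {f : Eu n → Eu n → ℝ} {Q : ℝ} {u u' : Eu n → ℝ}
    {du du' : Eu n → Eu n} (h : IsQMinimizer n Ω f Q u du) (hu : u =ᵐ[volume.restrict Ω] u')
    (hdu : du =ᵐ[volume.restrict Ω] du') : IsQMinimizer n Ω f Q u' du' := by
  obtain ⟨h1, h2, h3, h4⟩ := h
  refine ⟨h1.congr hu hdu, LocallyIntegrableOn.congr hu h2, LocallyIntegrableOn.congr hdu h3,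
    fun φ dφ a1 a2 a3 a4 a5 => ?_⟩
  have hdu' : du =ᵐ[volume.restrict (tsupport φ)] du' :=
    ae_mono (Measure.restrict_mono a5 le_rfl) hdu
  have e1 : (fun x => f x (du x)) =ᵐ[volume.restrict (tsupport φ)] fun x => f x (du' x) :=
    hdu'.mono fun x hx => by simp only [hx]
  have e2 : (fun x => f x (du x + dφ x)) =ᵐ[volume.restrict (tsupport φ)]
      fun x => f x (du' x + dφ x) := hdu'.mono fun x hx => by simp only [hx]
  obtain ⟨b1, b2⟩ := h4 φ dφ a1 a2 a3 a4 a5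
  refine ⟨b1.congr e1, fun b3 => ?_⟩
  rw [← integral_congr_ae e1, ← integral_congr_ae e2]
  exact b2 (b3.congr e2.symm)

theorem jfun_congr {V : Set (Eu n)} {p : ℝ} {u u' : Eu n → ℝ} {du du' : Eu n → Eu n}
    (hu : u =ᵐ[volume.restrict V] u') (hdu : du =ᵐ[volume.restrict V] du') (l : ℝ) {r : ℝ}
    (hr : ball 0 r ⊆ V) : Jfun n p u du l r = Jfun n p u' du' l r := by
  have hu' : u =ᵐ[volume.restrict (ball 0 r)] u' := ae_mono (Measure.restrict_mono hr le_rfl) hu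
  have hdu' : du =ᵐ[volume.restrict (ball 0 r)] du' :=
    ae_mono (Measure.restrict_mono hr le_rfl) hdu
  have hset : (ball (0 : Eu n) r ∩ {x | l < u x} : Set (Eu n)) =ᵐ[volume]
      (ball (0 : Eu n) r ∩ {x | l < u' x} : Set (Eu n)) := by
    filter_upwards [(ae_restrict_iff' measurableSet_ball).1 hu'] with x hx
    refine propext (and_congr_right fun hxb => ?_)
    show l < u x ↔ l < u' x
    rw [hx hxb]
  unfold Jfun
  congr 1
  · exact integral_congr_ae (hu'.mono fun x hx => by simp only [hx])
  · rw [setIntegral_congr_set hset]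
    have h2 : du =ᵐ[volume.restrict (ball 0 r ∩ {x | l < u' x})] du' :=
      ae_mono (Measure.restrict_mono inter_subset_left le_rfl) hdu'
    exact integral_congr_ae (h2.mono fun x hx => by simp only [hx])

end representatives

/-- **One-step improvement (Step 2 of the proof of Theorem 3.2).**
For a `Q`-minimizer `u` of `F[u,A] = ∫_A f(x,∇u)` under `(p,q)`-growth with inhomogeneity
`g`, `B₁ ⋐ Ω`, `1 ≤ p < min{q,n}`, `ε := min{1/q + 1/(n−1), 1} − 1/p ≥ 0`, there are
`c₁ = c₁(n,p,q,Q) ≥ 1` and `c₂ = c₂(n,p) ≥ 1` such that for all `k > h ≥ 0`,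
`1/2 ≤ ρ < σ < 1`:
`J(k,ρ) ≤ c₁ (ω(c₂ J(h,σ)^{p_n^*/p} (k−h)^{−p_n^*})
  + L (J(h,σ)^{1/p}/(k−h))^{p_n^* q ε} J(h,σ)^{q/p} (σ−ρ)^{−γ}
  + (J(h,σ)^{1/p}/(k−h))^{p_n^* p/n} J(h,σ))`,
where `p_n^* = pn/(n−p)` and `γ = q − 1 + q min{1/q + 1/(n−1), 1}`. -/
theorem one_step_improvement
    (n : ℕ) (hn : 2 ≤ n)
    (p q Q : ℝ) (hp : 1 ≤ p) (hpq : p < q) (hpn : p < (n : ℝ)) (hQ : 1 ≤ Q)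
    (hε : 0 ≤ min (1 / q + 1 / ((n : ℝ) - 1)) 1 - 1 / p) :
    ∃ c₁ c₂ : ℝ, 1 ≤ c₁ ∧ 1 ≤ c₂ ∧
      ∀ (Ω : Set (EuclideanSpace ℝ (Fin n))),
        IsOpen Ω → IsConnected Ω → Bornology.IsBounded Ω →
        closedBall (0 : EuclideanSpace ℝ (Fin n)) 1 ⊆ Ω →
      ∀ L μ : ℝ, 1 ≤ L → 0 ≤ μ →
      ∀ g : EuclideanSpace ℝ (Fin n) → ℝ,
        (∀ᵐ x ∂volume.restrict Ω, 0 ≤ g x) →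
        AEMeasurable g (volume.restrict Ω) →
        IntegrableOn (fun x => g x ^ (p / (p - 1))) Ω →
      ∀ f : EuclideanSpace ℝ (Fin n) → EuclideanSpace ℝ (Fin n) → ℝ,
        (∀ z : EuclideanSpace ℝ (Fin n),
          AEMeasurable (fun x => f x z) (volume.restrict Ω)) →
        (∀ᵐ x ∂volume.restrict Ω, Continuous fun z => f x z) →
        (∀ᵐ x ∂volume.restrict Ω, ConvexOn ℝ univ fun z => f x z) →
        (∀ᵐ x ∂volume.restrict Ω, ∀ z : EuclideanSpace ℝ (Fin n),
          ‖z‖ ^ p - g x ^ (p / (p - 1)) ≤ f x z ∧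
            f x z ≤ L * ‖z‖ ^ q + g x ^ (p / (p - 1))) →
        (∀ᵐ x ∂volume.restrict Ω, ∀ z : EuclideanSpace ℝ (Fin n),
          f x (2 • z) ≤ μ + L * f x z) →
      ∀ (u : EuclideanSpace ℝ (Fin n) → ℝ)
        (du : EuclideanSpace ℝ (Fin n) → EuclideanSpace ℝ (Fin n)),
        IsQMinimizer n Ω f Q u du →
      ∀ h k ρ σ : ℝ, 0 ≤ h → h < k → 1 / 2 ≤ ρ → ρ < σ → σ < 1 →
        Jfun n p u du k ρ
          ≤ c₁ * (omegaFn n p g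
              (c₂ * Jfun n p u du h σ ^ ((p * n / ((n : ℝ) - p)) / p) *
                (k - h) ^ (-(p * n / ((n : ℝ) - p)))) +
            L * (Jfun n p u du h σ ^ (1 / p) / (k - h))
                ^ ((p * n / ((n : ℝ) - p)) * q *
                  (min (1 / q + 1 / ((n : ℝ) - 1)) 1 - 1 / p)) *
              Jfun n p u du h σ ^ (q / p) *
              (σ - ρ) ^ (-(q - 1 + q * min (1 / q + 1 / ((n : ℝ) - 1)) 1)) +
            (Jfun n p u du h σ ^ (1 / p) / (k - h))
                ^ ((p * n / ((n : ℝ) - p)) * p / (n : ℝ)) *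
              Jfun n p u du h σ) := by
  obtain ⟨d, rfl⟩ : ∃ d, n = d + 1 := ⟨n - 1, by omega⟩
  have hd : 1 ≤ d := by omega
  have hdc : ((d + 1 : ℕ) : ℝ) - 1 = d := by push_cast; ring
  have hp0 : 0 < p := by linarith
  have hq0 : 0 < q := by linarith
  rw [hdc] at hε ⊢
  set M : ℝ := min (1 / q + 1 / (d : ℝ)) 1 with hM
  have hMp : 1 / p ≤ M := by linarith
  have hM0 : 0 < M := lt_of_lt_of_le (by positivity) hMp
  have hMm : 1 / (1 / M) = M := one_div_one_div M
  have hqM : q / (1 / M) = q * M := by rw [div_div_eq_mul_div, div_one]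
  obtain ⟨c₁, c₂, h1, h2, hmain⟩ := exists_one_step_const hd (m := 1 / M) hp hpq hpn
    (by rw [le_div_iff₀ hM0, one_mul]; exact min_le_right _ _)
    (by rwa [one_div_le hM0 hp0]) hMm hQ
  refine ⟨c₁, c₂, h1, h2, ?_⟩
  intro Ω hΩ _ _ hBΩ L _ hL _ g hg0 hgm hgi f hfm hfc hfx hgr _ u du hQm h k ρ σ _ hhk hρ hρσ hσ
  obtain ⟨u', hu'm, hu'⟩ := hQm.2.1.aestronglyMeasurable
  obtain ⟨du', hdu'm, hdu'⟩ := hQm.2.2.1.aestronglyMeasurable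
  have H : IsGrowthMinimizer (d + 1) Ω p q Q L (fun x => g x ^ (p / (p - 1))) f u' du' :=
    { isOpen := hΩ
      closedBall_subset := hBΩ
      one_le_exponent := hp
      one_lt_exponent := by linarith
      one_le_const := hQ
      const_nonneg := by linarith
      nonneg := hg0.mono fun x hx => Real.rpow_nonneg hx _
      integrableOn := hgi
      aemeasurable := hfm
      continuous := hfc
      convexOn := hfx
      growth := hgr
      isQMinimizer := hQm.congr hu' hdu'
      measurable := hu'm.measurable
      measurable_grad := hdu'm.measurable }
  have hball : ∀ r < 1, ball (0 : EuclideanSpace ℝ (Fin (d + 1))) r ⊆ Ω := fun r hr =>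
    (ball_subset_closedBall.trans (closedBall_subset_closedBall hr.le)).trans hBΩ
  have hres := hmain Ω L g f u' du' H hg0 hgm h k ρ σ hhk hρ hρσ hσ
  rw [← jfun_congr hu' hdu' k (hball ρ (by linarith)), ← jfun_congr hu' hdu' h (hball σ hσ),
    hMm, hqM] at hres
  exact hres
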